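/- For t ≥ 0 let N(t) := #{(a, b) ∈ ℤ² : a² + b² ≤ t²} be the number of lattice points in the closed disc of radius t. Let δ : [2, ∞) → (0, ∞) be a function with δ(X) → 0 and log(1/δ(X))/log X → 0 as X → ∞. Then for all fixed real numbers α < β: (1/X) · Leb{ x ∈ [X, 2X] : (N(x + δ(X)) − N(x) − π((x + δ(X))² − x²)) / (4 √x · √(δ(X) log(1/δ(X)))) ∈ (α, β] } → (1/√(2π)) ∫_α^β e^{−t²/2} dt as X → ∞. -/

import Mathlib

open Real Filter Topology MeasureTheory

/-- `N(t)`: the number of lattice points in the closed disc of radius `t`. -/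
noncomputable def latticeCount (t : ℝ) : ℕ :=
  Nat.card {p : ℤ × ℤ // ((p.1 : ℝ) ^ 2 + (p.2 : ℝ) ^ 2) ≤ t ^ 2}

/-- The squared Euclidean norm of a lattice point, as a natural number. -/
def latNorm (z : ℤ × ℤ) : ℕ := z.1.natAbs ^ 2 + z.2.natAbs ^ 2

theorem cast_latNorm (z : ℤ × ℤ) : (latNorm z : ℝ) = (z.1 : ℝ) ^ 2 + (z.2 : ℝ) ^ 2 := by
  simp [latNorm, Nat.cast_natAbs]

theorem latNorm_eq_zero {z : ℤ × ℤ} : latNorm z = 0 ↔ z = 0 := by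
  simp [latNorm, Prod.ext_iff]

theorem finite_latNorm_le (n : ℕ) : {z : ℤ × ℤ | latNorm z ≤ n}.Finite := by
  refine ((Set.finite_Icc (-(n : ℤ)) n).prod (Set.finite_Icc (-(n : ℤ)) n)).subset ?_
  rintro ⟨a, b⟩ h
  simp only [latNorm, Set.mem_ofPred_eq] at h
  have ha : a.natAbs ≤ n := by nlinarith [Nat.le_self_pow two_ne_zero a.natAbs]
  have hb : b.natAbs ≤ n := by nlinarith [Nat.le_self_pow two_ne_zero b.natAbs]
  simp only [Set.mem_prod, Set.mem_Icc]
  omega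

/-- The number of representations of `n` as an ordered sum of two integer squares. -/
noncomputable def repCount (n : ℕ) : ℕ := Nat.card {z : ℤ × ℤ // latNorm z = n}

instance finite_latNorm_fiber (n : ℕ) : Finite {z : ℤ × ℤ // latNorm z = n} :=
  ((finite_latNorm_le n).subset fun _ h => le_of_eq h).to_subtype

theorem repCount_zero : repCount 0 = 1 := by
  rw [repCount, Nat.card_eq_one_iff_unique]
  refine ⟨⟨fun a b => Subtype.ext ?_⟩, ⟨⟨0, latNorm_eq_zero.2 rfl⟩⟩⟩
  rw [latNorm_eq_zero.1 a.2, latNorm_eq_zero.1 b.2]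

theorem ENNReal.tsum_comp_eq_tsum_card_fiber {α : Type*} (N : α → ℕ)
    [∀ n, Finite {a // N a = n}] (f : ℕ → ENNReal) :
    ∑' a, f (N a) = ∑' n, (Nat.card {a // N a = n} : ENNReal) * f n := by
  rw [← (Equiv.sigmaFiberEquiv N).tsum_eq, ENNReal.tsum_sigma']
  refine tsum_congr fun n => ?_
  have : ∀ c : {a // N a = n}, f (N ((Equiv.sigmaFiberEquiv N) ⟨n, c⟩)) = f n := fun c => by
    simp [Equiv.sigmaFiberEquiv, c.2]
  rw [tsum_congr this, ENNReal.tsum_const, ENat.card_eq_coe_natCard]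
  simp

theorem ENNReal.tsum_latNorm (f : ℕ → ENNReal) :
    ∑' z, f (latNorm z) = ∑' n, (repCount n : ENNReal) * f n :=
  ENNReal.tsum_comp_eq_tsum_card_fiber latNorm f

theorem hasSum_repCount {f : ℕ → ℝ} (hf : Summable fun z => f (latNorm z)) :
    HasSum (fun n => (repCount n : ℝ) * f n) (∑' z, f (latNorm z)) := by
  have h := ((Equiv.sigmaFiberEquiv latNorm).hasSum_iff.2 hf.hasSum).sigma
    (g := fun n => (repCount n : ℝ) * f n) fun n => ?_
  · exact h
  · have : (fun c : {z : ℤ × ℤ // latNorm z = n} =>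
        ((fun z => f (latNorm z)) ∘ (Equiv.sigmaFiberEquiv latNorm)) ⟨n, c⟩) =
        fun _ => f n := by
      funext c
      simp [Equiv.sigmaFiberEquiv, c.2]
    rw [this]
    have := Fintype.ofFinite {z : ℤ × ℤ // latNorm z = n}
    convert! hasSum_fintype (fun _ : {z : ℤ × ℤ // latNorm z = n} => f n) using 1
    simp [repCount, Nat.card_eq_fintype_card]

theorem summable_latNorm_iff {f : ℕ → ℝ} (hf : ∀ n, 0 ≤ f n) :
    (Summable fun z => f (latNorm z)) ↔ Summable fun n => (repCount n : ℝ) * f n := by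
  refine ⟨fun h => (hasSum_repCount h).summable, fun h => ?_⟩
  have h1 : ∑' z, ENNReal.ofReal (f (latNorm z)) ≠ ⊤ := by
    rw [ENNReal.tsum_latNorm fun n => ENNReal.ofReal (f n)]
    have : ∀ n, (repCount n : ENNReal) * ENNReal.ofReal (f n) =
        ENNReal.ofReal ((repCount n : ℝ) * f n) := fun n => by
      rw [ENNReal.ofReal_mul (Nat.cast_nonneg _), ENNReal.ofReal_natCast]
    rw [tsum_congr this, ← ENNReal.ofReal_tsum_of_nonneg
      (fun n => mul_nonneg (Nat.cast_nonneg _) (hf n)) h]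
    exact ENNReal.ofReal_ne_top
  refine (ENNReal.summable_toReal h1).congr fun z => ?_
  rw [ENNReal.toReal_ofReal (hf _)]

theorem summable_latNorm_rpow {s : ℝ} (hs : 1 < s) :
    Summable fun z : ℤ × ℤ => (latNorm z : ℝ) ^ (-s) := by
  have h := EisensteinSeries.summable_one_div_norm_rpow (k := 2 * s) (by linarith)
  rw [← (finTwoArrowEquiv ℤ).symm.summable_iff] at h
  refine h.of_nonneg_of_le (fun z => by positivity) fun z => ?_
  rcases eq_or_ne z 0 with rfl | hz
  · rw [latNorm_eq_zero.2 rfl, Nat.cast_zero, Real.zero_rpow (by linarith)]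
    exact Real.rpow_nonneg (norm_nonneg _) _
  · have hpos : 0 < ‖(finTwoArrowEquiv ℤ).symm z‖ := by
      rw [norm_pos_iff]
      intro h0
      exact hz (by rw [← (finTwoArrowEquiv ℤ).apply_symm_apply z, h0]; rfl)
    have hle : ‖(finTwoArrowEquiv ℤ).symm z‖ ^ 2 ≤ (latNorm z : ℝ) := by
      rw [EisensteinSeries.norm_eq_max_natAbs]
      simp only [finTwoArrowEquiv_symm_apply, Matrix.cons_val_zero, Matrix.cons_val_one, latNorm]
      norm_cast
      rcases max_choice z.1.natAbs z.2.natAbs with h | h <;> rw [h] <;> simp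
    show _ ≤ ‖(finTwoArrowEquiv ℤ).symm z‖ ^ (-(2 * s))
    rw [show -(2 * s) = ((2 : ℕ) : ℝ) * (-s) by push_cast; ring, Real.rpow_mul (norm_nonneg _),
      Real.rpow_natCast]
    exact Real.rpow_le_rpow_of_nonpos (by positivity) hle (by linarith)

theorem summable_repCount_rpow {s : ℝ} (hs : 1 < s) :
    Summable fun n : ℕ => (repCount n : ℝ) * (n : ℝ) ^ (-s) :=
  (summable_latNorm_iff fun n => by positivity).1 (summable_latNorm_rpow hs)

/-- The analytic extension of `t ↦ (1 - t ^ 2) ^ (3 / 2) * exp (2 π i y t)` to the upper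
half-plane. -/
noncomputable def rieszIntegrand (y : ℝ) (t : ℂ) : ℂ :=
  (1 - t ^ 2) ^ ((3 / 2 : ℝ) : ℂ) * Complex.exp (2 * π * y * t * Complex.I)

theorem re_pos_or_im_ne_zero_one_sub_sq {t : ℂ} (hb : 0 < t.im) :
    0 < (1 - t ^ 2).re ∨ (1 - t ^ 2).im ≠ 0 := by
  by_cases h : t.re = 0
  · left
    simp [pow_two, h]
    nlinarith
  · right
    simp [pow_two]
    intro h'
    exact mul_ne_zero h hb.ne' (by linarith)

theorem differentiableAt_rieszIntegrand (y : ℝ) {t : ℂ} (hb : 0 < t.im) :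
    DifferentiableAt ℂ (rieszIntegrand y) t := by
  unfold rieszIntegrand
  refine DifferentiableAt.mul (DifferentiableAt.cpow_const (by fun_prop) ?_) (by fun_prop)
  exact re_pos_or_im_ne_zero_one_sub_sq hb

theorem continuousAt_rieszIntegrand (y : ℝ) {t : ℂ} (h1 : |t.re| ≤ 1) (hb : 0 ≤ t.im) :
    ContinuousAt (rieszIntegrand y) t := by
  unfold rieszIntegrand
  refine ContinuousAt.mul ?_ (by fun_prop)
  refine ContinuousAt.comp (f := fun t : ℂ => 1 - t ^ 2)
    (g := fun w : ℂ => w ^ ((3 / 2 : ℝ) : ℂ)) ?_ (by fun_prop)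
  refine Complex.continuousAt_cpow_const_of_re_pos ?_ (by norm_num)
  rcases hb.eq_or_lt with hb | hb
  · left
    simp [pow_two, ← hb]
    nlinarith [abs_le.1 h1]
  · rcases re_pos_or_im_ne_zero_one_sub_sq hb with h | h
    · exact Or.inl h.le
    · exact Or.inr h

theorem rieszIntegrand_ofReal (y : ℝ) {t : ℝ} (ht : |t| ≤ 1) :
    (rieszIntegrand y t).re = (1 - t ^ 2) ^ (3 / 2 : ℝ) * cos (2 * π * (y * t)) := by
  have h : 0 ≤ 1 - t ^ 2 := by nlinarith [abs_le.1 ht]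
  have h2 : (1 - (t : ℂ) ^ 2) ^ ((3 / 2 : ℝ) : ℂ) = (((1 - t ^ 2) ^ (3 / 2 : ℝ) : ℝ) : ℂ) := by
    rw [Complex.ofReal_cpow h]; push_cast; rfl
  rw [rieszIntegrand, h2, Complex.re_ofReal_mul]
  congr 1
  rw [show (2 * π * y * t * Complex.I : ℂ) = ((2 * π * (y * t) : ℝ) : ℂ) * Complex.I by
    push_cast; ring, Complex.exp_ofReal_mul_I_re]

theorem Complex.ofReal_mul_cpow_of_nonneg {r : ℝ} (hr : 0 ≤ r) {z : ℂ} (hz : z ≠ 0) {w : ℂ}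
    (hw : w ≠ 0) : ((r : ℂ) * z) ^ w = (r : ℂ) ^ w * z ^ w := by
  rcases hr.eq_or_lt with rfl | hr
  · simp [hw]
  · have hr' : (r : ℂ) ≠ 0 := by exact_mod_cast hr.ne'
    rw [Complex.cpow_def_of_ne_zero (mul_ne_zero hr' hz), Complex.log_ofReal_mul hr hz,
      Complex.ofReal_log hr.le, add_mul, Complex.exp_add, ← Complex.cpow_def_of_ne_zero hr',
      ← Complex.cpow_def_of_ne_zero hz]

theorem Complex.ofReal_sub_two_mul_I_ne_zero (s : ℝ) : (s - 2 * Complex.I : ℂ) ≠ 0 := fun h => by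
  simpa using congrArg Complex.im h

theorem rieszIntegrand_right (y : ℝ) {s : ℝ} (hs : 0 ≤ s) :
    rieszIntegrand y (1 + s * Complex.I) = Complex.exp ((2 * π * y : ℝ) * Complex.I) *
      ((s ^ (3 / 2 : ℝ) * rexp (-(2 * π * y * s)) : ℝ) *
        (s - 2 * Complex.I : ℂ) ^ ((3 / 2 : ℝ) : ℂ)) := by
  have h1 : (1 - (1 + s * Complex.I) ^ 2 : ℂ) = (s : ℂ) * (s - 2 * Complex.I) := by
    linear_combination (-s ^ 2 : ℂ) * Complex.I_sq
  have h2 : Complex.exp (2 * π * y * (1 + s * Complex.I) * Complex.I) =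
      Complex.exp ((2 * π * y : ℝ) * Complex.I) * (rexp (-(2 * π * y * s)) : ℝ) := by
    rw [Complex.ofReal_exp, ← Complex.exp_add]
    congr 1
    push_cast
    linear_combination (2 * π * y * s : ℂ) * Complex.I_sq
  rw [rieszIntegrand, h1, h2, Complex.ofReal_mul (s ^ (3 / 2 : ℝ)), Complex.ofReal_cpow hs,
    Complex.ofReal_mul_cpow_of_nonneg hs (Complex.ofReal_sub_two_mul_I_ne_zero s) (by norm_num)]
  ring

theorem rieszIntegrand_left (y s : ℝ) :
    rieszIntegrand y (-1 + s * Complex.I) =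
      (starRingEnd ℂ) (rieszIntegrand y (1 + s * Complex.I)) := by
  have h : (1 - (-1 + s * Complex.I) ^ 2 : ℂ) =
      (starRingEnd ℂ) (1 - (1 + s * Complex.I) ^ 2 : ℂ) := by
    simp
    ring
  have harg : (1 - (1 + s * Complex.I) ^ 2 : ℂ).arg ≠ π := by
    rw [Ne, Complex.arg_eq_pi_iff]
    simp [pow_two]
    intro h h'
    nlinarith
  unfold rieszIntegrand
  rw [map_mul, ← Complex.exp_conj, h, Complex.conj_cpow _ _ harg, Complex.conj_ofReal]
  congr 2
  simp only [map_mul, map_add, map_one, Complex.conj_ofReal, Complex.conj_I, map_ofNat]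
  ring

theorem Complex.norm_cpow_sub_two_mul_I_sub_le {s : ℝ} (hs : 0 ≤ s) :
    ‖(s - 2 * Complex.I : ℂ) ^ ((3 / 2 : ℝ) : ℂ) - (-2 * Complex.I : ℂ) ^ ((3 / 2 : ℝ) : ℂ)‖ ≤
      3 / 2 * (s + 2) * s := by
  have hd : ∀ u : ℝ, HasDerivAt (fun u : ℝ => (u - 2 * Complex.I : ℂ) ^ ((3 / 2 : ℝ) : ℂ))
      (((3 / 2 : ℝ) : ℂ) * (u - 2 * Complex.I : ℂ) ^ ((1 / 2 : ℝ) : ℂ)) u := by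
    intro u
    have h1 : HasDerivAt (fun u : ℂ => u - 2 * Complex.I) 1 (u : ℂ) :=
      (hasDerivAt_id _).sub_const _
    have h2 := (h1.cpow_const (c := ((3 / 2 : ℝ) : ℂ)) (Or.inr (by simp))).comp_ofReal
    convert h2 using 1
    rw [mul_one, show ((3 / 2 : ℝ) : ℂ) - 1 = ((1 / 2 : ℝ) : ℂ) by push_cast; norm_num]
  have hb : ∀ u ∈ Set.Icc 0 s,
      ‖((3 / 2 : ℝ) : ℂ) * (u - 2 * Complex.I : ℂ) ^ ((1 / 2 : ℝ) : ℂ)‖ ≤ 3 / 2 * (s + 2) := by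
    intro u hu
    rw [norm_mul, Complex.norm_cpow_real, Complex.norm_real, Real.norm_of_nonneg (by norm_num)]
    gcongr
    have h1 : ‖(u - 2 * Complex.I : ℂ)‖ ≤ s + 2 := by
      refine (norm_sub_le _ _).trans ?_
      simp [abs_of_nonneg hu.1, hu.2]
    calc ‖(u - 2 * Complex.I : ℂ)‖ ^ (1 / 2 : ℝ) ≤ (s + 2) ^ (1 / 2 : ℝ) := by gcongr
      _ ≤ (s + 2) ^ (1 : ℝ) := Real.rpow_le_rpow_of_exponent_le (by linarith) (by norm_num)
      _ = s + 2 := Real.rpow_one _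
  have := (convex_Icc (0 : ℝ) s).norm_image_sub_le_of_norm_hasDerivWithin_le
    (fun u _ => (hd u).hasDerivWithinAt) hb (Set.left_mem_Icc.2 hs) (Set.right_mem_Icc.2 hs)
  simpa [abs_of_nonneg hs] using this

theorem Complex.neg_two_mul_I_cpow :
    (-2 * Complex.I : ℂ) ^ ((3 / 2 : ℝ) : ℂ) =
      (2 ^ (3 / 2 : ℝ) : ℝ) * Complex.exp ((-(3 * π / 4) : ℝ) * Complex.I) := by
  have h : (-2 * Complex.I : ℂ) = ((2 : ℝ) : ℂ) * (-Complex.I) := by push_cast; ring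
  rw [h, Complex.ofReal_mul_cpow_of_nonneg zero_le_two (by simp) (by norm_num),
    Complex.ofReal_cpow zero_le_two, Complex.cpow_def_of_ne_zero (x := -Complex.I) (by simp),
    Complex.log_neg_I]
  congr 2
  push_cast
  ring

theorem integral_one_sub_sq_rpow_mul_cos_eq (y : ℝ) {R : ℝ} (hR : 0 ≤ R) :
    ∫ t in (-1 : ℝ)..1, (1 - t ^ 2) ^ (3 / 2 : ℝ) * cos (2 * π * (y * t)) =
      (∫ t in (-1 : ℝ)..1, rieszIntegrand y (t + R * Complex.I)).re +
        2 * (∫ s in (0 : ℝ)..R, rieszIntegrand y (1 + s * Complex.I)).im := by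
  have key := Complex.integral_boundary_rect_eq_zero_of_continuousOn_of_differentiableOn
    (rieszIntegrand y) (-1) (1 + R * Complex.I) (fun t ht => by
      simp [Complex.mem_reProdIm, Set.uIcc_of_le hR] at ht
      exact (continuousAt_rieszIntegrand y (abs_le.2 ht.1) ht.2.1).continuousWithinAt)
    (fun t ht => by
      simp [Complex.mem_reProdIm, hR] at ht
      exact (differentiableAt_rieszIntegrand y ht.2.1).differentiableWithinAt)
  simp only [Complex.neg_re, Complex.one_re, Complex.add_re, Complex.mul_re, Complex.ofReal_re,
    Complex.I_re, Complex.ofReal_im, Complex.I_im, Complex.neg_im, Complex.one_im, Complex.add_im,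
    Complex.mul_im, mul_zero, mul_one, zero_add, add_zero, sub_zero, neg_zero, zero_mul,
    Complex.ofReal_zero, Complex.ofReal_one, Complex.ofReal_neg, smul_eq_mul] at key
  have hleft : ∫ s in (0 : ℝ)..R, rieszIntegrand y (-1 + s * Complex.I) =
      (starRingEnd ℂ) (∫ s in (0 : ℝ)..R, rieszIntegrand y (1 + s * Complex.I)) := by
    rw [intervalIntegral.integral_of_le hR, intervalIntegral.integral_of_le hR, ← integral_conj]
    exact setIntegral_congr_fun measurableSet_Ioc fun s _ => rieszIntegrand_left y s
  have hintg : IntervalIntegrable (fun t : ℝ => rieszIntegrand y t) volume (-1) 1 := by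
    refine ContinuousOn.intervalIntegrable fun t ht => ?_
    rw [Set.uIcc_of_le (by norm_num)] at ht
    exact ((continuousAt_rieszIntegrand y (by simpa using abs_le.2 ht) (by simp)).comp
      (f := fun t : ℝ => (t : ℂ)) Complex.continuous_ofReal.continuousAt).continuousWithinAt
  have hbot : ∫ t in (-1 : ℝ)..1, (1 - t ^ 2) ^ (3 / 2 : ℝ) * cos (2 * π * (y * t)) =
      (∫ t in (-1 : ℝ)..1, rieszIntegrand y t).re := by
    rw [← Complex.reCLM_apply, ← Complex.reCLM.intervalIntegral_comp_comm hintg]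
    refine intervalIntegral.integral_congr fun t ht => ?_
    rw [Set.uIcc_of_le (by norm_num)] at ht
    exact (rieszIntegrand_ofReal y (abs_le.2 ht)).symm
  rw [hleft] at key
  have hre := congrArg Complex.re key
  simp only [Complex.sub_re, Complex.add_re, Complex.mul_re, Complex.I_re, Complex.I_im,
    Complex.conj_re, Complex.conj_im, Complex.zero_re] at hre
  rw [hbot]
  linarith

theorem tendsto_integral_rieszIntegrand {y : ℝ} (hy : 1 ≤ y) :
    Tendsto (fun R : ℝ => ∫ t in (-1 : ℝ)..1, rieszIntegrand y (t + R * Complex.I)) atTop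
      (𝓝 0) := by
  have hb : ∀ R : ℝ, 0 ≤ R → ∀ t ∈ Set.uIoc (-1 : ℝ) 1,
      ‖rieszIntegrand y (t + R * Complex.I)‖ ≤ rexp 2 * ((2 + R) ^ 3 * rexp (-(2 + R))) := by
    intro R hR t ht
    rw [Set.uIoc_of_le (by norm_num)] at ht
    have ht' : |t| ≤ 1 := abs_le.2 ⟨ht.1.le, ht.2⟩
    rw [rieszIntegrand, norm_mul, Complex.norm_cpow_real, Complex.norm_exp]
    have h1 : ‖(t + R * Complex.I : ℂ)‖ ≤ 1 + R := by
      refine (norm_add_le _ _).trans ?_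
      simp [abs_of_nonneg hR, ht']
    have h2 : ‖(1 - (t + R * Complex.I) ^ 2 : ℂ)‖ ≤ (2 + R) ^ 2 := by
      refine (norm_sub_le _ _).trans ?_
      rw [norm_pow, norm_one]
      nlinarith [norm_nonneg (t + R * Complex.I : ℂ)]
    have h3 : (2 * π * y * (t + R * Complex.I) * Complex.I : ℂ).re ≤ 2 + -(2 + R) := by
      have : (2 * π * y * (t + R * Complex.I) * Complex.I : ℂ) =
          ((-(2 * π * y * R) : ℝ) : ℂ) + ((2 * π * y * t : ℝ) : ℂ) * Complex.I := by
        push_cast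
        linear_combination (2 * π * y * R : ℂ) * Complex.I_sq
      rw [this, Complex.add_re, Complex.re_ofReal_mul, Complex.ofReal_re, Complex.I_re]
      nlinarith [Real.pi_gt_three, mul_nonneg (mul_nonneg pi_pos.le (by linarith : 0 ≤ y - 1)) hR,
        mul_nonneg (by linarith [Real.pi_gt_three] : 0 ≤ π - 1) hR]
    calc _ ≤ ((2 + R) ^ 2) ^ (3 / 2 : ℝ) * rexp (2 + -(2 + R)) := by gcongr
      _ = _ := by
        rw [Real.exp_add, ← Real.rpow_natCast, ← Real.rpow_mul (by linarith)]
        norm_num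
        ring
  have hlim : Tendsto (fun R : ℝ => 2 * (rexp 2 * ((2 + R) ^ 3 * rexp (-(2 + R))))) atTop
      (𝓝 0) := by
    have := ((Real.tendsto_pow_mul_exp_neg_atTop_nhds_zero 3).comp
      (tendsto_atTop_add_const_left atTop (2 : ℝ) tendsto_id)).const_mul (rexp 2)
    simpa using this.const_mul 2
  refine squeeze_zero_norm' ?_ hlim
  filter_upwards [eventually_ge_atTop 0] with R hR
  refine (intervalIntegral.norm_integral_le_of_norm_le_const (hb R hR)).trans (le_of_eq ?_)
  norm_num
  ring

theorem exists_abs_integral_one_sub_sq_rpow_mul_cos_add_le :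
    ∃ C : ℝ, ∀ y : ℝ, 1 ≤ y →
      |(∫ t in (-1 : ℝ)..1, (1 - t ^ 2) ^ (3 / 2 : ℝ) * cos (2 * π * (y * t))) +
        3 / (4 * π ^ 2) * y ^ (-(5 / 2) : ℝ) * cos (2 * π * y - π / 4)| ≤
          C * y ^ (-(7 / 2) : ℝ) := by
  refine ⟨3 * (Real.Gamma (9 / 2) + 2 * Real.Gamma (7 / 2)), fun y hy => ?_⟩
  have hy0 : 0 < y := by linarith
  have hc0 : 0 < 2 * π * y := by positivity
  have hcy : y ≤ 2 * π * y := by nlinarith [Real.pi_gt_three]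
  have hintg : ∀ p : ℝ, -1 < p →
      IntegrableOn (fun s : ℝ => s ^ p * rexp (-(2 * π * y * s))) (Set.Ioi 0) := fun p hp => by
    simpa using integrableOn_rpow_mul_exp_neg_mul_rpow hp zero_lt_one hc0
  have hval : ∀ p : ℝ, -1 < p → ∫ s in Set.Ioi (0 : ℝ), s ^ p * rexp (-(2 * π * y * s)) =
      (2 * π * y) ^ (-(p + 1)) * Real.Gamma (p + 1) := fun p hp => by
    have := Real.integral_rpow_mul_exp_neg_mul_Ioi (a := p + 1) (by linarith) hc0
    rw [add_sub_cancel_right] at this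
    rw [this, one_div, Real.inv_rpow hc0.le, Real.rpow_neg hc0.le]
  set g : ℝ → ℝ := fun s => s ^ (3 / 2 : ℝ) * rexp (-(2 * π * y * s)) with hg
  set w : ℂ := (-2 * Complex.I : ℂ) ^ ((3 / 2 : ℝ) : ℂ) with hw
  set v : ℝ → ℂ := fun s => (s - 2 * Complex.I : ℂ) ^ ((3 / 2 : ℝ) : ℂ) with hv
  set E : ℝ → ℝ := fun s => 3 / 2 * (s ^ (7 / 2 : ℝ) * rexp (-(2 * π * y * s))) +
    3 * (s ^ (5 / 2 : ℝ) * rexp (-(2 * π * y * s))) with hE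
  have hEint : IntegrableOn E (Set.Ioi 0) :=
    ((hintg (7 / 2) (by norm_num)).const_mul _).add ((hintg (5 / 2) (by norm_num)).const_mul _)
  have hdiff : ∀ s ∈ Set.Ioi (0 : ℝ), ‖(g s : ℂ) * (v s - w)‖ ≤ E s := by
    intro s hs
    have hs : 0 < s := hs
    rw [norm_mul, Complex.norm_real, Real.norm_of_nonneg (by positivity)]
    calc g s * ‖v s - w‖ ≤ g s * (3 / 2 * (s + 2) * s) := by
          gcongr
          exact Complex.norm_cpow_sub_two_mul_I_sub_le hs.le
      _ = E s := by
          simp only [hg, hE]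
          rw [show (7 / 2 : ℝ) = 3 / 2 + 2 by norm_num, show (5 / 2 : ℝ) = 3 / 2 + 1 by norm_num,
            Real.rpow_add hs, Real.rpow_add hs, Real.rpow_one, Real.rpow_two]
          ring
  have hvc : Continuous v := by
    refine continuous_iff_continuousAt.2 fun s => ?_
    exact ContinuousAt.cpow (by fun_prop) continuousAt_const (Or.inr (by simp))
  have hgc : Continuous g := by
    have : Continuous fun s : ℝ => s ^ (3 / 2 : ℝ) := Real.continuous_rpow_const (by norm_num)
    fun_prop
  have hDint : IntegrableOn (fun s => (g s : ℂ) * (v s - w)) (Set.Ioi 0) :=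
    Integrable.mono' hEint (by fun_prop) ((ae_restrict_mem measurableSet_Ioi).mono hdiff)
  have hMint : IntegrableOn (fun s => (g s : ℂ) * w) (Set.Ioi 0) :=
    (hintg (3 / 2) (by norm_num)).ofReal.mul_const w
  have hfint : IntegrableOn (fun s => (g s : ℂ) * v s) (Set.Ioi 0) :=
    (hDint.add hMint).congr (Eventually.of_forall fun s => by simp; ring)
  set J : ℂ := ∫ s in Set.Ioi (0 : ℝ), (g s : ℂ) * v s with hJ
  have hJerr : ‖J - (((2 * π * y) ^ (-(5 / 2) : ℝ) * Real.Gamma (5 / 2) : ℝ) : ℂ) * w‖ ≤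
      3 / 2 * ((2 * π * y) ^ (-(9 / 2) : ℝ) * Real.Gamma (9 / 2)) +
        3 * ((2 * π * y) ^ (-(7 / 2) : ℝ) * Real.Gamma (7 / 2)) := by
    have h1 : J - (((2 * π * y) ^ (-(5 / 2) : ℝ) * Real.Gamma (5 / 2) : ℝ) : ℂ) * w =
        ∫ s in Set.Ioi (0 : ℝ), (g s : ℂ) * (v s - w) := by
      have h2 := hval (3 / 2) (by norm_num)
      norm_num at h2
      rw [← h2, ← integral_complex_ofReal, ← integral_mul_const, hJ, ← integral_sub hfint hMint]
      simp only [mul_sub, hg]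
    rw [h1]
    refine (norm_integral_le_of_norm_le hEint
      ((ae_restrict_mem measurableSet_Ioi).mono hdiff)).trans (le_of_eq ?_)
    rw [integral_add ((hintg (7 / 2) (by norm_num)).const_mul _)
      ((hintg (5 / 2) (by norm_num)).const_mul _), integral_const_mul, integral_const_mul,
      hval _ (by norm_num), hval _ (by norm_num)]
    norm_num
  have hmain : (∫ t in (-1 : ℝ)..1, (1 - t ^ 2) ^ (3 / 2 : ℝ) * cos (2 * π * (y * t))) =
      2 * (Complex.exp ((2 * π * y : ℝ) * Complex.I) * J).im := by
    have hlim1 := (Complex.continuous_re.tendsto 0).comp (tendsto_integral_rieszIntegrand hy)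
    have hlim2 := (Complex.continuous_im.tendsto _).comp
      ((intervalIntegral_tendsto_integral_Ioi 0 hfint tendsto_id).const_mul
        (Complex.exp ((2 * π * y : ℝ) * Complex.I)))
    have hlim := hlim1.add (hlim2.const_mul 2)
    rw [Complex.zero_re, zero_add] at hlim
    refine tendsto_nhds_unique (tendsto_const_nhds.congr' ?_) hlim
    filter_upwards [eventually_ge_atTop 0] with R hR
    rw [integral_one_sub_sq_rpow_mul_cos_eq y hR]
    simp only [Function.comp_apply, id_eq]
    congr 3
    rw [← intervalIntegral.integral_const_mul]
    refine intervalIntegral.integral_congr fun s hs => ?_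
    rw [Set.uIcc_of_le hR] at hs
    exact rieszIntegrand_right y hs.1
  have hM : 2 * (Complex.exp ((2 * π * y : ℝ) * Complex.I) *
      ((((2 * π * y) ^ (-(5 / 2) : ℝ) * Real.Gamma (5 / 2) : ℝ) : ℂ) * w)).im =
      -(3 / (4 * π ^ 2) * y ^ (-(5 / 2) : ℝ) * cos (2 * π * y - π / 4)) := by
    have hG : Real.Gamma (5 / 2) = 3 / 4 * √π := by
      rw [show (5 / 2 : ℝ) = 1 / 2 + 1 + 1 by norm_num, Real.Gamma_add_one (by norm_num),
        Real.Gamma_add_one (by norm_num), Real.Gamma_one_half_eq]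
      ring
    have h1 : Complex.exp ((2 * π * y : ℝ) * Complex.I) *
        ((((2 * π * y) ^ (-(5 / 2) : ℝ) * Real.Gamma (5 / 2) : ℝ) : ℂ) * w) =
        (((2 * π * y) ^ (-(5 / 2) : ℝ) * Real.Gamma (5 / 2) * 2 ^ (3 / 2 : ℝ) : ℝ) : ℂ) *
          Complex.exp ((2 * π * y - π / 4 - π / 2 : ℝ) * Complex.I) := by
      rw [hw, Complex.neg_two_mul_I_cpow, show ((2 * π * y - π / 4 - π / 2 : ℝ) * Complex.I : ℂ) =
        (2 * π * y : ℝ) * Complex.I + (-(3 * π / 4) : ℝ) * Complex.I by push_cast; ring,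
        Complex.exp_add]
      push_cast
      ring
    have h2 : (2 * π * y) ^ (-(5 / 2) : ℝ) * (√π * 2 ^ (3 / 2 : ℝ)) =
        1 / (2 * π ^ 2) * y ^ (-(5 / 2) : ℝ) := by
      rw [Real.mul_rpow (by positivity) hy0.le, Real.mul_rpow two_pos.le pi_pos.le,
        Real.sqrt_eq_rpow]
      have h3 : (2 : ℝ) ^ (-(5 / 2) : ℝ) * 2 ^ (3 / 2 : ℝ) = 1 / 2 := by
        rw [← Real.rpow_add two_pos]
        norm_num
      have h4 : π ^ (-(5 / 2) : ℝ) * π ^ (1 / 2 : ℝ) = 1 / π ^ 2 := by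
        rw [← Real.rpow_add pi_pos, show -(5 / 2) + 1 / 2 = (-2 : ℝ) by norm_num,
          Real.rpow_neg pi_pos.le, one_div, Real.rpow_two]
      linear_combination π ^ (-(5 / 2) : ℝ) * π ^ (1 / 2 : ℝ) * y ^ (-(5 / 2) : ℝ) * h3 +
        1 / 2 * y ^ (-(5 / 2) : ℝ) * h4
    rw [h1, Complex.im_ofReal_mul, Complex.exp_ofReal_mul_I_im, Real.sin_sub_pi_div_two, hG]
    linear_combination (-(3 / 2) * cos (2 * π * y - π / 4)) * h2
  have hfin : |2 * (Complex.exp ((2 * π * y : ℝ) * Complex.I) * J).im -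
      2 * (Complex.exp ((2 * π * y : ℝ) * Complex.I) *
      ((((2 * π * y) ^ (-(5 / 2) : ℝ) * Real.Gamma (5 / 2) : ℝ) : ℂ) * w)).im| ≤
      2 * (3 / 2 * ((2 * π * y) ^ (-(9 / 2) : ℝ) * Real.Gamma (9 / 2)) +
        3 * ((2 * π * y) ^ (-(7 / 2) : ℝ) * Real.Gamma (7 / 2))) := by
    rw [← mul_sub, ← Complex.sub_im, ← mul_sub, abs_mul, abs_two]
    gcongr
    refine (Complex.abs_im_le_norm _).trans ?_
    rwa [norm_mul, Complex.norm_exp_ofReal_mul_I, one_mul]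
  rw [hM, ← hmain, sub_neg_eq_add] at hfin
  refine hfin.trans ?_
  have h7 : (2 * π * y) ^ (-(7 / 2) : ℝ) ≤ y ^ (-(7 / 2) : ℝ) :=
    Real.rpow_le_rpow_of_nonpos hy0 hcy (by norm_num)
  have h9 : (2 * π * y) ^ (-(9 / 2) : ℝ) ≤ y ^ (-(7 / 2) : ℝ) :=
    (Real.rpow_le_rpow_of_nonpos hy0 hcy (by norm_num)).trans
      (Real.rpow_le_rpow_of_exponent_le hy (by norm_num))
  have g7 : 0 < Real.Gamma (7 / 2) := Real.Gamma_pos_of_pos (by norm_num)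
  have g9 : 0 < Real.Gamma (9 / 2) := Real.Gamma_pos_of_pos (by norm_num)
  nlinarith [mul_le_mul_of_nonneg_right h7 g7.le, mul_le_mul_of_nonneg_right h9 g9.le]

/-- The Fourier transform of the Riesz kernel `(1 - |v| ^ 2)₊` in the plane is a multiple of this
function of the norm. -/
noncomputable def rieszKernel (y : ℝ) : ℝ :=
  ∫ t in (-1 : ℝ)..1, (1 - t ^ 2) ^ (3 / 2 : ℝ) * cos (2 * π * (y * t))

theorem max_sub_sq_eq_zero {s y : ℝ} (hy : y ∉ Set.Ioc (-√s) (√s)) : max 0 (s - y ^ 2) = 0 := by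
  refine max_eq_left (sub_nonpos.2 ?_)
  by_contra! h
  have := Real.lt_sqrt_of_sq_lt (x := |y|) (by rwa [sq_abs])
  exact hy ⟨(abs_lt.1 this).1, (abs_lt.1 this).2.le⟩

theorem max_sub_sq_eq_self {s y : ℝ} (hs : 0 ≤ s) (hy : y ∈ Set.uIcc (-√s) (√s)) :
    max 0 (s - y ^ 2) = s - y ^ 2 := by
  rw [Set.uIcc_of_le (by linarith [Real.sqrt_nonneg s])] at hy
  refine max_eq_right (sub_nonneg.2 ?_)
  rw [← sq_abs, ← Real.sq_sqrt hs]
  exact pow_le_pow_left₀ (abs_nonneg _) (abs_le.2 hy) 2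

theorem integral_max_sub_sq (s : ℝ) :
    ∫ y : ℝ, max 0 (s - y ^ 2) = 4 / 3 * (max 0 s) ^ (3 / 2 : ℝ) := by
  rw [← setIntegral_eq_integral_of_forall_compl_eq_zero fun y hy => max_sub_sq_eq_zero hy,
    ← intervalIntegral.integral_of_le (by linarith [Real.sqrt_nonneg s])]
  rcases le_total s 0 with hs | hs
  · simp [Real.sqrt_eq_zero_of_nonpos hs, hs]
  · rw [intervalIntegral.integral_congr fun y hy => max_sub_sq_eq_self hs hy, max_eq_right hs,
      show (3 / 2 : ℝ) = 1 + 1 / 2 by norm_num, Real.rpow_add_of_nonneg hs (by norm_num)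
        (by norm_num), Real.rpow_one, ← Real.sqrt_eq_rpow]
    rw [intervalIntegral.integral_sub (by simp) (by simp)]
    simp [integral_pow]
    linear_combination (-2 / 3 * √s) * Real.sq_sqrt hs

theorem hasCompactSupport_max_sub_sq (x : ℝ) :
    HasCompactSupport fun p : ℝ × ℝ => max 0 (x ^ 2 - p.1 ^ 2 - p.2 ^ 2) := by
  refine HasCompactSupport.intro (K := Set.Icc (-|x|) |x| ×ˢ Set.Icc (-|x|) |x|)
    (isCompact_Icc.prod isCompact_Icc) fun p hp => max_eq_left ?_
  by_contra! h
  refine hp ⟨abs_le.1 (sq_le_sq.1 ?_), abs_le.1 (sq_le_sq.1 ?_)⟩ <;>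
    nlinarith [sq_nonneg p.1, sq_nonneg p.2]

/-- The Fourier transform of a radial function on the plane is radial. -/
theorem integral_exp_mul_comp_normSq (f : ℝ → ℂ) (w : ℂ) :
    ∫ v : ℂ, Complex.exp ((-2 * π * (v.re * w.re + v.im * w.im) : ℝ) * Complex.I) *
        f (Complex.normSq v) =
      ∫ v : ℂ, Complex.exp ((-2 * π * (v.re * ‖w‖) : ℝ) * Complex.I) * f (Complex.normSq v) := by
  set c : Circle := Circle.exp w.arg with hc
  have hw : w = ‖w‖ * (c : ℂ) := by
    rw [hc, Circle.coe_exp, Complex.norm_mul_exp_arg_mul_I]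
  have hc1 : (c : ℂ).re * (c : ℂ).re + (c : ℂ).im * (c : ℂ).im = 1 := by
    rw [← Complex.normSq_apply, Circle.normSq_coe]
  rw [← (rotation c).measurePreserving.integral_comp
    (rotation c).toHomeomorph.measurableEmbedding]
  refine integral_congr_ae (Eventually.of_forall fun v => ?_)
  simp only [rotation_apply, Complex.normSq_mul, Circle.normSq_coe, one_mul]
  congr 5
  have hre : w.re = ‖w‖ * (c : ℂ).re := by
    conv_lhs => rw [hw, Complex.re_ofReal_mul]
  have him : w.im = ‖w‖ * (c : ℂ).im := by
    conv_lhs => rw [hw, Complex.im_ofReal_mul]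
  rw [hre, him, Complex.mul_re, Complex.mul_im]
  linear_combination (v.re * ‖w‖) * hc1

theorem integrable_exp_mul_max_sub_sq (x k m : ℝ) :
    Integrable fun p : ℝ × ℝ => Complex.exp ((-2 * π * (p.1 * k + p.2 * m) : ℝ) * Complex.I) *
      ((max 0 (x ^ 2 - p.1 ^ 2 - p.2 ^ 2) : ℝ) : ℂ) := by
  refine Continuous.integrable_of_hasCompactSupport (by fun_prop) ?_
  refine HasCompactSupport.mul_left ?_
  exact (hasCompactSupport_max_sub_sq x).comp_left (g := fun r : ℝ => (r : ℂ)) Complex.ofReal_zero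

theorem integral_prod_exp_mul_max_sub_sq (x k m : ℝ) :
    ∫ u : ℝ, ∫ y : ℝ, Complex.exp ((-2 * π * (u * k + y * m) : ℝ) * Complex.I) *
        ((max 0 (x ^ 2 - u ^ 2 - y ^ 2) : ℝ) : ℂ) =
      ∫ v : ℂ, Complex.exp ((-2 * π * (v.re * k + v.im * m) : ℝ) * Complex.I) *
        ((max 0 (x ^ 2 - Complex.normSq v) : ℝ) : ℂ) := by
  rw [← integral_prod _ (integrable_exp_mul_max_sub_sq x k m),
    ← (Complex.volume_preserving_equiv_real_prod.symm).integral_comp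
      Complex.measurableEquivRealProd.symm.measurableEmbedding]
  refine integral_congr_ae (Eventually.of_forall fun p => ?_)
  simp only [Complex.measurableEquivRealProd_symm_apply, Complex.normSq_mk]
  congr 3
  ring_nf

theorem integral_exp_mul_one_sub_sq_rpow (y : ℝ) :
    ∫ t in (-1 : ℝ)..1, Complex.exp ((-2 * π * (y * t) : ℝ) * Complex.I) *
        (((1 - t ^ 2) ^ (3 / 2 : ℝ) : ℝ) : ℂ) = (rieszKernel y : ℂ) := by
  set f : ℝ → ℂ := fun t => Complex.exp ((-2 * π * (y * t) : ℝ) * Complex.I) *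
        (((1 - t ^ 2) ^ (3 / 2 : ℝ) : ℝ) : ℂ) with hf
  have hc : Continuous fun t : ℝ => (1 - t ^ 2) ^ (3 / 2 : ℝ) :=
    Continuous.rpow_const (by fun_prop) fun _ => Or.inr (by norm_num)
  have hfc : Continuous f := by fun_prop
  have hfn : Continuous fun t => f (-t) := hfc.comp continuous_neg
  have h1 : ∫ t in (-1 : ℝ)..1, f (-t) = ∫ t in (-1 : ℝ)..1, f t := by
    rw [intervalIntegral.integral_comp_neg, neg_neg]
  have h2 : (∫ t in (-1 : ℝ)..1, f t) + ∫ t in (-1 : ℝ)..1, f (-t) = 2 * (rieszKernel y : ℂ) := by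
    rw [← intervalIntegral.integral_add (hfc.intervalIntegrable _ _)
      (hfn.intervalIntegrable _ _), rieszKernel,
      ← intervalIntegral.integral_ofReal, ← intervalIntegral.integral_const_mul]
    refine intervalIntegral.integral_congr fun t _ => ?_
    have h3 : ((cos (2 * π * (y * t)) : ℝ) : ℂ) =
        (Complex.exp ((2 * π * (y * t) : ℝ) * Complex.I) +
          Complex.exp (-((2 * π * (y * t) : ℝ) : ℂ) * Complex.I)) / 2 := by
      rw [Complex.ofReal_cos, Complex.cos]
    simp only [hf]
    rw [Complex.ofReal_mul ((1 - t ^ 2) ^ (3 / 2 : ℝ)), h3,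
        show (-2 * π * (y * -t) : ℝ) = 2 * π * (y * t) by ring,
      show (-2 * π * (y * t) : ℝ) = -(2 * π * (y * t)) by ring, Complex.ofReal_neg, neg_sq]
    ring
  rw [h1] at h2
  linear_combination h2 / 2

theorem integral_radial_exp_mul_max_sub_sq {x : ℝ} (hx : 0 < x) (k m : ℝ) :
    ∫ u : ℝ, ∫ y : ℝ, Complex.exp ((-2 * π * (u * k + y * m) : ℝ) * Complex.I) *
        ((max 0 (x ^ 2 - u ^ 2 - y ^ 2) : ℝ) : ℂ) =
      ((4 / 3 * x ^ 4 * rieszKernel (x * √(k ^ 2 + m ^ 2)) : ℝ) : ℂ) := by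
  have h := integral_exp_mul_comp_normSq (fun r => ((max 0 (x ^ 2 - r) : ℝ) : ℂ)) ⟨k, m⟩
  have hn : ‖(⟨k, m⟩ : ℂ)‖ = √(k ^ 2 + m ^ 2) := by
    rw [Complex.norm_def, Complex.normSq_mk]
    ring_nf
  simp only [hn] at h
  set ρ := √(k ^ 2 + m ^ 2)
  have h2 := integral_prod_exp_mul_max_sub_sq x ρ 0
  simp only [mul_zero, add_zero] at h2
  rw [integral_prod_exp_mul_max_sub_sq, h, ← h2]
  have h3 : ∀ u : ℝ, ∫ y : ℝ, Complex.exp ((-2 * π * (u * ρ) : ℝ) * Complex.I) *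
        ((max 0 (x ^ 2 - u ^ 2 - y ^ 2) : ℝ) : ℂ) =
      Complex.exp ((-2 * π * (u * ρ) : ℝ) * Complex.I) *
        ((4 / 3 * (max 0 (x ^ 2 - u ^ 2)) ^ (3 / 2 : ℝ) : ℝ) : ℂ) := fun u => by
    rw [integral_const_mul, integral_complex_ofReal, integral_max_sub_sq]
  simp only [h3]
  have hsupp : ∀ u : ℝ, u ∉ Set.Ioc (-x) x →
      Complex.exp ((-2 * π * (u * ρ) : ℝ) * Complex.I) *
        ((4 / 3 * (max 0 (x ^ 2 - u ^ 2)) ^ (3 / 2 : ℝ) : ℝ) : ℂ) = 0 := fun u hu => by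
    rw [max_sub_sq_eq_zero (by rwa [Real.sqrt_sq hx.le]), Real.zero_rpow (by norm_num)]
    simp
  rw [← setIntegral_eq_integral_of_forall_compl_eq_zero hsupp,
    ← intervalIntegral.integral_of_le (by linarith)]
  have h4 := intervalIntegral.smul_integral_comp_mul_left (a := -1) (b := 1)
    (f := fun u : ℝ => Complex.exp ((-2 * π * (u * ρ) : ℝ) * Complex.I) *
        ((4 / 3 * (max 0 (x ^ 2 - u ^ 2)) ^ (3 / 2 : ℝ) : ℝ) : ℂ)) x
  rw [mul_neg_one, mul_one] at h4
  rw [← h4, Complex.ofReal_mul, ← integral_exp_mul_one_sub_sq_rpow,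
    ← intervalIntegral.integral_const_mul, ← intervalIntegral.integral_smul]
  refine intervalIntegral.integral_congr fun t ht => ?_
  rw [Set.uIcc_of_le (by norm_num)] at ht
  have ht1 : 0 ≤ 1 - t ^ 2 := by nlinarith [ht.1, ht.2]
  have h5 : (max 0 (x ^ 2 - (x * t) ^ 2)) ^ (3 / 2 : ℝ) = x ^ 3 * (1 - t ^ 2) ^ (3 / 2 : ℝ) := by
    rw [show x ^ 2 - (x * t) ^ 2 = x ^ 2 * (1 - t ^ 2) by ring,
      max_eq_right (by positivity), Real.mul_rpow (by positivity) ht1, ← Real.rpow_natCast x 2,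
      ← Real.rpow_mul hx.le]
    norm_num
  simp only [h5, Complex.real_smul]
  rw [show x * t * ρ = x * ρ * t by ring]
  push_cast
  ring

theorem rieszKernel_zero : rieszKernel 0 = 3 * π / 8 := by
  have hc : Continuous fun t : ℝ => (1 - t ^ 2) ^ (3 / 2 : ℝ) :=
    Continuous.rpow_const (by fun_prop) fun _ => Or.inr (by norm_num)
  have h := intervalIntegral.integral_comp_mul_deriv (a := -(π / 2)) (b := π / 2)
    (fun x _ => Real.hasDerivAt_sin x) Real.continuous_cos.continuousOn hc
  rw [Real.sin_neg, Real.sin_pi_div_two] at h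
  have h2 : ∀ θ ∈ Set.uIcc (-(π / 2)) (π / 2),
      ((fun t : ℝ => (1 - t ^ 2) ^ (3 / 2 : ℝ)) ∘ sin) θ * cos θ = cos θ ^ 4 := fun θ hθ => by
    rw [Set.uIcc_of_le (by linarith [pi_pos])] at hθ
    have hcos := Real.cos_nonneg_of_mem_Icc hθ
    simp only [Function.comp_apply]
    rw [← Real.cos_sq', ← Real.rpow_natCast (cos θ) 2, ← Real.rpow_mul hcos]
    norm_num
    ring
  rw [intervalIntegral.integral_congr h2, integral_cos_pow, integral_cos_sq] at h
  simp [rieszKernel, ← h]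
  ring

theorem exists_abs_rieszKernel_le : ∃ C : ℝ, ∀ y : ℝ, 1 ≤ y →
    |rieszKernel y| ≤ C * y ^ (-(5 / 2) : ℝ) := by
  obtain ⟨C, hC⟩ := exists_abs_integral_one_sub_sq_rpow_mul_cos_add_le
  refine ⟨|C| + 3 / (4 * π ^ 2), fun y hy => ?_⟩
  have h := hC y hy
  rw [← rieszKernel] at h
  have h2 : |3 / (4 * π ^ 2) * y ^ (-(5 / 2) : ℝ) * cos (2 * π * y - π / 4)| ≤
      3 / (4 * π ^ 2) * y ^ (-(5 / 2) : ℝ) := by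
    rw [abs_mul, abs_of_nonneg (by positivity)]
    exact mul_le_of_le_one_right (by positivity) (Real.abs_cos_le_one _)
  have h3 : C * y ^ (-(7 / 2) : ℝ) ≤ |C| * y ^ (-(5 / 2) : ℝ) :=
    mul_le_mul (le_abs_self C) (Real.rpow_le_rpow_of_exponent_le hy (by norm_num))
      (by positivity) (abs_nonneg C)
  have h4 := abs_sub (rieszKernel y + 3 / (4 * π ^ 2) * y ^ (-(5 / 2) : ℝ) *
      cos (2 * π * y - π / 4))
    (3 / (4 * π ^ 2) * y ^ (-(5 / 2) : ℝ) * cos (2 * π * y - π / 4))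
  rw [add_sub_cancel_right] at h4
  linarith

/-- Poisson summation for compactly supported continuous functions with summable Fourier
transform. -/
theorem tsum_int_eq_tsum_fourier {f : ℝ → ℂ} (hc : Continuous f) (hs : HasCompactSupport f)
    (hF : Summable fun n : ℤ => FourierTransform.fourier f (n : ℝ)) :
    ∑' n : ℤ, f n = ∑' n : ℤ, FourierTransform.fourier f (n : ℝ) := by
  have hO : f =O[cocompact ℝ] fun x : ℝ => |x| ^ (-(2 : ℝ)) :=
    (Filter.coclosedCompact_eq_cocompact (X := ℝ) ▸
      hasCompactSupport_iff_eventuallyEq.1 hs).trans_isBigO (Asymptotics.isBigO_zero _ _)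
  simpa using Real.tsum_eq_tsum_fourier_of_rpow_decay_of_summable hc one_lt_two hO hF 0

theorem norm_fourier_max_sub_sq_le {s : ℝ} (hs : 0 ≤ s) {m : ℝ} (hm : 1 ≤ |m|) :
    ‖FourierTransform.fourier (fun y : ℝ => ((max 0 (s - y ^ 2) : ℝ) : ℂ)) m‖ ≤
      (4 * √s + 4) * |m| ^ (-(2 : ℝ)) := by
  have hm0 : m ≠ 0 := by
    rintro rfl
    simp at hm
    linarith
  set c : ℂ := (-2 * π * m : ℝ) * Complex.I with hc
  have hc0 : c ≠ 0 := by simp [hc, hm0, pi_ne_zero]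
  have hcn : |m| ≤ ‖c‖ := by
    rw [hc, norm_mul, Complex.norm_I, Complex.norm_real, Real.norm_eq_abs, abs_mul, abs_mul,
      abs_neg, abs_two, abs_of_pos pi_pos]
    nlinarith [pi_gt_three, abs_nonneg m]
  have hsupp : ∀ y : ℝ, y ∉ Set.Ioc (-√s) (√s) →
      Complex.exp ((-2 * π * y * m : ℝ) * Complex.I) • ((max 0 (s - y ^ 2) : ℝ) : ℂ) = 0 :=
    fun y hy => by rw [max_sub_sq_eq_zero hy, Complex.ofReal_zero, smul_zero]
  set P : ℝ → ℂ := fun y => Complex.exp (c * y) *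
    ((s - y ^ 2) / c + 2 * y / c ^ 2 - 2 / c ^ 3) with hP
  have hderiv : ∀ y : ℝ, HasDerivAt P (Complex.exp (c * y) * (s - y ^ 2)) y := fun y => by
    have h1 : HasDerivAt (fun z : ℂ => Complex.exp (c * z) *
        ((s - z ^ 2) / c + 2 * z / c ^ 2 - 2 / c ^ 3))
        (Complex.exp (c * y) * (c * 1) * ((s - y ^ 2) / c + 2 * y / c ^ 2 - 2 / c ^ 3) +
          Complex.exp (c * y) * ((-((2 : ℕ) * (y : ℂ) ^ (2 - 1) * 1)) / c + 2 * 1 / c ^ 2))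
        (y : ℂ) :=
      (((hasDerivAt_id _).const_mul c).cexp).mul
        (((((hasDerivAt_id _).pow 2).const_sub _).div_const c |>.add
          (((hasDerivAt_id _).const_mul 2).div_const _)).sub_const _)
    convert h1.comp_ofReal using 1
    push_cast
    field_simp
    ring
  have hval : ∫ y in (-√s)..(√s), Complex.exp (c * y) * (s - y ^ 2 : ℂ) = P (√s) - P (-√s) :=
    intervalIntegral.integral_eq_sub_of_hasDerivAt (fun y _ => hderiv y)
      (Continuous.intervalIntegrable (by fun_prop) _ _)
  have hb : ∀ y : ℝ, |y| = √s → ‖P y‖ ≤ (2 * √s + 2) * (|m| ^ 2)⁻¹ := fun y hy => by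
    have hy2 : (s - y ^ 2 : ℂ) = 0 := by
      rw [← Complex.ofReal_pow, ← sq_abs, hy, Real.sq_sqrt hs, sub_self]
    have he : ‖Complex.exp (c * y)‖ = 1 := by
      rw [show c * y = ((-2 * π * m * y : ℝ) : ℂ) * Complex.I by rw [hc]; push_cast; ring,
        Complex.norm_exp_ofReal_mul_I]
    simp only [hP]
    rw [norm_mul, he, one_mul, hy2, zero_div, zero_add]
    refine (norm_sub_le _ _).trans ?_
    rw [norm_div, norm_div, norm_mul, norm_pow, norm_pow, Complex.norm_real, Real.norm_eq_abs, hy,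
      Complex.norm_ofNat, add_mul, ← div_eq_mul_inv, ← div_eq_mul_inv]
    have : |m| ^ 2 ≤ ‖c‖ ^ 3 := (pow_le_pow_right₀ hm (by norm_num : 2 ≤ 3)).trans (by gcongr)
    gcongr
  rw [Real.fourier_real_eq_integral_exp_smul,
    ← setIntegral_eq_integral_of_forall_compl_eq_zero hsupp,
    ← intervalIntegral.integral_of_le (by linarith [Real.sqrt_nonneg s]),
    intervalIntegral.integral_congr (g := fun y : ℝ => Complex.exp (c * y) * (s - y ^ 2 : ℂ))]
  · rw [hval]
    refine (norm_sub_le _ _).trans ((add_le_add (hb _ (abs_of_nonneg (Real.sqrt_nonneg s)))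
      (hb _ (by rw [abs_neg, abs_of_nonneg (Real.sqrt_nonneg s)]))).trans (le_of_eq ?_))
    rw [Real.rpow_neg (abs_nonneg m), Real.rpow_two]
    ring
  · intro y hy
    simp only [max_sub_sq_eq_self hs hy, smul_eq_mul, hc]
    push_cast
    ring_nf

theorem fourier_slice_eq (x m u : ℝ) :
    FourierTransform.fourier (fun y : ℝ => ((max 0 (x ^ 2 - u ^ 2 - y ^ 2) : ℝ) : ℂ)) m =
      ∫ y in (-|x|)..|x|, Complex.exp ((-2 * π * y * m : ℝ) * Complex.I) •
        ((max 0 (x ^ 2 - u ^ 2 - y ^ 2) : ℝ) : ℂ) := by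
  rw [Real.fourier_real_eq_integral_exp_smul, intervalIntegral.integral_of_le (by simp),
    setIntegral_eq_integral_of_forall_compl_eq_zero]
  intro y hy
  rw [max_eq_left, Complex.ofReal_zero, smul_zero]
  by_contra! h
  have := abs_lt.1 (sq_lt_sq.1 (by nlinarith [sq_nonneg u] : y ^ 2 < x ^ 2))
  exact hy ⟨this.1, this.2.le⟩

theorem continuous_fourier_slice (x m : ℝ) : Continuous fun u : ℝ =>
    FourierTransform.fourier (fun y : ℝ => ((max 0 (x ^ 2 - u ^ 2 - y ^ 2) : ℝ) : ℂ)) m := by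
  simp only [fourier_slice_eq]
  exact intervalIntegral.continuous_parametric_intervalIntegral_of_continuous' (by fun_prop) _ _

theorem fourier_slice_eq_zero {x u : ℝ} (hu : |x| ≤ |u|) (m : ℝ) :
    FourierTransform.fourier (fun y : ℝ => ((max 0 (x ^ 2 - u ^ 2 - y ^ 2) : ℝ) : ℂ)) m = 0 := by
  have : ∀ y : ℝ, max 0 (x ^ 2 - u ^ 2 - y ^ 2) = 0 := fun y =>
    max_eq_left (by nlinarith [sq_le_sq.2 hu, sq_nonneg y])
  simp [Real.fourier_real_eq_integral_exp_smul, this]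

theorem summable_fourier_max_sub_sq (s : ℝ) : Summable fun m : ℤ =>
    FourierTransform.fourier (fun y : ℝ => ((max 0 (s - y ^ 2) : ℝ) : ℂ)) (m : ℝ) := by
  rcases le_total s 0 with hs | hs
  · have : ∀ y : ℝ, max 0 (s - y ^ 2) = 0 := fun y => max_eq_left (by nlinarith [sq_nonneg y])
    simp [Real.fourier_real_eq_integral_exp_smul, this, summable_zero]
  · refine Summable.of_norm_bounded_eventually
      ((Real.summable_abs_int_rpow one_lt_two).mul_left (4 * √s + 4)) ?_
    filter_upwards [(Set.finite_singleton (0 : ℤ)).compl_mem_cofinite] with m hm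
    refine norm_fourier_max_sub_sq_le hs ?_
    exact_mod_cast Int.one_le_abs hm

theorem fourier_fourier_slice {x : ℝ} (hx : 0 < x) (k m : ℝ) :
    FourierTransform.fourier (fun u : ℝ =>
      FourierTransform.fourier (fun y : ℝ => ((max 0 (x ^ 2 - u ^ 2 - y ^ 2) : ℝ) : ℂ)) m) k =
      ((4 / 3 * x ^ 4 * rieszKernel (x * √(k ^ 2 + m ^ 2)) : ℝ) : ℂ) := by
  rw [← integral_radial_exp_mul_max_sub_sq hx, Real.fourier_real_eq_integral_exp_smul]
  refine integral_congr_ae (Eventually.of_forall fun u => ?_)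
  simp only [Real.fourier_real_eq_integral_exp_smul, smul_eq_mul, ← integral_const_mul]
  refine integral_congr_ae (Eventually.of_forall fun y => ?_)
  simp only
  rw [← mul_assoc, ← Complex.exp_add]
  congr 2
  push_cast
  ring

theorem summable_rieszKernel_latNorm {x : ℝ} (hx : 1 ≤ x) :
    Summable fun z : ℤ × ℤ => rieszKernel (x * √(latNorm z)) := by
  obtain ⟨C, hC⟩ := exists_abs_rieszKernel_le
  refine Summable.of_norm_bounded_eventually
    ((summable_latNorm_rpow (s := 5 / 4) (by norm_num)).mul_left |C|) ?_
  filter_upwards [(Set.finite_singleton (0 : ℤ × ℤ)).compl_mem_cofinite] with z hz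
  have hn : (1 : ℝ) ≤ latNorm z := by
    exact_mod_cast Nat.one_le_iff_ne_zero.2 fun h => hz (latNorm_eq_zero.1 h)
  have hy : √(latNorm z) ≤ x * √(latNorm z) := le_mul_of_one_le_left (Real.sqrt_nonneg _) hx
  have hs : 1 ≤ √(latNorm z : ℝ) := by rwa [Real.one_le_sqrt]
  rw [Real.norm_eq_abs]
  calc _ ≤ C * (x * √(latNorm z)) ^ (-(5 / 2) : ℝ) := hC _ (hs.trans hy)
    _ ≤ |C| * (√(latNorm z)) ^ (-(5 / 2) : ℝ) :=
      mul_le_mul (le_abs_self C) (Real.rpow_le_rpow_of_nonpos (by linarith) hy (by norm_num))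
        (by positivity) (abs_nonneg C)
    _ = _ := by
      rw [Real.sqrt_eq_rpow, ← Real.rpow_mul (Nat.cast_nonneg _)]
      norm_num

/-- The first Riesz mean of the Gauss circle problem. -/
noncomputable def rieszMean (x : ℝ) : ℝ := ∑' z : ℤ × ℤ, max 0 (x ^ 2 - latNorm z)

theorem finite_support_max_sub_latNorm (x : ℝ) :
    (Function.support fun z : ℤ × ℤ => max 0 (x ^ 2 - (latNorm z : ℝ))).Finite := by
  refine (finite_latNorm_le ⌊x ^ 2⌋₊).subset fun z hz => ?_
  rw [Set.mem_ofPred_eq]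
  refine Nat.le_floor ?_
  by_contra! h
  exact hz (max_eq_left (by linarith))

theorem rieszMean_eq_tsum {x : ℝ} (hx : 1 ≤ x) :
    rieszMean x = ∑' z : ℤ × ℤ, 4 / 3 * x ^ 4 * rieszKernel (x * √(latNorm z)) := by
  have hx0 : 0 < x := by linarith
  set φ : ℝ → ℝ → ℂ := fun u y => ((max 0 (x ^ 2 - u ^ 2 - y ^ 2) : ℝ) : ℂ) with hφ
  set c : ℝ → ℝ → ℂ := fun u m => FourierTransform.fourier (φ u) m with hc
  have hsumK : Summable fun z : ℤ × ℤ =>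
      ((4 / 3 * x ^ 4 * rieszKernel (x * √(latNorm z)) : ℝ) : ℂ) :=
    Complex.ofRealCLM.summable ((summable_rieszKernel_latNorm hx).mul_left _)
  have hlat : ∀ a b : ℤ, (latNorm (a, b) : ℝ) = (a : ℝ) ^ 2 + (b : ℝ) ^ 2 := fun a b =>
    cast_latNorm _
  have hinner : ∀ a : ℤ, ∑' b : ℤ, φ a b = ∑' m : ℤ, c a m := fun a =>
    tsum_int_eq_tsum_fourier (f := φ a) (by fun_prop) (by
      refine HasCompactSupport.intro (K := Set.Icc (-|x|) |x|) isCompact_Icc fun y hy => ?_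
      simp only [hφ, Complex.ofReal_eq_zero]
      refine max_eq_left ?_
      by_contra! h
      exact hy (abs_le.1 (sq_le_sq.1 (by nlinarith [sq_nonneg (a : ℝ)]))))
      (summable_fourier_max_sub_sq _)
  have houter : ∀ m : ℤ, ∑' a : ℤ, c a m =
      ∑' k : ℤ, ((4 / 3 * x ^ 4 * rieszKernel (x * √(latNorm (m, k))) : ℝ) : ℂ) := fun m => by
    have hk : ∀ k : ℤ, FourierTransform.fourier (fun u => c u m) (k : ℝ) =
        ((4 / 3 * x ^ 4 * rieszKernel (x * √(latNorm (m, k))) : ℝ) : ℂ) := fun k => by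
      rw [fourier_fourier_slice hx0, hlat, add_comm]
    simp only [← hk]
    refine tsum_int_eq_tsum_fourier (continuous_fourier_slice x m) ?_ ?_
    · refine HasCompactSupport.intro (K := Set.Icc (-|x|) |x|) isCompact_Icc fun u hu => ?_
      refine fourier_slice_eq_zero ?_ _
      by_contra! h
      exact hu (abs_le.1 h.le)
    · exact (hsumK.prod_factor m).congr fun k => (hk k).symm
  have hswap : ∑' a : ℤ, ∑' m : ℤ, c a m = ∑' m : ℤ, ∑' a : ℤ, c a m := by
    set T : Finset ℤ := Finset.Icc (-⌈|x|⌉) ⌈|x|⌉ with hT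
    have hz : ∀ a ∉ T, ∀ m : ℤ, c a m = 0 := fun a ha m => by
      refine fourier_slice_eq_zero ?_ _
      by_contra! h
      refine ha (Finset.mem_Icc.2 (abs_le.1 ?_))
      exact_mod_cast h.le.trans (Int.le_ceil _)
    rw [tsum_eq_sum (s := T) fun a ha => by simp [hz a ha],
      ← Summable.tsum_finsetSum fun a _ => summable_fourier_max_sub_sq _]
    exact tsum_congr fun m => (tsum_eq_sum fun a ha => hz a ha m).symm
  have hG : (rieszMean x : ℂ) = ∑' a : ℤ, ∑' b : ℤ, φ a b := by
    rw [rieszMean, Complex.ofReal_tsum, Summable.tsum_prod]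
    · refine tsum_congr fun a => tsum_congr fun b => ?_
      rw [hlat, sub_add_eq_sub_sub]
    · exact summable_of_hasFiniteSupport ((finite_support_max_sub_latNorm x).subset fun z hz h =>
        hz (Complex.ofReal_eq_zero.2 h))
  apply Complex.ofReal_injective
  rw [hG, tsum_congr hinner, hswap, tsum_congr houter, Complex.ofReal_tsum, hsumK.tsum_prod]

/-- The almost periodic main term of the Riesz mean of the Gauss circle problem. -/
noncomputable def rieszOsc (x : ℝ) : ℝ :=
  ∑' n : ℕ, (repCount n : ℝ) * ((n : ℝ) ^ (-(5 / 4) : ℝ) * cos (2 * π * (√n * x) - π / 4))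

theorem hasSum_repCount_rpow_mul {s : ℝ} (hs : 1 < s) {c : ℕ → ℝ} (hc : ∀ n, |c n| ≤ 1) :
    HasSum (fun n : ℕ => (repCount n : ℝ) * ((n : ℝ) ^ (-s) * c n))
      (∑' z, (latNorm z : ℝ) ^ (-s) * c (latNorm z)) :=
  hasSum_repCount (f := fun n : ℕ => (n : ℝ) ^ (-s) * c n)
    (Summable.of_norm_bounded (summable_latNorm_rpow hs) fun z => by
      rw [norm_mul, Real.norm_of_nonneg (by positivity)]
      exact mul_le_of_le_one_right (by positivity) (hc _))

theorem exists_abs_rieszMean_sub_le : ∃ C : ℝ, 0 ≤ C ∧ ∀ x : ℝ, 1 ≤ x →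
    |rieszMean x - π * x ^ 4 / 2 + 1 / π ^ 2 * x ^ (3 / 2 : ℝ) * rieszOsc x| ≤ C * √x := by
  obtain ⟨C, hC⟩ := exists_abs_integral_one_sub_sq_rpow_mul_cos_add_le
  have hS := summable_latNorm_rpow (s := 7 / 4) (by norm_num)
  refine ⟨4 / 3 * |C| * ∑' z, (latNorm z : ℝ) ^ (-(7 / 4) : ℝ),
    mul_nonneg (by positivity) (tsum_nonneg fun z => by positivity), fun x hx => ?_⟩
  have hx0 : 0 < x := by linarith
  have hosc := hasSum_repCount_rpow_mul (s := 5 / 4) (by norm_num)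
    (c := fun n => cos (2 * π * (√n * x) - π / 4)) (fun n => Real.abs_cos_le_one _)
  have hosc2 : Summable fun z => (latNorm z : ℝ) ^ (-(5 / 4) : ℝ) *
      cos (2 * π * (√(latNorm z) * x) - π / 4) :=
    Summable.of_norm_bounded (summable_latNorm_rpow (s := 5 / 4) (by norm_num)) fun z => by
      rw [norm_mul, Real.norm_of_nonneg (by positivity)]
      exact mul_le_of_le_one_right (by positivity) (Real.abs_cos_le_one _)
  have hK := (summable_rieszKernel_latNorm hx).mul_left (4 / 3 * x ^ 4)
  rw [rieszMean_eq_tsum hx, rieszOsc, hosc.tsum_eq, ← tsum_mul_left,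
    hK.tsum_eq_add_tsum_ite 0, show latNorm 0 = 0 from rfl]
  simp only [Nat.cast_zero, Real.sqrt_zero, mul_zero, rieszKernel_zero]
  rw [show ∀ A B : ℝ, 4 / 3 * x ^ 4 * (3 * π / 8) + A - π * x ^ 4 / 2 + B = A + B by
    intros; ring, ← Summable.tsum_add ?_ (hosc2.mul_left _)]
  · rw [← tsum_mul_left, ← tsum_mul_right, ← Real.norm_eq_abs]
    refine tsum_of_norm_bounded ((hS.mul_left _).mul_right _).hasSum fun z => ?_
    rw [Real.norm_eq_abs]
    by_cases hz : z = 0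
    · subst hz
      simp [show latNorm 0 = 0 from rfl]
    · have hn : (1 : ℝ) ≤ latNorm z := by
        exact_mod_cast Nat.one_le_iff_ne_zero.2 fun h => hz (latNorm_eq_zero.1 h)
      have hs : 1 ≤ √(latNorm z : ℝ) := by rwa [Real.one_le_sqrt]
      have h := hC (x * √(latNorm z)) (by nlinarith)
      rw [← rieszKernel] at h
      rw [if_neg hz]
      have hpow : ∀ p : ℝ, (x * √(latNorm z)) ^ (-p) = x ^ (-p) * (latNorm z : ℝ) ^ (-(p / 2)) :=
        fun p => by
        rw [Real.mul_rpow hx0.le (by positivity), Real.sqrt_eq_rpow,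
          ← Real.rpow_mul (Nat.cast_nonneg _)]
        ring_nf
      have hx4 : x ^ 4 = x ^ (4 : ℝ) := by norm_cast
      have e1 : x ^ 4 * x ^ (-(5 / 2) : ℝ) = x ^ (3 / 2 : ℝ) := by
        rw [hx4, ← Real.rpow_add hx0]; norm_num
      have e2 : x ^ 4 * x ^ (-(7 / 2) : ℝ) = √x := by
        rw [hx4, ← Real.rpow_add hx0, Real.sqrt_eq_rpow]; norm_num
      rw [hpow, hpow] at h
      norm_num at h
      have h2 : 4 / 3 * x ^ 4 * rieszKernel (x * √(latNorm z)) + 1 / π ^ 2 * x ^ (3 / 2 : ℝ) *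
          ((latNorm z : ℝ) ^ (-(5 / 4) : ℝ) * cos (2 * π * (√(latNorm z) * x) - π / 4)) =
          4 / 3 * x ^ 4 * (rieszKernel (x * √(latNorm z)) + 3 / (4 * π ^ 2) *
            (x ^ (-(5 / 2) : ℝ) * (latNorm z : ℝ) ^ (-(5 / 4) : ℝ)) *
            cos (2 * π * (x * √(latNorm z)) - π / 4)) := by
        rw [← e1, mul_comm (√(latNorm z : ℝ)) x]
        ring
      rw [h2, abs_mul, abs_of_nonneg (by positivity)]
      calc _ ≤ 4 / 3 * x ^ 4 * (C * (x ^ (-(7 / 2) : ℝ) * (latNorm z : ℝ) ^ (-(7 / 4) : ℝ))) := by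
            gcongr
        _ ≤ 4 / 3 * x ^ 4 * (|C| * (x ^ (-(7 / 2) : ℝ) * (latNorm z : ℝ) ^ (-(7 / 4) : ℝ))) := by
            gcongr
            exact le_abs_self C
        _ = _ := by rw [← e2]; ring
  · refine Summable.of_norm_bounded hK.norm fun z => ?_
    split_ifs
    · rw [norm_zero]
      positivity
    · exact le_rfl


theorem latticeCount_eq_sum {t : ℝ} {T : Finset (ℤ × ℤ)}
    (hT : ∀ z, (latNorm z : ℝ) ≤ t ^ 2 → z ∈ T) :
    (latticeCount t : ℝ) = ∑ z ∈ T, if (latNorm z : ℝ) ≤ t ^ 2 then 1 else 0 := by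
  rw [Finset.sum_boole, latticeCount]
  congr 1
  refine Nat.subtype_card _ fun z => ?_
  simp only [Finset.mem_filter, cast_latNorm, and_iff_right_iff_imp]
  exact fun h => hT z (by rwa [cast_latNorm])

theorem exists_finset_latNorm_le (t : ℝ) :
    ∃ T : Finset (ℤ × ℤ), ∀ z, (latNorm z : ℝ) ≤ t ^ 2 → z ∈ T :=
  ⟨(finite_latNorm_le ⌊t ^ 2⌋₊).toFinset, fun z hz => by
    simpa using Nat.le_floor hz⟩

theorem rieszMean_eq_sum {t : ℝ} {T : Finset (ℤ × ℤ)} (hT : ∀ z, (latNorm z : ℝ) ≤ t ^ 2 → z ∈ T) :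
    rieszMean t = ∑ z ∈ T, max 0 (t ^ 2 - (latNorm z : ℝ)) :=
  tsum_eq_sum fun z hz => max_eq_left (by
    by_contra! h
    exact hz (hT z (by linarith)))

theorem latticeCount_mul_le {x y : ℝ} (hx : 0 ≤ x) (hxy : x ≤ y) :
    latticeCount x * (y ^ 2 - x ^ 2) ≤ rieszMean y - rieszMean x := by
  obtain ⟨T, hT⟩ := exists_finset_latNorm_le y
  have h : x ^ 2 ≤ y ^ 2 := by gcongr
  rw [latticeCount_eq_sum fun z hz => hT z (hz.trans h), rieszMean_eq_sum hT,
    rieszMean_eq_sum fun z hz => hT z (hz.trans h), ← Finset.sum_sub_distrib, Finset.sum_mul]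
  refine Finset.sum_le_sum fun z _ => ?_
  split_ifs with hz
  · rw [max_eq_right (by linarith), max_eq_right (by linarith)]
    linarith
  · rw [max_eq_left (a := 0) (b := x ^ 2 - _) (by linarith)]
    simp

theorem le_latticeCount_mul {x y : ℝ} (hx : 0 ≤ x) (hxy : x ≤ y) :
    rieszMean y - rieszMean x ≤ latticeCount y * (y ^ 2 - x ^ 2) := by
  obtain ⟨T, hT⟩ := exists_finset_latNorm_le y
  have h : x ^ 2 ≤ y ^ 2 := by gcongr
  rw [latticeCount_eq_sum hT, rieszMean_eq_sum hT,
    rieszMean_eq_sum fun z hz => hT z (hz.trans h), ← Finset.sum_sub_distrib, Finset.sum_mul]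
  refine Finset.sum_le_sum fun z _ => ?_
  split_ifs with hz
  · rw [max_eq_right (a := 0) (b := y ^ 2 - _) (by linarith)]
    linarith [le_max_right 0 (x ^ 2 - (latNorm z : ℝ))]
  · rw [max_eq_left (by linarith), max_eq_left (by linarith)]
    simp

theorem exists_abs_rieszOsc_le : ∃ C : ℝ, 0 ≤ C ∧ ∀ x, |rieszOsc x| ≤ C := by
  have hS := summable_repCount_rpow (s := 5 / 4) (by norm_num)
  refine ⟨∑' n, (repCount n : ℝ) * (n : ℝ) ^ (-(5 / 4) : ℝ), tsum_nonneg fun n => by positivity,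
    fun x => ?_⟩
  rw [rieszOsc, ← Real.norm_eq_abs]
  refine tsum_of_norm_bounded hS.hasSum fun n => ?_
  rw [norm_mul, norm_mul, Real.norm_of_nonneg (by positivity), Real.norm_of_nonneg (by positivity)]
  gcongr
  exact mul_le_of_le_one_right (by positivity) (Real.abs_cos_le_one _)

theorem latticeCount_mono {x y : ℝ} (hx : 0 ≤ x) (hxy : x ≤ y) :
    latticeCount x ≤ latticeCount y := by
  obtain ⟨T, hT⟩ := exists_finset_latNorm_le y
  have h : x ^ 2 ≤ y ^ 2 := by gcongr
  rw [← Nat.cast_le (α := ℝ), latticeCount_eq_sum fun z hz => hT z (hz.trans h),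
    latticeCount_eq_sum hT]
  refine Finset.sum_le_sum fun z _ => ?_
  split_ifs <;> norm_num
  linarith

theorem exists_abs_latticeCount_sub_le : ∃ C : ℝ, 0 ≤ C ∧ ∀ x : ℝ, 1 ≤ x →
    |latticeCount x - π * x ^ 2| ≤ C * x := by
  obtain ⟨C, hC0, hC⟩ := exists_abs_rieszMean_sub_le
  obtain ⟨D, hD0, hD⟩ := exists_abs_rieszOsc_le
  obtain ⟨E, hE0, hE⟩ : ∃ E : ℝ, 0 ≤ E ∧ ∀ x : ℝ, 1 ≤ x →
      |rieszMean x - π * x ^ 4 / 2| ≤ E * x ^ 2 := by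
    refine ⟨C + D, by positivity, fun x hx => ?_⟩
    have h1 : x ^ (3 / 2 : ℝ) ≤ x ^ 2 := by
      rw [← Real.rpow_two]
      exact Real.rpow_le_rpow_of_exponent_le hx (by norm_num)
    have h2 : √x ≤ x ^ 2 := by
      rw [Real.sqrt_eq_rpow, ← Real.rpow_two]
      exact Real.rpow_le_rpow_of_exponent_le hx (by norm_num)
    have h3 : |1 / π ^ 2 * x ^ (3 / 2 : ℝ) * rieszOsc x| ≤ D * x ^ 2 := by
      rw [abs_mul, abs_of_nonneg (by positivity), mul_comm D]
      refine mul_le_mul ?_ (hD x) (abs_nonneg _) (by positivity)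
      refine (mul_le_of_le_one_left (by positivity) ?_).trans h1
      rw [div_le_one (by positivity)]
      nlinarith [pi_gt_three]
    have h4 := abs_sub (rieszMean x - π * x ^ 4 / 2 + 1 / π ^ 2 * x ^ (3 / 2 : ℝ) * rieszOsc x)
      (1 / π ^ 2 * x ^ (3 / 2 : ℝ) * rieszOsc x)
    rw [add_sub_cancel_right] at h4
    have h5 := hC x hx
    nlinarith [mul_le_mul_of_nonneg_left h2 hC0]
  refine ⟨5 * E + 2 * π, by positivity, fun x hx => abs_le.2 ⟨?_, ?_⟩⟩
  · rcases le_total 2 x with hx2 | hx2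
    · have h1 := le_latticeCount_mul (x := x - 1) (y := x) (by linarith) (by linarith)
      have h2 := abs_le.1 (hE x hx)
      have h3 := abs_le.1 (hE (x - 1) (by linarith))
      have h4 : π * (x ^ 2 - x + 1 / 2) * (2 * x - 1) - 2 * E * x ^ 2 ≤
          latticeCount x * (2 * x - 1) := by nlinarith
      have h5 : 2 * E * x ^ 2 ≤ 2 * E * x * (2 * x - 1) := by
        nlinarith [mul_nonneg hE0 (by nlinarith : 0 ≤ x * (x - 1))]
      have h6 : π * (x ^ 2 - x + 1 / 2) - 2 * E * x ≤ latticeCount x :=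
        le_of_mul_le_mul_right (by linarith) (by linarith : 0 < 2 * x - 1)
      nlinarith [pi_pos, mul_nonneg hE0 (by linarith : 0 ≤ x), mul_pos pi_pos (by linarith : 0 < x)]
    · have h0 : (0 : ℝ) ≤ latticeCount x := Nat.cast_nonneg _
      nlinarith [pi_pos, mul_nonneg hE0 (by linarith : 0 ≤ x), mul_nonneg pi_pos.le
        (mul_nonneg (by linarith : 0 ≤ x) (by linarith : 0 ≤ 2 - x))]
  · have h1 := latticeCount_mul_le (x := x) (y := x + 1) (by linarith) (by linarith)
    have h2 := abs_le.1 (hE x hx)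
    have h3 := abs_le.1 (hE (x + 1) (by linarith))
    have h4 : latticeCount x * (2 * x + 1) ≤
        π * (x ^ 2 + x + 1 / 2) * (2 * x + 1) + 5 * E * x ^ 2 := by
      nlinarith [mul_nonneg hE0 (by nlinarith : 0 ≤ 3 * x ^ 2 - 2 * x - 1)]
    have h5 : 5 * E * x ^ 2 ≤ 5 * E * x * (2 * x + 1) := by
      nlinarith [mul_nonneg hE0 (by nlinarith : 0 ≤ x * (x + 1))]
    have h6 : latticeCount x ≤ π * (x ^ 2 + x + 1 / 2) + 5 * E * x :=
      le_of_mul_le_mul_right (by linarith) (by linarith : 0 < 2 * x + 1)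
    nlinarith [mul_nonneg pi_pos.le (by linarith : 0 ≤ x - 1)]

/-- Gaussian integers that are coprime to their conjugate. -/
def conjCoprime : Set GaussianInt := {β | IsCoprime β (star β)}

theorem ne_zero_of_mem_conjCoprime {β : GaussianInt} (hβ : β ∈ conjCoprime) : β ≠ 0 := by
  rintro rfl
  have h : IsCoprime (0 : GaussianInt) (star 0) := hβ
  rw [star_zero, isCoprime_zero_left] at h
  exact not_isUnit_zero h

theorem GaussianInt.natAbs_norm_eq_iff {a b : GaussianInt} :
    a.norm.natAbs = b.norm.natAbs ↔ a * star a = b * star b := by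
  rw [← Zsqrtd.norm_eq_mul_conj, ← Zsqrtd.norm_eq_mul_conj, Int.cast_inj,
    Int.natAbs_inj_of_nonneg_of_nonneg (Zsqrtd.norm_nonneg (by norm_num) _)
      (Zsqrtd.norm_nonneg (by norm_num) _)]

theorem exists_unit_mul_star_eq {a c : GaussianInt} (hac : IsCoprime a c)
    (h : a.norm.natAbs = c.norm.natAbs) :
    a ∈ conjCoprime ∧ ∃ ε : GaussianIntˣ, c = ε * star a := by
  rw [GaussianInt.natAbs_norm_eq_iff] at h
  have h1 : a ∣ star c := hac.dvd_of_dvd_mul_left (h ▸ dvd_mul_right _ _)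
  have h2 : c ∣ star a := hac.symm.dvd_of_dvd_mul_left (h ▸ dvd_mul_right _ _)
  have h3 : star a ∣ c := by
    obtain ⟨k, hk⟩ := h1
    exact ⟨star k, by rw [← star_star c, hk, star_mul, mul_comm]⟩
  obtain ⟨u, hu⟩ := associated_of_dvd_dvd h3 h2
  refine ⟨?_, u, by rw [← hu, mul_comm]⟩
  exact hac.of_isCoprime_of_dvd_right h3

instance finite_units_gaussianInt : Finite GaussianIntˣ := by
  refine Finite.of_injective (β := {z : ℤ × ℤ // latNorm z = 1})
    (fun u => ⟨((u : GaussianInt).re, (u : GaussianInt).im), ?_⟩) fun u v h => ?_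
  · have h := Zsqrtd.norm_eq_one_iff.2 u.isUnit
    rw [Zsqrtd.norm_def] at h
    zify [latNorm]
    simp only [sq_abs]
    have h0 := Zsqrtd.norm_nonneg (d := -1) (by norm_num) (u : GaussianInt)
    rw [Zsqrtd.norm_def] at h0
    nlinarith [abs_of_nonneg h0, congrArg (Nat.cast (R := ℤ)) h,
      Int.natCast_natAbs ((u : GaussianInt).re * (u : GaussianInt).re -
        -1 * (u : GaussianInt).im * (u : GaussianInt).im)]
  · simp only [Subtype.mk.injEq, Prod.mk.injEq] at h
    exact Units.ext (Zsqrtd.ext h.1 h.2)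

/-- Pairs of nonzero Gaussian integers of equal norm. -/
abbrev EqualNormPair : Type :=
  {p : GaussianInt × GaussianInt // p.1 ≠ 0 ∧ p.1.norm.natAbs = p.2.norm.natAbs}

theorem exists_gcd_mul_unit {g β : GaussianInt} (hβ : β ∈ conjCoprime) (ε : GaussianIntˣ) :
    ∃ u : GaussianIntˣ, EuclideanDomain.gcd (g * β) (g * (ε * star β)) * u = g := by
  have hd : g ∣ EuclideanDomain.gcd (g * β) (g * (ε * star β)) :=
    EuclideanDomain.dvd_gcd (dvd_mul_right _ _) (dvd_mul_right _ _)
  refine associated_of_dvd_dvd ?_ hd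
  obtain ⟨a, b, hab⟩ : IsCoprime β (ε * star β) :=
    (isCoprime_mul_unit_left_right ε.isUnit _ _).2 hβ
  have : g = a * (g * β) + b * (g * (ε * star β)) := by linear_combination (-g) * hab
  conv_rhs => rw [this]
  exact dvd_add ((EuclideanDomain.gcd_dvd_left _ _).mul_left _)
    ((EuclideanDomain.gcd_dvd_right _ _).mul_left _)

theorem exists_equiv_equalNormPair :
    ∃ e : ({g : GaussianInt // g ≠ 0} × conjCoprime) × GaussianIntˣ ≃
        EqualNormPair × GaussianIntˣ,
      ∀ g β ε, ((e ((g, β), ε)).1 : GaussianInt × GaussianInt).1 = g * β := by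
  choose u hu using fun (g : GaussianInt) (β : conjCoprime) (ε : GaussianIntˣ) =>
    exists_gcd_mul_unit (g := g) β.2 ε
  let T : ({g : GaussianInt // g ≠ 0} × conjCoprime) × GaussianIntˣ →
      EqualNormPair × GaussianIntˣ := fun t =>
    (⟨(t.1.1 * t.1.2, t.1.1 * (t.2 * star (t.1.2 : GaussianInt))),
      mul_ne_zero t.1.1.2 (ne_zero_of_mem_conjCoprime t.1.2.2), by
        simp [Zsqrtd.norm_mul, Zsqrtd.norm_conj, Int.natAbs_mul,
          Zsqrtd.norm_eq_one_iff.2 t.2.isUnit]⟩, u t.1.1 t.1.2 t.2)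
  refine ⟨Equiv.ofBijective T ⟨?_, ?_⟩, fun g β ε => rfl⟩
  · rintro ⟨⟨⟨g, hg⟩, β⟩, ε⟩ ⟨⟨⟨g', hg'⟩, β'⟩, ε'⟩ h
    simp only [T, Prod.mk.injEq, Subtype.mk.injEq] at h
    obtain ⟨⟨h1, h2⟩, h3⟩ := h
    have hgg : g = g' := by rw [← hu g β ε, ← hu g' β' ε', h1, h2, h3]
    subst hgg
    have hββ : β = β' := Subtype.ext (mul_left_cancel₀ hg h1)
    subst hββ
    have hεε : ε = ε' := Units.ext (mul_right_cancel₀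
      (star_ne_zero.2 (ne_zero_of_mem_conjCoprime β.2)) (mul_left_cancel₀ hg h2))
    subst hεε
    rfl
  · rintro ⟨⟨⟨z, w⟩, hz, hzw⟩, v⟩
    simp only at hz hzw
    set d := EuclideanDomain.gcd z w with hd
    have hd0 : d ≠ 0 := fun h => hz (EuclideanDomain.gcd_eq_zero_iff.1 h).1
    obtain ⟨a, ha⟩ : d * v ∣ z := (Units.mul_right_dvd).2 (EuclideanDomain.gcd_dvd_left z w)
    obtain ⟨c, hc⟩ : d * v ∣ w := (Units.mul_right_dvd).2 (EuclideanDomain.gcd_dvd_right z w)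
    have hdv : d * v ≠ 0 := mul_ne_zero hd0 v.ne_zero
    have hac : IsCoprime a c := by
      have h := EuclideanDomain.gcd_eq_gcd_ab z w
      rw [← hd] at h
      refine ⟨v * EuclideanDomain.gcdA z w, v * EuclideanDomain.gcdB z w,
        mul_left_cancel₀ hd0 ?_⟩
      linear_combination -h - EuclideanDomain.gcdA z w * ha - EuclideanDomain.gcdB z w * hc
    have hn : a.norm.natAbs = c.norm.natAbs := by
      rw [ha, hc, Zsqrtd.norm_mul, Zsqrtd.norm_mul (n := d * (v : GaussianInt)), Int.natAbs_mul,
        Int.natAbs_mul] at hzw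
      refine mul_left_cancel₀ ?_ hzw
      rw [Int.natAbs_ne_zero]
      exact fun h => hdv ((Zsqrtd.norm_eq_zero_iff (by norm_num) _).1 h)
    obtain ⟨haB, ε, hε⟩ := exists_unit_mul_star_eq hac hn
    refine ⟨((⟨d * (v : GaussianInt), hdv⟩, ⟨a, haB⟩), ε), ?_⟩
    have h1 : d * v * (ε * star a) = w := by rw [← hε, hc]
    simp only [T, Prod.mk.injEq, Subtype.mk.injEq]
    refine ⟨⟨ha.symm, h1⟩, Units.ext (mul_left_cancel₀ hd0 ?_)⟩
    have := hu (d * (v : GaussianInt)) ⟨a, haB⟩ ε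
    rwa [h1, ← ha, ← hd] at this

/-- Gaussian integers as lattice points. -/
def gaussianIntEquiv : ℤ × ℤ ≃ GaussianInt where
  toFun z := ⟨z.1, z.2⟩
  invFun z := (z.re, z.im)
  left_inv _ := rfl
  right_inv _ := rfl

theorem natAbs_norm_gaussianIntEquiv (z : ℤ × ℤ) :
    (gaussianIntEquiv z).norm.natAbs = latNorm z := by
  have h : (gaussianIntEquiv z).norm = (latNorm z : ℤ) := by
    simp [Zsqrtd.norm_def, gaussianIntEquiv, latNorm, sq]
  rw [h, Int.natAbs_natCast]

theorem tsum_repCount_eq_tsum_gaussianInt (f : ℕ → ENNReal) :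
    ∑' n, (repCount n : ENNReal) * f n = ∑' g : GaussianInt, f g.norm.natAbs := by
  rw [← ENNReal.tsum_latNorm, ← gaussianIntEquiv.tsum_eq]
  exact tsum_congr fun z => by rw [natAbs_norm_gaussianIntEquiv]

theorem tsum_ite_natAbs_norm (n : ℕ) (c : ENNReal) :
    ∑' g : GaussianInt, (if n = g.norm.natAbs then c else 0) = repCount n * c := by
  rw [← tsum_repCount_eq_tsum_gaussianInt fun m => if n = m then c else 0,
    tsum_eq_single n fun m hm => by rw [if_neg hm.symm, mul_zero], if_pos rfl]

theorem tsum_equalNormPair (f : ℕ → ENNReal) (hf : f 0 = 0) :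
    ∑' p : EqualNormPair, f (p : GaussianInt × GaussianInt).1.norm.natAbs =
      ∑' n, (repCount n : ENNReal) ^ 2 * f n := by
  have h : ∀ p : GaussianInt × GaussianInt,
      Set.indicator {p : GaussianInt × GaussianInt | p.1 ≠ 0 ∧ p.1.norm.natAbs = p.2.norm.natAbs}
        (fun p => f p.1.norm.natAbs) p =
      if p.1.norm.natAbs = p.2.norm.natAbs then f p.1.norm.natAbs else 0 := fun p => by
    by_cases h0 : p.1 = 0
    · simp [h0, hf, Set.indicator]
    · simp [Set.indicator, h0]
  rw [show (∑' p : EqualNormPair, f (p : GaussianInt × GaussianInt).1.norm.natAbs) = _ from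
    tsum_subtype {p : GaussianInt × GaussianInt | p.1 ≠ 0 ∧ p.1.norm.natAbs = p.2.norm.natAbs}
      (fun p => f p.1.norm.natAbs), tsum_congr h, ENNReal.tsum_prod']
  simp only
  rw [tsum_congr fun a : GaussianInt => tsum_ite_natAbs_norm a.norm.natAbs (f a.norm.natAbs),
    ← tsum_repCount_eq_tsum_gaussianInt fun n => repCount n * f n]
  exact tsum_congr fun n => by rw [sq, mul_assoc]

theorem tsum_repCount_sq (f : ℕ → ENNReal) (hf : f 0 = 0) :
    ∑' n, (repCount n : ENNReal) ^ 2 * f n =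
      ∑' β : conjCoprime, ∑' n, (repCount n : ENNReal) *
        f (n * (β : GaussianInt).norm.natAbs) := by
  obtain ⟨e, he⟩ := exists_equiv_equalNormPair
  have hU : ((ENat.card GaussianIntˣ : ℕ∞) : ENNReal) ≠ ⊤ := by
    rw [ENat.card_eq_coe_natCard]; simp
  have hU0 : ((ENat.card GaussianIntˣ : ℕ∞) : ENNReal) ≠ 0 := by
    rw [ENat.card_eq_coe_natCard]; simp [Nat.card_pos.ne']
  refine (ENNReal.mul_right_inj hU0 hU).1 ?_
  rw [← tsum_equalNormPair f hf]
  have h1 : ∑' q : EqualNormPair × GaussianIntˣ,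
      f (q.1 : GaussianInt × GaussianInt).1.norm.natAbs =
      ENat.card GaussianIntˣ * ∑' p : EqualNormPair,
        f (p : GaussianInt × GaussianInt).1.norm.natAbs := by
    rw [ENNReal.tsum_prod']
    simp only [ENNReal.tsum_const, ENNReal.tsum_mul_left]
  rw [← h1, ← e.tsum_eq, ENNReal.tsum_prod']
  simp only [ENNReal.tsum_const, ENNReal.tsum_mul_left, he]
  rw [ENNReal.tsum_prod', ENNReal.tsum_comm]
  congr 1
  refine tsum_congr fun β => ?_
  rw [tsum_repCount_eq_tsum_gaussianInt fun n => f (n * (β : GaussianInt).norm.natAbs)]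
  refine (tsum_subtype {g : GaussianInt | g ≠ 0} fun g => f (g * β).norm.natAbs).trans ?_
  refine tsum_congr fun g => ?_
  by_cases h0 : g = 0
  · simp [h0, hf, Set.indicator]
  · simp [Set.indicator, h0, Zsqrtd.norm_mul, Int.natAbs_mul]

theorem exists_card_divisors_le {ε : ℝ} (hε : 0 < ε) :
    ∃ C : ℝ, 0 < C ∧ ∀ n : ℕ, (n.divisors.card : ℝ) ≤ C * (n : ℝ) ^ ε := by
  obtain ⟨P, hP⟩ := exists_nat_ge ((2 : ℝ) ^ ε⁻¹)
  set D : ℝ := max 1 (ε * Real.log 2)⁻¹ with hD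
  have hl : 0 < ε * Real.log 2 := mul_pos hε (Real.log_pos (by norm_num))
  have hD1 : 1 ≤ D := le_max_left _ _
  have hD2 : 1 ≤ D * (ε * Real.log 2) := by
    calc 1 = (ε * Real.log 2)⁻¹ * (ε * Real.log 2) := (inv_mul_cancel₀ hl.ne').symm
      _ ≤ _ := by gcongr; exact le_max_right _ _
  refine ⟨D ^ P, by positivity, fun n => ?_⟩
  rcases eq_or_ne n 0 with rfl | hn
  · simp [Real.zero_rpow hε.ne']
  have hfac : ∀ p ∈ n.primeFactors, ((n.factorization p + 1 : ℕ) : ℝ) ≤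
      (if p < P then D else 1) * ((p ^ n.factorization p : ℕ) : ℝ) ^ ε := by
    intro p hp
    have hp2 : (2 : ℝ) ≤ p := by exact_mod_cast (Nat.prime_of_mem_primeFactors hp).two_le
    set a := n.factorization p
    rw [Nat.cast_pow, ← Real.rpow_natCast, ← Real.rpow_mul (by positivity), mul_comm (a : ℝ),
      Real.rpow_mul (by positivity), Real.rpow_natCast]
    split_ifs with h
    · have h1 : 1 + a * (ε * Real.log 2) ≤ ((p : ℝ) ^ ε) ^ a := by
        calc 1 + a * (ε * Real.log 2) ≤ Real.exp (a * (ε * Real.log 2)) := by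
              linarith [Real.add_one_le_exp (a * (ε * Real.log 2))]
          _ = ((2 : ℝ) ^ ε) ^ a := by
              rw [Real.exp_nat_mul, Real.rpow_def_of_pos (by norm_num), mul_comm ε]
          _ ≤ _ := by gcongr
      push_cast
      calc (a : ℝ) + 1 ≤ D * (1 + a * (ε * Real.log 2)) := by
            nlinarith [mul_le_mul_of_nonneg_left hD2 (Nat.cast_nonneg (α := ℝ) a)]
        _ ≤ _ := by gcongr
    · have h2 : (2 : ℝ) ≤ (p : ℝ) ^ ε := by
        have : (2 : ℝ) ^ ε⁻¹ ≤ p := hP.trans (by exact_mod_cast not_lt.1 h)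
        calc (2 : ℝ) = ((2 : ℝ) ^ ε⁻¹) ^ ε := by
              rw [← Real.rpow_mul (by norm_num), inv_mul_cancel₀ hε.ne', Real.rpow_one]
          _ ≤ _ := by gcongr
      rw [one_mul]
      calc ((a + 1 : ℕ) : ℝ) ≤ (2 : ℝ) ^ a := by exact_mod_cast Nat.lt_two_pow_self
        _ ≤ _ := by gcongr
  rw [Nat.card_divisors hn, Nat.cast_prod]
  refine (Finset.prod_le_prod (fun _ _ => Nat.cast_nonneg _) hfac).trans ?_
  rw [Finset.prod_mul_distrib]
  have h3 : ∏ p ∈ n.primeFactors, ((p ^ n.factorization p : ℕ) : ℝ) ^ ε = (n : ℝ) ^ ε := by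
    rw [Real.finsetProd_rpow _ _ fun _ _ => Nat.cast_nonneg _, ← Nat.cast_prod,
      ← Nat.prod_factorization_eq_prod_primeFactors fun p a => p ^ a,
      Nat.prod_factorization_pow_eq_self hn]
  rw [h3]
  gcongr
  rw [Finset.prod_ite, Finset.prod_const, Finset.prod_const_one, mul_one]
  refine pow_le_pow_right₀ hD1 ?_
  calc _ ≤ (Finset.range P).card := Finset.card_le_card fun p hp => by
        simpa using (Finset.mem_filter.1 hp).2
    _ = P := Finset.card_range P

theorem repCount_sq_le {n : ℕ} (hn : n ≠ 0) :
    repCount n ^ 2 ≤ ∑ x ∈ n.divisorsAntidiagonal, repCount x.1 * repCount x.2 := by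
  rw [← Nat.cast_le (α := ENNReal)]
  have h1 := tsum_repCount_sq (fun m => if m = n then 1 else 0) (by simp [hn.symm])
  rw [tsum_eq_single n fun m hm => by simp [hm]] at h1
  push_cast
  calc ((repCount n : ENNReal)) ^ 2
      = ∑' β : conjCoprime, ∑' k, (repCount k : ENNReal) *
        (if k * (β : GaussianInt).norm.natAbs = n then 1 else 0) := by rw [← h1]; simp
    _ ≤ ∑' β : GaussianInt, ∑' k, (repCount k : ENNReal) *
        (if k * β.norm.natAbs = n then 1 else 0) :=
      ENNReal.tsum_comp_le_tsum_of_injective Subtype.val_injective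
        (fun β : GaussianInt => ∑' k, (repCount k : ENNReal) *
        (if k * β.norm.natAbs = n then 1 else 0))
    _ = ∑' m, (repCount m : ENNReal) * ∑' k, (repCount k : ENNReal) *
        (if k * m = n then 1 else 0) :=
      (tsum_repCount_eq_tsum_gaussianInt fun m => ∑' k, (repCount k : ENNReal) *
        (if k * m = n then 1 else 0)).symm
    _ = ∑' x : ℕ × ℕ, (if x.1 * x.2 = n then (repCount x.1 * repCount x.2 : ENNReal) else 0) := by
      rw [ENNReal.tsum_prod']
      refine tsum_congr fun m => ?_
      rw [← ENNReal.tsum_mul_left]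
      refine tsum_congr fun k => ?_
      rw [mul_comm k m]
      split_ifs <;> simp
    _ = _ := by
      rw [tsum_eq_sum (s := n.divisorsAntidiagonal) fun x hx => ?_]
      · refine Finset.sum_congr rfl fun x hx => ?_
        rw [if_pos (Nat.mem_divisorsAntidiagonal.1 hx).1]
      · rw [if_neg fun h => hx (Nat.mem_divisorsAntidiagonal.2 ⟨h, hn⟩)]

theorem repCount_le (n : ℕ) : repCount n ≤ (2 * n + 1) ^ 2 := by
  have hsub : {z : ℤ × ℤ | latNorm z = n} ⊆
      ((Finset.Icc (-(n : ℤ)) n ×ˢ Finset.Icc (-(n : ℤ)) n : Finset (ℤ × ℤ)) : Set (ℤ × ℤ)) := by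
    rintro ⟨a, b⟩ h
    simp only [latNorm, Set.mem_ofPred_eq] at h
    have ha : a.natAbs ≤ n := by nlinarith [Nat.le_self_pow two_ne_zero a.natAbs]
    have hb : b.natAbs ≤ n := by nlinarith [Nat.le_self_pow two_ne_zero b.natAbs]
    simp only [Finset.coe_product, Finset.coe_Icc, Set.mem_prod, Set.mem_Icc]
    omega
  have h := Set.ncard_le_ncard hsub (Finset.finite_toSet _)
  rw [Set.ncard_coe_finset, Finset.card_product, Int.card_Icc, ← sq] at h
  refine h.trans (le_of_eq ?_)
  congr 1
  omega

theorem exists_repCount_le {ε : ℝ} (hε : 0 < ε) :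
    ∃ C : ℝ, 0 < C ∧ ∀ n : ℕ, 1 ≤ n → (repCount n : ℝ) ≤ C * (n : ℝ) ^ ε := by
  have main : ∀ k : ℕ, ∃ C : ℝ, 0 < C ∧ ∀ n : ℕ, 1 ≤ n →
      (repCount n : ℝ) ≤ C * (n : ℝ) ^ (ε / 2 + 2 * (1 / 2 : ℝ) ^ k) := by
    intro k
    induction k with
    | zero =>
      refine ⟨9, by norm_num, fun n hn => ?_⟩
      have hn' : (1 : ℝ) ≤ n := by exact_mod_cast hn
      calc (repCount n : ℝ) ≤ (2 * n + 1) ^ 2 := by exact_mod_cast repCount_le n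
        _ ≤ 9 * (n : ℝ) ^ 2 := by nlinarith
        _ ≤ _ := by
          rw [← Real.rpow_natCast]
          gcongr
          norm_num
          linarith
    | succ k ih =>
      obtain ⟨C, hC, h⟩ := ih
      obtain ⟨D, hD, hd⟩ := exists_card_divisors_le (half_pos hε)
      refine ⟨√(C ^ 2 * D), by positivity, fun n hn => ?_⟩
      set θ := ε / 2 + 2 * (1 / 2 : ℝ) ^ k with hθ
      have hn0 : n ≠ 0 := by omega
      have h1 : (repCount n : ℝ) ^ 2 ≤ C ^ 2 * D * (n : ℝ) ^ (θ + ε / 2) := by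
        calc (repCount n : ℝ) ^ 2
            ≤ ∑ x ∈ n.divisorsAntidiagonal, (repCount x.1 : ℝ) * repCount x.2 := by
              exact_mod_cast repCount_sq_le hn0
          _ ≤ ∑ x ∈ n.divisorsAntidiagonal, C ^ 2 * (n : ℝ) ^ θ := by
              refine Finset.sum_le_sum fun x hx => ?_
              obtain ⟨hx1, -⟩ := Nat.mem_divisorsAntidiagonal.1 hx
              have h1 : x.1 ≠ 0 := by rintro h; rw [h, zero_mul] at hx1; exact hn0 hx1.symm
              have h2 : x.2 ≠ 0 := by rintro h; rw [h, mul_zero] at hx1; exact hn0 hx1.symm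
              calc (repCount x.1 : ℝ) * repCount x.2
                  ≤ (C * (x.1 : ℝ) ^ θ) * (C * (x.2 : ℝ) ^ θ) := by
                    gcongr
                    · exact h _ (by omega)
                    · exact h _ (by omega)
                _ = _ := by
                    rw [← hx1, Nat.cast_mul, Real.mul_rpow (by positivity) (by positivity)]
                    ring
          _ = n.divisors.card * (C ^ 2 * (n : ℝ) ^ θ) := by
              rw [Finset.sum_const, nsmul_eq_mul, ← Nat.map_div_right_divisors, Finset.card_map]
          _ ≤ D * (n : ℝ) ^ (ε / 2) * (C ^ 2 * (n : ℝ) ^ θ) := by gcongr; exact hd n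
          _ = _ := by rw [Real.rpow_add (by positivity) θ]; ring
      refine (Real.le_sqrt_of_sq_le h1).trans (le_of_eq ?_)
      rw [Real.sqrt_mul (by positivity), Real.sqrt_eq_rpow ((n : ℝ) ^ _),
        ← Real.rpow_mul (by positivity), hθ, pow_succ]
      ring_nf
  obtain ⟨k, hk⟩ := exists_pow_lt_of_lt_one (show 0 < ε / 4 by positivity)
    (show (1 / 2 : ℝ) < 1 by norm_num)
  obtain ⟨C, hC, h⟩ := main k
  refine ⟨C, hC, fun n hn => (h n hn).trans ?_⟩
  gcongr
  · exact_mod_cast hn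
  · linarith

theorem latticeCount_natCast (m : ℕ) :
    (latticeCount m : ℝ) = 1 + ∑ n ∈ Finset.Ioc 0 (m ^ 2), (repCount n : ℝ) := by
  obtain ⟨T, hT⟩ := exists_finset_latNorm_le (m : ℝ)
  have hs : Summable fun z => (if latNorm z ≤ m ^ 2 then (1 : ℝ) else 0) :=
    summable_of_hasFiniteSupport ((finite_latNorm_le (m ^ 2)).subset fun z hz => by
      by_contra h
      exact hz (if_neg h))
  have h := hasSum_repCount (f := fun n => if n ≤ m ^ 2 then (1 : ℝ) else 0) hs
  rw [latticeCount_eq_sum hT]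
  have h2 : ∑' z, (if latNorm z ≤ m ^ 2 then (1 : ℝ) else 0) =
      ∑ z ∈ T, if (latNorm z : ℝ) ≤ (m : ℝ) ^ 2 then 1 else 0 := by
    rw [tsum_eq_sum (s := T) fun z hz => if_neg fun h => hz (hT z (by exact_mod_cast h))]
    exact Finset.sum_congr rfl fun z _ => by norm_cast
  rw [← h2, ← h.tsum_eq, tsum_eq_sum (s := insert 0 (Finset.Ioc 0 (m ^ 2))) fun n hn => by
    rw [Finset.mem_insert, Finset.mem_Ioc] at hn
    rw [if_neg (by omega), mul_zero], Finset.sum_insert (by simp), repCount_zero]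
  congr 1
  · simp
  · exact Finset.sum_congr rfl fun n hn => by rw [if_pos (Finset.mem_Ioc.1 hn).2, mul_one]

/-- Comparison of a radial lattice sum with a sum over integer radii. -/
theorem exists_abs_sum_repCount_sub_le : ∃ C : ℝ, 0 ≤ C ∧ ∀ (ψ : ℝ → ℝ) (w : ℕ → ℝ),
    (∀ (m : ℕ) (t : ℝ), 1 ≤ t → m ≤ t → t ≤ m + 1 → |ψ t - ψ (m + 1)| ≤ w m) → ∀ M : ℕ,
    |∑ n ∈ Finset.Ioc 0 ((M + 1) ^ 2), (repCount n : ℝ) * ψ √n -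
      π * ∑ m ∈ Finset.range (M + 1), (2 * m + 1) * ψ (m + 1)| ≤
    C * ((M + 1) * |ψ (M + 1)| + |ψ 1| + ∑ m ∈ Finset.range (M + 1), (m + 1) * w m) := by
  obtain ⟨C, hC0, hC⟩ := exists_abs_latticeCount_sub_le
  set E : ℕ → ℝ := fun m => latticeCount m - π * (m : ℝ) ^ 2 with hE
  have hE0 : E 0 = 1 := by
    simp only [hE, latticeCount_natCast]; simp
  have hEb : ∀ m : ℕ, |E (m + 1)| ≤ C * (m + 1) := fun m => by
    have := hC (m + 1) (by linarith [(Nat.cast_nonneg m : (0 : ℝ) ≤ m)])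
    simpa [hE] using this
  refine ⟨3 * C + 8, by positivity, fun ψ w hw M => ?_⟩
  have hw0 : ∀ m, 0 ≤ w m := fun m => (abs_nonneg _).trans
    (hw m (m + 1) (by linarith [(Nat.cast_nonneg m : (0 : ℝ) ≤ m)]) (by linarith) le_rfl)
  have hR : ∀ m : ℕ, ∑ n ∈ Finset.Ioc (m ^ 2) ((m + 1) ^ 2), (repCount n : ℝ) =
      E (m + 1) - E m + π * (2 * m + 1) := fun m => by
    have h := Finset.sum_Ioc_consecutive (fun n => (repCount n : ℝ)) (Nat.zero_le (m ^ 2))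
      (show m ^ 2 ≤ (m + 1) ^ 2 by gcongr; omega)
    simp only [hE, latticeCount_natCast]
    rw [← h]
    push_cast
    ring
  have hR2 : ∀ m : ℕ, E (m + 1) - E m + π * (2 * m + 1) ≤ (2 * C + 8) * (m + 1) := fun m => by
    have h1 := (le_abs_self _).trans (hEb m)
    have h2 : -E m ≤ C * (m + 1) := by
      rcases m with _ | m
      · rw [hE0]; push_cast; nlinarith
      · have := (neg_le_abs _).trans (hEb m)
        push_cast; nlinarith
    nlinarith [Real.pi_lt_four, (Nat.cast_nonneg m : (0 : ℝ) ≤ m)]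
  have hshell : ∀ m : ℕ, |∑ n ∈ Finset.Ioc (m ^ 2) ((m + 1) ^ 2), (repCount n : ℝ) * ψ √n -
      (E (m + 1) - E m + π * (2 * m + 1)) * ψ (m + 1)| ≤ (2 * C + 8) * ((m + 1) * w m) := by
    intro m
    rw [← hR, Finset.sum_mul, ← Finset.sum_sub_distrib]
    refine (Finset.abs_sum_le_sum_abs _ _).trans ?_
    rw [← mul_assoc]
    refine le_trans ?_ (mul_le_mul_of_nonneg_right (hR2 m) (hw0 m))
    rw [← hR, Finset.sum_mul]
    refine Finset.sum_le_sum fun n hn => ?_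
    obtain ⟨h1, h2⟩ := Finset.mem_Ioc.1 hn
    rw [← mul_sub, abs_mul, abs_of_nonneg (Nat.cast_nonneg _)]
    refine mul_le_mul_of_nonneg_left (hw m _ ?_ ?_ ?_) (Nat.cast_nonneg _)
    · rw [Real.one_le_sqrt]
      exact_mod_cast Nat.one_le_iff_ne_zero.2 (by omega)
    · exact Real.le_sqrt_of_sq_le (by exact_mod_cast h1.le)
    · rw [Real.sqrt_le_left (by positivity)]
      exact_mod_cast h2
  have hparts : ∀ M : ℕ, |∑ m ∈ Finset.range (M + 1), (E (m + 1) - E m) * ψ (m + 1) -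
      E (M + 1) * ψ (M + 1) + ψ 1| ≤ C * ∑ m ∈ Finset.range (M + 1), (m + 1) * w m := by
    intro M
    induction M with
    | zero =>
      have : (E (0 + 1) - E 0) * ψ (0 + 1) - E (0 + 1) * ψ (0 + 1) + ψ 1 = 0 := by
        rw [hE0, zero_add]; ring_nf
      simp only [zero_add, Finset.range_one, Finset.sum_singleton, Nat.cast_zero] at this ⊢
      rw [this, abs_zero]
      have := hw0 0
      positivity
    | succ M ih =>
      rw [Finset.sum_range_succ, Finset.sum_range_succ _ (M + 1), mul_add C]
      have h1 := hw (M + 1) (M + 1) (by linarith [(Nat.cast_nonneg M : (0 : ℝ) ≤ M)])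
        (by push_cast; linarith) (by push_cast; linarith)
      have h2 : |E (M + 1) * (ψ (M + 1) - ψ ((M + 1 : ℕ) + 1))| ≤
          C * (((M + 1 : ℕ) + 1) * w (M + 1)) := by
        rw [abs_mul]
        refine (mul_le_mul (hEb M) h1 (abs_nonneg _) (by positivity)).trans ?_
        push_cast
        nlinarith [mul_nonneg hC0 (hw0 (M + 1))]
      refine le_trans ?_ (add_le_add ih h2)
      refine le_trans (le_of_eq ?_) (abs_add_le _ _)
      congr 1
      push_cast
      ring
  have htot : ∀ M : ℕ, |∑ n ∈ Finset.Ioc 0 (M ^ 2), (repCount n : ℝ) * ψ √n -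
      ∑ m ∈ Finset.range M, (E (m + 1) - E m + π * (2 * m + 1)) * ψ (m + 1)| ≤
      (2 * C + 8) * ∑ m ∈ Finset.range M, (m + 1) * w m := by
    intro M
    induction M with
    | zero => simp
    | succ M ih =>
      rw [Finset.sum_range_succ, Finset.sum_range_succ _ M, mul_add (2 * C + 8),
        ← Finset.sum_Ioc_consecutive _ (Nat.zero_le (M ^ 2))
          (show M ^ 2 ≤ (M + 1) ^ 2 by gcongr; omega)]
      refine le_trans (le_of_eq ?_) ((abs_add_le _ _).trans (add_le_add ih (hshell M)))
      congr 1
      ring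
  have h1 := htot (M + 1)
  have h2 := hparts M
  set S := ∑ m ∈ Finset.range (M + 1), ((m : ℝ) + 1) * w m
  have hS : 0 ≤ S := Finset.sum_nonneg fun m _ => mul_nonneg (by positivity) (hw0 m)
  have h3 : ∑ m ∈ Finset.range (M + 1), (E (m + 1) - E m + π * (2 * m + 1)) * ψ (m + 1) =
      ∑ m ∈ Finset.range (M + 1), (E (m + 1) - E m) * ψ (m + 1) +
        π * ∑ m ∈ Finset.range (M + 1), (2 * m + 1) * ψ (m + 1) := by
    rw [Finset.mul_sum, ← Finset.sum_add_distrib]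
    exact Finset.sum_congr rfl fun m _ => by ring
  rw [h3] at h1
  have h4 : |E (M + 1) * ψ (M + 1)| ≤ C * ((M + 1) * |ψ (M + 1)|) := by
    rw [abs_mul, ← mul_assoc]
    exact mul_le_mul_of_nonneg_right (hEb M) (abs_nonneg _)
  have h5 : 0 ≤ (M + 1 : ℝ) * |ψ (M + 1)| := by positivity
  rw [abs_le] at h1 h2 h4 ⊢
  have h6 := neg_abs_le (ψ 1)
  have h7 := le_abs_self (ψ 1)
  have h8 := abs_nonneg (ψ 1)
  constructor <;> nlinarith [mul_nonneg hC0 h8, mul_nonneg hC0 hS, mul_nonneg hC0 h5]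

theorem exists_abs_sum_repCount_div_sub_log_le : ∃ C : ℝ, 0 ≤ C ∧ ∀ H : ℕ, 1 ≤ H →
    |∑ n ∈ Finset.Ioc 0 H, (repCount n : ℝ) / n - π * Real.log H| ≤ C := by
  obtain ⟨C, hC0, hC⟩ := exists_abs_sum_repCount_sub_le
  have hs : Summable fun m : ℕ => 1 / ((m : ℝ) + 1) ^ 2 := by
    simpa using (summable_nat_add_iff 1).2 (Real.summable_one_div_nat_pow.2 (by norm_num : 1 < 2))
  set Z := ∑' m : ℕ, 1 / ((m : ℝ) + 1) ^ 2
  have hsq : ∀ M : ℕ, |∑ n ∈ Finset.Ioc 0 ((M + 1) ^ 2), (repCount n : ℝ) / n -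
      2 * π * Real.log (M + 1)| ≤ C * (2 + 8 * Z) + π * Z + 2 * π := by
    intro M
    have h := hC (fun t => 1 / t ^ 2) (fun m => 8 / ((m : ℝ) + 1) ^ 3) (fun m t h1 h2 h3 => by
      have h4 : (m + 1 : ℝ) ≤ 2 * t := by linarith
      have hm : (0 : ℝ) ≤ m := Nat.cast_nonneg m
      set s : ℝ := m + 1
      have hs1 : 0 < s := by positivity
      have ht : 0 < t := by linarith
      rw [abs_of_nonneg (by
        have : 1 / s ^ 2 ≤ 1 / t ^ 2 := by gcongr
        linarith), div_sub_div _ _ (by positivity) (by positivity),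
        div_le_div_iff₀ (by positivity) (by positivity)]
      have h5 : s ^ 2 - t ^ 2 ≤ 2 * s := by nlinarith
      have h6 : s ^ 2 ≤ 4 * t ^ 2 := by nlinarith
      have h7 : 1 * s ^ 2 - t ^ 2 * 1 ≤ 2 * s := by linarith
      calc (1 * s ^ 2 - t ^ 2 * 1) * s ^ 3 ≤ 2 * s * s ^ 3 := by gcongr
        _ = 2 * s ^ 2 * s ^ 2 := by ring
        _ ≤ 2 * s ^ 2 * (4 * t ^ 2) := by gcongr
        _ = 8 * (t ^ 2 * s ^ 2) := by ring) M
    have e1 : ∑ n ∈ Finset.Ioc 0 ((M + 1) ^ 2), (repCount n : ℝ) * (1 / √n ^ 2) =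
        ∑ n ∈ Finset.Ioc 0 ((M + 1) ^ 2), (repCount n : ℝ) / n :=
      Finset.sum_congr rfl fun n _ => by rw [Real.sq_sqrt (Nat.cast_nonneg n)]; ring
    have e2 : ∑ m ∈ Finset.range (M + 1), ((m : ℝ) + 1) * (8 / ((m : ℝ) + 1) ^ 3) ≤ 8 * Z := by
      rw [show (8 : ℝ) * Z = ∑' m : ℕ, 8 * (1 / ((m : ℝ) + 1) ^ 2) from tsum_mul_left.symm]
      refine le_trans (le_of_eq (Finset.sum_congr rfl fun m _ => ?_))
        ((hs.mul_left 8).sum_le_tsum _ fun _ _ => by positivity)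
      field_simp
    have e3 : ∑ m ∈ Finset.range (M + 1), (2 * (m : ℝ) + 1) * (1 / ((m : ℝ) + 1) ^ 2) =
        2 * (harmonic (M + 1) : ℝ) - ∑ m ∈ Finset.range (M + 1), 1 / ((m : ℝ) + 1) ^ 2 := by
      rw [harmonic]
      push_cast
      rw [Finset.mul_sum, ← Finset.sum_sub_distrib]
      refine Finset.sum_congr rfl fun m _ => ?_
      field_simp
      ring
    have e4 : ∑ m ∈ Finset.range (M + 1), 1 / ((m : ℝ) + 1) ^ 2 ≤ Z :=
      hs.sum_le_tsum _ fun _ _ => by positivity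
    have e4' : 0 ≤ ∑ m ∈ Finset.range (M + 1), 1 / ((m : ℝ) + 1) ^ 2 :=
      Finset.sum_nonneg fun _ _ => by positivity
    have e5 : ((M : ℝ) + 1) * |1 / ((M : ℝ) + 1) ^ 2| ≤ 1 := by
      rw [abs_of_nonneg (by positivity), mul_one_div, div_le_one (by positivity)]
      nlinarith [(Nat.cast_nonneg M : (0 : ℝ) ≤ M)]
    have e6 : Real.log (M + 1) ≤ (harmonic (M + 1) : ℝ) := by
      refine le_trans ?_ (log_add_one_le_harmonic (M + 1))
      push_cast
      gcongr
      linarith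
    have e7 : (harmonic (M + 1) : ℝ) ≤ 1 + Real.log (M + 1) := by
      simpa using harmonic_le_one_add_log (M + 1)
    simp only [e1, e3] at h
    rw [show |(1 : ℝ) / 1 ^ 2| = 1 by norm_num] at h
    have h8 := h.trans (mul_le_mul_of_nonneg_left (show _ ≤ 2 + 8 * Z by linarith) hC0)
    have m1 := mul_le_mul_of_nonneg_left e4 Real.pi_pos.le
    have m2 := mul_nonneg Real.pi_pos.le e4'
    have m3 := mul_le_mul_of_nonneg_left e6 Real.pi_pos.le
    have m4 := mul_le_mul_of_nonneg_left e7 Real.pi_pos.le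
    rw [abs_le] at h8 ⊢
    constructor <;> linarith
  have hmono : ∀ a b : ℕ, a ≤ b → ∑ n ∈ Finset.Ioc 0 a, (repCount n : ℝ) / n ≤
      ∑ n ∈ Finset.Ioc 0 b, (repCount n : ℝ) / n := fun a b hab =>
    Finset.sum_le_sum_of_subset_of_nonneg (Finset.Ioc_subset_Ioc_right hab)
      fun _ _ _ => by positivity
  have hZ : 0 ≤ Z := tsum_nonneg fun _ => by positivity
  refine ⟨C * (2 + 8 * Z) + π * Z + 2 * π + 2 * π, by positivity, fun H hH => ?_⟩
  obtain ⟨M, hM⟩ : ∃ M, Nat.sqrt H = M + 1 := Nat.exists_eq_succ_of_ne_zero (by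
    rw [Ne, Nat.sqrt_eq_zero]; omega)
  have h1 : (M + 1) ^ 2 ≤ H := by rw [← hM]; exact Nat.sqrt_le' H
  have h2 : H ≤ (M + 1 + 1) ^ 2 := by rw [← hM]; exact (Nat.lt_succ_sqrt' H).le
  have h3 := hsq M
  have h4 := hsq (M + 1)
  have h5 := hmono _ _ h1
  have h6 := hmono _ _ h2
  have hH' : (1 : ℝ) ≤ H := by exact_mod_cast hH
  have h7 : 2 * Real.log (M + 1) ≤ Real.log H := by
    rw [← Real.log_rpow (by positivity)]
    exact Real.log_le_log (by positivity) (by exact_mod_cast h1)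
  have h8 : Real.log H ≤ 2 * Real.log ((M + 1 : ℕ) + 1) := by
    rw [← Real.log_rpow (by positivity)]
    exact Real.log_le_log (by positivity) (by exact_mod_cast h2)
  have h9 : Real.log ((M + 1 : ℕ) + 1) ≤ Real.log (M + 1) + 1 := by
    calc Real.log ((M + 1 : ℕ) + 1) ≤ Real.log ((M + 1) * 2) := by
          refine Real.log_le_log (by positivity) ?_
          push_cast; linarith [(Nat.cast_nonneg M : (0 : ℝ) ≤ M)]
      _ ≤ _ := by
          rw [Real.log_mul (by positivity) (by norm_num)]
          linarith [Real.log_two_lt_d9]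
  rw [abs_le] at h3 h4 ⊢
  constructor <;> nlinarith [Real.pi_pos]

theorem Real.abs_sin_le_sqrt {y : ℝ} (hy : 0 ≤ y) : |sin y| ≤ √y := by
  rcases le_total y 1 with h | h
  · have h1 : |sin y| ≤ y := by
      have := Real.abs_sin_le_abs (x := y)
      rwa [abs_of_nonneg hy] at this
    exact h1.trans (Real.le_sqrt_of_sq_le (by nlinarith))
  · exact (Real.abs_sin_le_one y).trans (Real.one_le_sqrt.2 h)

theorem Real.sin_sq_le_mul_sqrt {y : ℝ} (hy : 0 ≤ y) : sin y ^ 2 ≤ y * √y := by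
  have h2 : |sin y| ≤ y := by
    have := Real.abs_sin_le_abs (x := y)
    rwa [abs_of_nonneg hy] at this
  rw [← sq_abs, sq]
  exact mul_le_mul h2 (Real.abs_sin_le_sqrt hy) (abs_nonneg _) hy

theorem hasSum_sin_sq_div_sq {η : ℝ} (h0 : 0 ≤ η) (h1 : η ≤ 1) :
    HasSum (fun m : ℕ => sin (π * η * (m + 1)) ^ 2 / ((m : ℝ) + 1) ^ 2)
      (π ^ 2 * η * (1 - η) / 2) := by
  have hc : ∀ x : ℝ, x ∈ Set.Icc (0 : ℝ) 1 → HasSum (fun n : ℕ => 1 / (n : ℝ) ^ 2 *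
      cos (2 * π * n * x)) (π ^ 2 * (x ^ 2 - x + 1 / 6)) := fun x hx => by
    have h := hasSum_one_div_nat_pow_mul_cos one_ne_zero hx
    convert! h using 1
    simp [Polynomial.bernoulli, Finset.sum_range_succ, bernoulli_one, bernoulli_two, Nat.choose,
        Nat.factorial,
      Polynomial.eval_monomial]
    ring
  have h := ((hc 0 (by simp)).sub (hc η ⟨h0, h1⟩)).mul_left (1 / 2)
  rw [← hasSum_nat_add_iff' 1] at h
  convert! h using 1
  · funext m
    rw [Real.sin_sq_eq_half_sub, show 2 * (π * η * ((m : ℝ) + 1)) = 2 * π * (m + 1) * η by ring]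
    push_cast
    rw [mul_zero, Real.cos_zero]
    ring
  · simp
    ring

/-- The lattice sum giving the diagonal contribution of the multiples of one direction. -/
noncomputable def annulusKernel (η : ℝ) : ℝ :=
  ∑' n : ℕ, (repCount n : ℝ) * ((n : ℝ) ^ (-(3 / 2) : ℝ) * sin (π * η * √n) ^ 2)

theorem rpow_neg_three_halves (n : ℕ) : (n : ℝ) ^ (-(3 / 2) : ℝ) = 1 / √n ^ 3 := by
  rw [Real.sqrt_eq_rpow, ← Real.rpow_natCast, ← Real.rpow_mul (by positivity),
    Real.rpow_neg (by positivity), one_div]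
  norm_num

theorem summable_annulusKernel (η : ℝ) :
    Summable fun n : ℕ => (repCount n : ℝ) * ((n : ℝ) ^ (-(3 / 2) : ℝ) * sin (π * η * √n) ^ 2) :=
  (hasSum_repCount_rpow_mul (by norm_num) fun n => by
    rw [abs_of_nonneg (sq_nonneg _)]
    exact Real.sin_sq_le_one _).summable

theorem tendsto_sum_Ioc {f : ℕ → ℝ} (hf : Summable f) (h0 : f 0 = 0) :
    Tendsto (fun K : ℕ => ∑ n ∈ Finset.Ioc 0 K, f n) atTop (𝓝 (∑' n, f n)) := by
  refine ((tendsto_add_atTop_iff_nat 1).2 hf.hasSum.tendsto_sum_nat).congr fun K => ?_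
  refine (Finset.sum_subset (fun n hn => ?_) fun n hn hn' => ?_).symm
  · rw [Finset.mem_Ioc] at hn
    rw [Finset.mem_range]; omega
  · rw [Finset.mem_range] at hn
    rw [Finset.mem_Ioc] at hn'
    rwa [show n = 0 by omega]

theorem exists_abs_annulusKernel_sub_le : ∃ C : ℝ, 0 ≤ C ∧ ∀ η : ℝ, 0 ≤ η → η ≤ 1 →
    |annulusKernel η - π ^ 3 * η| ≤ C * (η * √η) := by
  obtain ⟨C, hC0, hC⟩ := exists_abs_sum_repCount_sub_le
  have hs : Summable fun m : ℕ => 1 / (((m : ℝ) + 1) * √(m + 1)) := by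
    have h := (summable_nat_add_iff 1).2 (Real.summable_one_div_nat_rpow.2
      (by norm_num : (1 : ℝ) < 3 / 2))
    refine h.congr fun m => ?_
    push_cast
    rw [Real.sqrt_eq_rpow, show (3 / 2 : ℝ) = 1 + 1 / 2 by norm_num,
      Real.rpow_add (by positivity), Real.rpow_one]
  set Z := ∑' m : ℕ, 1 / (((m : ℝ) + 1) * √(m + 1))
  have hZ0 : 0 ≤ Z := tsum_nonneg fun _ => by positivity
  refine ⟨(C * (2 + 40 * Z) + π * Z) * (π * √π) + π ^ 3, by positivity, fun η h0 h1 => ?_⟩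
  set κ : ℝ := π * η * √(π * η) with hκ
  have hκ0 : 0 ≤ κ := by positivity
  have hκ1 : κ = π * √π * (η * √η) := by
    rw [hκ, Real.sqrt_mul Real.pi_pos.le]; ring
  have hsin : ∀ t : ℝ, 0 ≤ t → sin (π * η * t) ^ 2 ≤ κ * (t * √t) := fun t ht => by
    refine (Real.sin_sq_le_mul_sqrt (by positivity)).trans (le_of_eq ?_)
    rw [hκ, Real.sqrt_mul (by positivity) t]; ring
  set ψ : ℝ → ℝ := fun t => sin (π * η * t) ^ 2 / t ^ 3 with hψ
  have hψ0 : ∀ t : ℝ, 0 ≤ t → 0 ≤ ψ t := fun t ht => by positivity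
  have hψb : ∀ t : ℝ, 1 ≤ t → ψ t ≤ κ * (1 / (t * √t)) := fun t ht => by
    have ht0 : 0 < t := by linarith
    have hst := Real.sq_sqrt ht0.le
    rw [hψ]
    simp only
    rw [mul_one_div, div_le_div_iff₀ (by positivity) (by positivity)]
    calc sin (π * η * t) ^ 2 * (t * √t) ≤ κ * (t * √t) * (t * √t) := by
          gcongr; exact hsin t ht0.le
      _ = κ * t ^ 2 * √t ^ 2 := by ring
      _ = 1 * (κ * t ^ 3) := by rw [hst]; ring
      _ = _ := by ring
  have hvar : ∀ (m : ℕ) (t : ℝ), 1 ≤ t → m ≤ t → t ≤ m + 1 →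
      |ψ t - ψ (m + 1)| ≤ 26 * κ * (√(m + 1) / ((m : ℝ) + 1) ^ 3) := by
    intro m t ht1 ht2 ht3
    have hm : (0 : ℝ) ≤ m := Nat.cast_nonneg m
    have hts : (m + 1 : ℝ) ≤ 2 * t := by linarith
    have hdiff : (m + 1 : ℝ) - t ≤ 1 := by linarith
    set s : ℝ := m + 1
    have hs0 : 0 < s := by positivity
    have ht0 : 0 < t := by linarith
    have e1 : ψ t - ψ s = sin (π * η * t) ^ 2 * (1 / t ^ 3 - 1 / s ^ 3) +
        (sin (π * η * t) ^ 2 - sin (π * η * s) ^ 2) * (1 / s ^ 3) := by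
      rw [hψ]; ring
    have e2 : |1 / t ^ 3 - 1 / s ^ 3| ≤ 24 / s ^ 4 := by
      have h : 1 / s ^ 3 ≤ 1 / t ^ 3 := by gcongr
      rw [abs_of_nonneg (by linarith), div_sub_div _ _ (by positivity) (by positivity),
        div_le_div_iff₀ (by positivity) (by positivity)]
      have h1 : 1 * s ^ 3 - t ^ 3 * 1 ≤ 3 * s ^ 2 := by
        have : s ^ 3 - t ^ 3 = (s - t) * (s ^ 2 + s * t + t ^ 2) := by ring
        have h2 : (s - t) * (s ^ 2 + s * t + t ^ 2) ≤ 1 * (s ^ 2 + s * s + s ^ 2) := by gcongr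
        linarith
      have h2 : s ^ 3 ≤ 8 * t ^ 3 := by
        calc s ^ 3 ≤ (2 * t) ^ 3 := by gcongr
          _ = 8 * t ^ 3 := by ring
      calc (1 * s ^ 3 - t ^ 3 * 1) * s ^ 4 ≤ 3 * s ^ 2 * s ^ 4 := by gcongr
        _ = 3 * s ^ 3 * s ^ 3 := by ring
        _ ≤ 3 * s ^ 3 * (8 * t ^ 3) := by gcongr
        _ = 24 * (t ^ 3 * s ^ 3) := by ring
    have e3 : |sin (π * η * t) ^ 2 - sin (π * η * s) ^ 2| ≤ 2 * κ * √s := by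
      have h1 : sin (π * η * t) ^ 2 - sin (π * η * s) ^ 2 =
          sin (π * η * (t + s)) * sin (π * η * (t - s)) := by
        rw [mul_add (π * η) t s, mul_sub (π * η) t s, Real.sin_add, Real.sin_sub]
        linear_combination (-sin (π * η * t) ^ 2) * Real.sin_sq_add_cos_sq (π * η * s) +
          sin (π * η * s) ^ 2 * Real.sin_sq_add_cos_sq (π * η * t)
      have h2 : |sin (π * η * (t + s))| ≤ 2 * (√(π * η) * √s) := by
        refine (Real.abs_sin_le_sqrt (by positivity)).trans ?_
        rw [← Real.sqrt_mul (by positivity), Real.sqrt_le_left (by positivity), mul_pow,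
          Real.sq_sqrt (by positivity)]
        have : π * η * (t + s) ≤ π * η * (4 * s) := by gcongr; linarith
        linarith
      have h3 : |sin (π * η * (t - s))| ≤ π * η := by
        refine Real.abs_sin_le_abs.trans ?_
        rw [abs_mul, abs_of_nonneg (by positivity : 0 ≤ π * η)]
        refine mul_le_of_le_one_right (by positivity) ?_
        rw [abs_le]; constructor <;> linarith
      rw [h1, abs_mul]
      calc _ ≤ 2 * (√(π * η) * √s) * (π * η) := by gcongr
        _ = _ := by rw [hκ]; ring
    rw [e1]
    refine (abs_add_le _ _).trans ?_
    rw [abs_mul, abs_mul, abs_of_nonneg (sq_nonneg _), abs_of_nonneg (by positivity :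
      0 ≤ 1 / s ^ 3)]
    have e4 : sin (π * η * t) ^ 2 ≤ κ * (s * √s) :=
      (hsin t ht0.le).trans (by gcongr)
    calc _ ≤ κ * (s * √s) * (24 / s ^ 4) + 2 * κ * √s * (1 / s ^ 3) := by gcongr
      _ = _ := by field_simp; ring
  have hψsum : ∀ M : ℕ, ∑ m ∈ Finset.range M, ψ (m + 1) ≤ κ * Z := fun M => by
    rw [show κ * Z = ∑' m : ℕ, κ * (1 / (((m : ℝ) + 1) * √(m + 1))) from tsum_mul_left.symm]
    refine (Finset.sum_le_sum fun (m : ℕ) _ => hψb (m + 1)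
      (by linarith [(Nat.cast_nonneg m : (0 : ℝ) ≤ m)])).trans ?_
    exact (hs.mul_left κ).sum_le_tsum _ fun _ _ => by positivity
  have hwsum : ∀ M : ℕ, ∑ m ∈ Finset.range M,
      ((m : ℝ) + 1) * (26 * κ * (√(m + 1) / ((m : ℝ) + 1) ^ 3)) ≤ 26 * (κ * Z) := fun M => by
    rw [show 26 * (κ * Z) = ∑' m : ℕ, 26 * κ * (1 / (((m : ℝ) + 1) * √(m + 1))) by
      rw [tsum_mul_left]; ring]
    refine le_trans (le_of_eq (Finset.sum_congr rfl fun m _ => ?_))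
      ((hs.mul_left (26 * κ)).sum_le_tsum _ fun _ _ => by positivity)
    have : √((m : ℝ) + 1) ^ 2 = m + 1 := Real.sq_sqrt (by positivity)
    field_simp
    linear_combination κ * this
  have hbound : ∀ M : ℕ, |∑ n ∈ Finset.Ioc 0 ((M + 1) ^ 2), (repCount n : ℝ) * ψ √n -
      2 * π * ∑ m ∈ Finset.range (M + 1), sin (π * η * (m + 1)) ^ 2 / ((m : ℝ) + 1) ^ 2| ≤
      (C * (2 + 40 * Z) + π * Z) * κ := fun M => by
    have h := hC ψ _ hvar M
    have hM : (1 : ℝ) ≤ M + 1 := by linarith [(Nat.cast_nonneg M : (0 : ℝ) ≤ M)]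
    have h2 : ((M : ℝ) + 1) * |ψ (M + 1)| ≤ κ := by
      rw [abs_of_nonneg (hψ0 _ (by positivity))]
      calc ((M : ℝ) + 1) * ψ (M + 1) ≤ ((M : ℝ) + 1) * (κ * (1 / ((M + 1) * √(M + 1)))) := by
            gcongr; exact hψb _ hM
        _ = κ / √(M + 1) := by field_simp
        _ ≤ κ := div_le_self hκ0 (Real.one_le_sqrt.2 hM)
    have h3 : |ψ 1| ≤ κ := by
      rw [abs_of_nonneg (hψ0 _ zero_le_one)]
      simpa using hψb 1 le_rfl
    have h4 : ∑ m ∈ Finset.range (M + 1), (2 * (m : ℝ) + 1) * ψ (m + 1) =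
        2 * ∑ m ∈ Finset.range (M + 1), sin (π * η * (m + 1)) ^ 2 / ((m : ℝ) + 1) ^ 2 -
          ∑ m ∈ Finset.range (M + 1), ψ (m + 1) := by
      rw [Finset.mul_sum, ← Finset.sum_sub_distrib]
      refine Finset.sum_congr rfl fun m _ => ?_
      simp only [hψ]
      field_simp
      ring
    have h5 := hψsum (M + 1)
    have h6 : 0 ≤ ∑ m ∈ Finset.range (M + 1), ψ (m + 1) :=
      Finset.sum_nonneg fun m _ => hψ0 _ (by positivity)
    have h7 := hwsum (M + 1)
    have h8 := h.trans (mul_le_mul_of_nonneg_left (show _ ≤ (2 + 40 * Z) * κ by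
      nlinarith [mul_nonneg hκ0 hZ0]) hC0)
    rw [h4] at h8
    have m1 := mul_le_mul_of_nonneg_left h5 Real.pi_pos.le
    have m2 := mul_nonneg Real.pi_pos.le h6
    rw [abs_le] at h8 ⊢
    constructor <;> linarith
  have hψn : ∀ n : ℕ, (repCount n : ℝ) * ψ √n =
      (repCount n : ℝ) * ((n : ℝ) ^ (-(3 / 2) : ℝ) * sin (π * η * √n) ^ 2) := fun n => by
    rw [rpow_neg_three_halves, hψ]; ring
  have hlim1 : Tendsto (fun M : ℕ => ∑ n ∈ Finset.Ioc 0 ((M + 1) ^ 2), (repCount n : ℝ) * ψ √n)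
      atTop (𝓝 (annulusKernel η)) := by
    refine Tendsto.congr (fun M => Finset.sum_congr rfl fun n _ => (hψn n).symm)
      ((tendsto_sum_Ioc (summable_annulusKernel η) (by simp)).comp ?_)
    exact (tendsto_pow_atTop two_ne_zero).comp (tendsto_add_atTop_nat 1)
  have hlim2 := ((hasSum_sin_sq_div_sq h0 h1).tendsto_sum_nat.comp
    (tendsto_add_atTop_nat 1)).const_mul (2 * π)
  have hfin := le_of_tendsto (hlim1.sub hlim2).abs (Eventually.of_forall hbound)
  have h9 : η ^ 2 ≤ η * √η := by
    rw [sq]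
    gcongr
    exact Real.le_sqrt_of_sq_le (by nlinarith)
  have h10 : π ^ 3 * η ^ 2 ≤ π ^ 3 * (η * √η) := by gcongr
  have h11 : 0 ≤ π ^ 3 * η ^ 2 := by positivity
  rw [hκ1] at hfin
  rw [abs_le] at hfin ⊢
  constructor <;> nlinarith

theorem finite_natAbs_norm_fiber (n : ℕ) : Finite {g : GaussianInt // g.norm.natAbs = n} :=
  Finite.of_injective (β := {z : ℤ × ℤ // latNorm z = n})
    (fun g => ⟨gaussianIntEquiv.symm g, by
      rw [← natAbs_norm_gaussianIntEquiv, Equiv.apply_symm_apply, g.2]⟩)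
    fun _ _ h => Subtype.ext (gaussianIntEquiv.symm.injective (congrArg Subtype.val h :))

instance finite_conjCoprime_fiber (n : ℕ) :
    Finite {β : conjCoprime // (β : GaussianInt).norm.natAbs = n} :=
  have := finite_natAbs_norm_fiber n
  Finite.of_injective (β := {g : GaussianInt // g.norm.natAbs = n}) (fun β => ⟨β.1, β.2⟩)
    fun _ _ h => Subtype.ext (Subtype.ext (congrArg Subtype.val h :))

/-- The number of Gaussian integers of norm `n` that are coprime to their conjugate. -/
noncomputable def conjCount (n : ℕ) : ℕ :=
  Nat.card {β : conjCoprime // (β : GaussianInt).norm.natAbs = n}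

theorem conjCount_le (n : ℕ) : conjCount n ≤ repCount n :=
  Nat.card_le_card_of_injective (β := {z : ℤ × ℤ // latNorm z = n})
    (fun β => ⟨gaussianIntEquiv.symm β.1, by
      rw [← natAbs_norm_gaussianIntEquiv, Equiv.apply_symm_apply, β.2]⟩)
    fun a b h => Subtype.ext (Subtype.ext
      (gaussianIntEquiv.symm.injective (Subtype.ext_iff.1 h)))

theorem conjCount_zero : conjCount 0 = 0 := by
  rw [conjCount, Nat.card_eq_zero]
  refine Or.inl ⟨fun β => ne_zero_of_mem_conjCoprime β.1.2 ?_⟩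
  exact (Zsqrtd.norm_eq_zero_iff (by norm_num) _).1 (Int.natAbs_eq_zero.1 β.2)

theorem tsum_repCount_sq_eq_tsum_conjCount (f : ℕ → ENNReal) (hf : f 0 = 0) :
    ∑' n, (repCount n : ENNReal) ^ 2 * f n =
      ∑' m, (conjCount m : ENNReal) * ∑' n, (repCount n : ENNReal) * f (n * m) := by
  rw [tsum_repCount_sq f hf]
  exact ENNReal.tsum_comp_eq_tsum_card_fiber
    (fun β : conjCoprime => (β : GaussianInt).norm.natAbs)
    fun m => ∑' n, (repCount n : ENNReal) * f (n * m)

theorem natAbs_norm_eq (g : GaussianInt) : g.norm.natAbs = g.re.natAbs ^ 2 + g.im.natAbs ^ 2 :=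
  natAbs_norm_gaussianIntEquiv (g.re, g.im)

theorem gcd_eq_one_of_mem_conjCoprime {β : GaussianInt} (hβ : β ∈ conjCoprime) :
    Int.gcd β.re β.im = 1 := by
  have hd : ∀ γ : GaussianInt, γ.re.natAbs = β.re.natAbs → γ.im.natAbs = β.im.natAbs →
      ((Int.gcd β.re β.im : ℤ) : GaussianInt) ∣ γ := fun γ h1 h2 => by
    rw [Zsqrtd.intCast_dvd, ← Int.dvd_natAbs, ← Int.dvd_natAbs (b := γ.im), h1, h2,
      Int.dvd_natAbs, Int.dvd_natAbs]
    exact ⟨Int.gcd_dvd_left _ _, Int.gcd_dvd_right _ _⟩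
  have hβ' : IsCoprime β (star β) := hβ
  have hu := hβ'.isUnit_of_dvd' (hd β rfl rfl) (hd (star β) (by simp) (by simp))
  have h := Zsqrtd.norm_eq_one_iff.2 hu
  rw [natAbs_norm_eq] at h
  simpa using h

theorem odd_norm_of_mem_conjCoprime {β : GaussianInt} (hβ : β ∈ conjCoprime) :
    Odd β.norm.natAbs := by
  by_contra hodd
  rw [Nat.not_odd_iff_even, natAbs_norm_eq] at hodd
  have hd : ∀ γ : GaussianInt, Even (γ.re.natAbs ^ 2 + γ.im.natAbs ^ 2) →
      (⟨1, 1⟩ : GaussianInt) ∣ γ := fun γ h => by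
    have h2 : Even (γ.re + γ.im) := by
      rw [Int.even_add, ← Int.natAbs_even, ← Int.natAbs_even (n := γ.im)]
      simpa [Nat.even_add, Nat.even_pow] using h
    obtain ⟨k, hk⟩ := h2
    refine ⟨⟨k, k - γ.re⟩, ?_⟩
    ext
    · simp
    · simp; omega
  have hβ' : IsCoprime β (star β) := hβ
  have hu := hβ'.isUnit_of_dvd' (hd β hodd) (hd (star β) (by simpa using hodd))
  have h := Zsqrtd.norm_eq_one_iff.2 hu
  rw [natAbs_norm_eq] at h
  norm_num at h

theorem mem_conjCoprime_of_gcd_eq_one {β : GaussianInt} (hodd : Odd β.norm.natAbs)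
    (h : Int.gcd β.re β.im = 1) : β ∈ conjCoprime := by
  obtain ⟨a, b, hab⟩ := Int.isCoprime_iff_gcd_eq_one.2 h
  rw [Int.natAbs_odd] at hodd
  obtain ⟨j, hj⟩ := hodd
  have hn := Zsqrtd.norm_eq_mul_conj β
  rw [hj] at hn
  have h2 : (⟨a, -b⟩ : GaussianInt) * β + ⟨a, b⟩ * star β = 2 := by
    ext
    · simp; linear_combination 2 * hab
    · simp; ring
  refine ⟨star β - j * ⟨a, -b⟩, -j * ⟨a, b⟩, ?_⟩
  push_cast at hn
  linear_combination -hn - j * h2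

theorem exists_equiv_odd_norm :
    ∃ e : ℕ × conjCoprime ≃ {γ : GaussianInt // Odd γ.norm.natAbs},
      ∀ k β, (e (k, β) : GaussianInt) = ((2 * k + 1 : ℕ) : ℤ) * β := by
  have hnorm : ∀ (k : ℕ) (β : GaussianInt), (((k : ℤ) : GaussianInt) * β).norm.natAbs =
      k ^ 2 * β.norm.natAbs := fun k β => by
    rw [Zsqrtd.norm_mul, Zsqrtd.norm_intCast, Int.natAbs_mul, Int.natAbs_mul,
      Int.natAbs_natCast, sq]
  refine ⟨Equiv.ofBijective (fun x => ⟨((2 * x.1 + 1 : ℕ) : ℤ) * x.2, ?_⟩) ⟨?_, ?_⟩,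
    fun k β => rfl⟩
  · rw [hnorm]
    exact (Odd.pow ⟨x.1, rfl⟩).mul (odd_norm_of_mem_conjCoprime x.2.2)
  · rintro ⟨k, β⟩ ⟨l, β'⟩ h
    have h' : ((2 * k + 1 : ℕ) : ℤ) * (β : GaussianInt) = ((2 * l + 1 : ℕ) : ℤ) * β' :=
      Subtype.ext_iff.1 h
    have hg : ∀ (k : ℕ) (β : conjCoprime), Int.gcd (((k : ℤ) * (β : GaussianInt)) :
        GaussianInt).re (((k : ℤ) * (β : GaussianInt)) : GaussianInt).im = k := fun k β => by
      simp [Int.gcd_mul_left, gcd_eq_one_of_mem_conjCoprime β.2]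
    have hkl : 2 * k + 1 = 2 * l + 1 := by rw [← hg (2 * k + 1) β, h', hg]
    have hkl' : k = l := by omega
    subst hkl'
    have h0 : (((2 * k + 1 : ℕ) : ℤ) : GaussianInt) ≠ 0 := by
      rw [Int.cast_ne_zero]; omega
    rw [Subtype.ext (mul_left_cancel₀ h0 h')]
  · rintro ⟨γ, hγ⟩
    set g := Int.gcd γ.re γ.im with hg
    obtain ⟨β, hβ⟩ : ((g : ℤ) : GaussianInt) ∣ γ :=
      (Zsqrtd.intCast_dvd _ _).2 ⟨Int.gcd_dvd_left _ _, Int.gcd_dvd_right _ _⟩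
    have hγ' := hγ
    rw [hβ, hnorm, Nat.odd_mul] at hγ'
    have hgodd : Odd g := (Nat.odd_pow_iff two_ne_zero).1 hγ'.1
    have hβg : Int.gcd β.re β.im = 1 := by
      have h : Int.gcd γ.re γ.im = g * Int.gcd β.re β.im := by
        conv_lhs => rw [hβ]
        simp [Int.gcd_mul_left]
      rw [← hg] at h
      exact (Nat.mul_eq_left hgodd.pos.ne').1 h.symm
    obtain ⟨k, hk⟩ := hgodd
    refine ⟨(k, ⟨β, mem_conjCoprime_of_gcd_eq_one hγ'.2 hβg⟩), Subtype.ext ?_⟩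
    simp only
    rw [← hk, ← hβ]

theorem tsum_odd_repCount (f : ℕ → ENNReal) :
    ∑' n, (repCount n : ENNReal) * (if Odd n then f n else 0) =
      ∑' k : ℕ, ∑' m, (conjCount m : ENNReal) * f ((2 * k + 1) ^ 2 * m) := by
  obtain ⟨e, he⟩ := exists_equiv_odd_norm
  rw [tsum_repCount_eq_tsum_gaussianInt fun n => if Odd n then f n else 0]
  have h1 : ∑' g : GaussianInt, (if Odd g.norm.natAbs then f g.norm.natAbs else 0) =
      ∑' γ : {γ : GaussianInt // Odd γ.norm.natAbs}, f (γ : GaussianInt).norm.natAbs :=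
    (tsum_congr fun g => by simp [Set.indicator]).trans
      (tsum_subtype {γ : GaussianInt | Odd γ.norm.natAbs} fun g => f g.norm.natAbs).symm
  rw [h1, ← e.tsum_eq, ENNReal.tsum_prod']
  refine tsum_congr fun k => ?_
  refine Eq.trans (tsum_congr fun β => ?_) (ENNReal.tsum_comp_eq_tsum_card_fiber
    (fun β : conjCoprime => (β : GaussianInt).norm.natAbs) fun m => f ((2 * k + 1) ^ 2 * m))
  rw [he, Zsqrtd.norm_mul, Zsqrtd.norm_intCast, Int.natAbs_mul, Int.natAbs_mul,
    Int.natAbs_natCast, ← sq]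

theorem repCount_two_mul (n : ℕ) : repCount (2 * n) = repCount n := by
  refine (Nat.card_eq_of_bijective (α := {z : ℤ × ℤ // latNorm z = n})
    (β := {z : ℤ × ℤ // latNorm z = 2 * n}) (fun z => ⟨(z.1.1 - z.1.2, z.1.1 + z.1.2), ?_⟩)
    ⟨?_, ?_⟩).symm
  · have h := z.2
    zify [latNorm] at h ⊢
    simp only [sq_abs] at h ⊢
    linear_combination 2 * h
  · rintro ⟨⟨a, b⟩, h⟩ ⟨⟨c, d⟩, h'⟩ hab
    simp only [Subtype.mk.injEq, Prod.mk.injEq] at hab ⊢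
    omega
  · rintro ⟨⟨a, b⟩, h⟩
    have h1 : Even (a ^ 2 + b ^ 2) := by
      have h' := h
      zify [latNorm] at h'
      simp only [sq_abs] at h'
      exact ⟨n, by rw [h']; ring⟩
    have h2 : Even (a + b) := by simpa [Int.even_add, Int.even_pow] using h1
    obtain ⟨k, hk⟩ := h2
    obtain rfl : b = k + k - a := by omega
    refine ⟨⟨(k, k - a), ?_⟩, ?_⟩
    · zify [latNorm] at h ⊢
      simp only [sq_abs] at h ⊢
      nlinarith
    · simp only [Subtype.mk.injEq, Prod.mk.injEq]
      constructor <;> ring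

theorem sum_odd_repCount_div_eq (H : ℕ) :
    ∑ n ∈ Finset.Ioc 0 H, (if Odd n then (repCount n : ℝ) / n else 0) =
      ∑ n ∈ Finset.Ioc 0 H, (repCount n : ℝ) / n -
        1 / 2 * ∑ n ∈ Finset.Ioc 0 (H / 2), (repCount n : ℝ) / n := by
  have h : ∑ n ∈ Finset.Ioc 0 H, (if Odd n then 0 else (repCount n : ℝ) / n) =
      1 / 2 * ∑ n ∈ Finset.Ioc 0 (H / 2), (repCount n : ℝ) / n := by
    have h1 : ∀ n, (if Odd n then 0 else (repCount n : ℝ) / n) =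
        if Even n then (repCount n : ℝ) / n else 0 := fun n => by
      rcases Nat.even_or_odd n with hn | hn
      · rw [if_neg (Nat.not_odd_iff_even.2 hn), if_pos hn]
      · rw [if_pos hn, if_neg (Nat.not_even_iff_odd.2 hn)]
    simp only [h1]
    rw [← Finset.sum_filter, Finset.mul_sum]
    symm
    refine Finset.sum_bij (fun n _ => 2 * n) ?_ ?_ ?_ ?_
    · intro n hn
      simp only [Finset.mem_Ioc, Finset.mem_filter] at hn ⊢
      exact ⟨by omega, even_two_mul n⟩
    · intro a _ b _ hab; omega
    · intro n hn
      simp only [Finset.mem_Ioc, Finset.mem_filter] at hn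
      obtain ⟨k, hk⟩ := hn.2
      exact ⟨k, by simp only [Finset.mem_Ioc]; omega, by omega⟩
    · intro n _
      rw [repCount_two_mul]
      push_cast
      ring
  rw [← h, ← Finset.sum_sub_distrib]
  refine Finset.sum_congr rfl fun n _ => ?_
  split_ifs <;> simp

theorem exists_abs_sum_odd_repCount_div_sub_log_le : ∃ C, 0 ≤ C ∧ ∀ H : ℕ, 1 ≤ H →
    |∑ n ∈ Finset.Ioc 0 H, (if Odd n then (repCount n : ℝ) / n else 0) - π / 2 * log H| ≤ C := by
  obtain ⟨C, hC0, hC⟩ := exists_abs_sum_repCount_div_sub_log_le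
  refine ⟨C + C / 2 + π * log 4, by positivity, fun H hH => ?_⟩
  rw [sum_odd_repCount_div_eq]
  have h1 := abs_le.1 (hC H hH)
  have hH' : (1 : ℝ) ≤ H := by exact_mod_cast hH
  have hl4 : 0 ≤ log 4 := log_nonneg (by norm_num)
  have hp := pi_pos
  rcases Nat.lt_or_ge H 2 with h2 | h2
  · obtain rfl : H = 1 := by omega
    simp only [Nat.cast_one, log_one, mul_zero, sub_zero] at h1 ⊢
    norm_num [Finset.Ioc_self] at h1 ⊢
    nlinarith
  · have h3 := abs_le.1 (hC (H / 2) (by omega))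
    have h4 : log ((H / 2 : ℕ) : ℝ) ≤ log H :=
      log_le_log (by exact_mod_cast (by omega : 0 < H / 2)) (by exact_mod_cast Nat.div_le_self _ _)
    have h5 : log H - log 4 ≤ log ((H / 2 : ℕ) : ℝ) := by
      rw [← log_div (by positivity) (by norm_num)]
      refine log_le_log (by positivity) ?_
      rw [div_le_iff₀ (by norm_num)]
      exact_mod_cast (by omega : H ≤ H / 2 * 4)
    rw [abs_le]
    constructor <;> nlinarith

theorem hasSum_one_div_odd_sq :
    HasSum (fun k : ℕ => 1 / ((2 * k + 1 : ℕ) : ℝ) ^ 2) (π ^ 2 / 8) := by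
  have h := hasSum_zeta_two
  have he : HasSum (fun k : ℕ => 1 / ((2 * k : ℕ) : ℝ) ^ 2) (π ^ 2 / 24) := by
    convert! h.mul_left (1 / 4) using 1
    · ext k; push_cast; rw [mul_pow]; ring
    · ring
  have hs : Summable (fun k : ℕ => 1 / ((2 * k + 1 : ℕ) : ℝ) ^ 2) :=
    h.summable.comp_injective (i := fun k : ℕ => 2 * k + 1) fun a b hab => by
      simpa using hab
  have h2 := (HasSum.even_add_odd (f := fun k : ℕ => 1 / (k : ℝ) ^ 2) he hs.hasSum).unique h
  have : ∑' k : ℕ, 1 / ((2 * k + 1 : ℕ) : ℝ) ^ 2 = π ^ 2 / 8 := by linarith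
  exact this ▸ hs.hasSum

/-- The logarithmic sum of `conjCount`. -/
noncomputable def conjLogSum (H : ℕ) : ℝ := ∑ m ∈ Finset.Ioc 0 H, (conjCount m : ℝ) / m

theorem tsum_mul_ofReal_ite_div (r : ℕ → ℕ) (H : ℕ) (d : ℕ) (hd : 0 < d) :
    ∑' m, (r m : ENNReal) *
        (if d * m ∈ Finset.Ioc 0 H then ENNReal.ofReal (1 / (d * m : ℕ)) else 0) =
      ENNReal.ofReal (1 / d * ∑ m ∈ Finset.Ioc 0 (H / d), (r m : ℝ) / m) := by
  have h : ∀ m, (d * m ∈ Finset.Ioc 0 H) = (m ∈ Finset.Ioc 0 (H / d)) := fun m => by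
    simp only [Finset.mem_Ioc, Nat.le_div_iff_mul_le hd, mul_comm d, eq_iff_iff]
    exact and_congr_left fun _ => by simp [hd]
  simp only [h]
  rw [Finset.mul_sum, ENNReal.ofReal_sum_of_nonneg fun m _ => by positivity,
    tsum_eq_sum (s := Finset.Ioc 0 (H / d)) fun m hm => by rw [if_neg hm, mul_zero]]
  refine Finset.sum_congr rfl fun m hm => ?_
  rw [if_pos hm, ← ENNReal.ofReal_natCast (r m), ← ENNReal.ofReal_mul (by positivity)]
  push_cast
  congr 1
  rw [one_div_mul_eq_div, div_div, mul_one_div, mul_comm (d : ℝ)]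

theorem ofReal_sum_odd_repCount_div (H : ℕ) :
    ENNReal.ofReal (∑ n ∈ Finset.Ioc 0 H, (if Odd n then (repCount n : ℝ) / n else 0)) =
      ∑' k : ℕ, ENNReal.ofReal
        (1 / ((2 * k + 1 : ℕ) : ℝ) ^ 2 * conjLogSum (H / (2 * k + 1) ^ 2)) := by
  have h := tsum_odd_repCount fun n =>
    if n ∈ Finset.Ioc 0 H then ENNReal.ofReal (1 / (n : ℕ)) else 0
  calc _ = ∑' n, (repCount n : ENNReal) *
        (if Odd n then (if n ∈ Finset.Ioc 0 H then ENNReal.ofReal (1 / (n : ℕ)) else 0)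
          else 0) := by
        rw [ENNReal.ofReal_sum_of_nonneg fun n _ => by split_ifs <;> positivity,
          tsum_eq_sum (s := Finset.Ioc 0 H) fun m hm => by rw [if_neg hm, ite_self, mul_zero]]
        refine Finset.sum_congr rfl fun n hn => ?_
        rw [if_pos hn]
        split_ifs
        · rw [← ENNReal.ofReal_natCast (repCount n), ← ENNReal.ofReal_mul (by positivity),
            mul_one_div]
        · simp
    _ = _ := by
        rw [h]
        refine tsum_congr fun k => ?_
        rw [tsum_mul_ofReal_ite_div conjCount H _ (by positivity)]
        push_cast
        rfl

theorem conjLogSum_nonneg (H : ℕ) : 0 ≤ conjLogSum H :=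
  Finset.sum_nonneg fun m _ => by positivity

theorem conjLogSum_mono : Monotone conjLogSum := fun a b hab =>
  Finset.sum_le_sum_of_subset_of_nonneg (Finset.Ioc_subset_Ioc_right hab)
    fun m _ _ => by positivity

theorem sum_odd_repCount_div_le (H : ℕ) :
    ∑ n ∈ Finset.Ioc 0 H, (if Odd n then (repCount n : ℝ) / n else 0) ≤
      π ^ 2 / 8 * conjLogSum H := by
  rw [← ENNReal.ofReal_le_ofReal_iff (mul_nonneg (by positivity) (conjLogSum_nonneg H)),
    ofReal_sum_odd_repCount_div, ← (hasSum_one_div_odd_sq.mul_right (conjLogSum H)).tsum_eq,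
    ENNReal.ofReal_tsum_of_nonneg
      (fun k => mul_nonneg (by positivity) (conjLogSum_nonneg H))
      (hasSum_one_div_odd_sq.mul_right (conjLogSum H)).summable]
  exact ENNReal.tsum_le_tsum fun k => ENNReal.ofReal_le_ofReal
    (mul_le_mul_of_nonneg_left (conjLogSum_mono (Nat.div_le_self _ _)) (by positivity))

theorem sum_mul_conjLogSum_le (K H : ℕ) :
    (∑ k ∈ Finset.range K, 1 / ((2 * k + 1 : ℕ) : ℝ) ^ 2) * conjLogSum H ≤
      ∑ n ∈ Finset.Ioc 0 ((2 * K + 1) ^ 2 * H),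
        (if Odd n then (repCount n : ℝ) / n else 0) := by
  rw [← ENNReal.ofReal_le_ofReal_iff (Finset.sum_nonneg fun n _ => by split_ifs <;> positivity),
    ofReal_sum_odd_repCount_div, Finset.sum_mul, ENNReal.ofReal_sum_of_nonneg
      (fun k _ => mul_nonneg (by positivity) (conjLogSum_nonneg H))]
  refine le_trans (Finset.sum_le_sum fun k hk => ENNReal.ofReal_le_ofReal
    (mul_le_mul_of_nonneg_left (conjLogSum_mono ?_) (by positivity)))
    (ENNReal.sum_le_tsum (Finset.range K))
  rw [Nat.le_div_iff_mul_le (by positivity), mul_comm]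
  have := Finset.mem_range.1 hk
  gcongr

theorem tendsto_conjLogSum_div_log :
    Tendsto (fun H : ℕ => conjLogSum H / log H) atTop (𝓝 (4 / π)) := by
  obtain ⟨C, hC0, hC⟩ := exists_abs_sum_odd_repCount_div_sub_log_le
  have hp := pi_pos
  have hlog : Tendsto (fun H : ℕ => log (H : ℝ)) atTop atTop :=
    tendsto_log_atTop.comp tendsto_natCast_atTop_atTop
  have hlim : ∀ a b c : ℝ, Tendsto (fun H : ℕ => a + b / log (H : ℝ) + c / log (H : ℝ)) atTop
      (𝓝 a) := fun a b c => by
    simpa using (tendsto_const_nhds.add (hlog.const_div_atTop b)).add (hlog.const_div_atTop c)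
  have hev : ∀ᶠ H : ℕ in atTop, 1 ≤ H ∧ 0 < log (H : ℝ) :=
    (eventually_ge_atTop 1).and (hlog.eventually_gt_atTop 0)
  refine tendsto_order.2 ⟨fun a ha => ?_, fun a ha => ?_⟩
  · filter_upwards [hev, (hlim (4 / π) (-(8 / π ^ 2 * C)) 0).eventually (lt_mem_nhds ha)]
      with H ⟨hH, hl⟩ h
    refine h.trans_le ?_
    have h1 := (abs_le.1 (hC H hH)).1
    have h2 := sum_odd_repCount_div_le H
    have h3 : π / 2 * log H - C ≤ π ^ 2 / 8 * conjLogSum H := by linarith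
    rw [zero_div, add_zero, add_div' _ _ _ hl.ne', div_le_div_iff_of_pos_right hl]
    have h4 := mul_le_mul_of_nonneg_left h3 (by positivity : (0:ℝ) ≤ 8 / π ^ 2)
    have e1 : 8 / π ^ 2 * (π ^ 2 / 8 * conjLogSum H) = conjLogSum H := by field_simp
    have e2 : 8 / π ^ 2 * (π / 2 * log H - C) = 4 / π * log H + -(8 / π ^ 2 * C) := by
      field_simp; ring
    linarith
  · have hs : Tendsto (fun K : ℕ => π / 2 / ∑ k ∈ Finset.range K, 1 / ((2 * k + 1 : ℕ) : ℝ) ^ 2)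
        atTop (𝓝 (4 / π)) := by
      convert! (tendsto_const_nhds (x := π / 2)).div hasSum_one_div_odd_sq.tendsto_sum_nat
        (by positivity) using 2
      field_simp; norm_num
    obtain ⟨K, hK, hK1⟩ := ((hs.eventually (gt_mem_nhds ha)).and (eventually_ge_atTop 1)).exists
    set s := ∑ k ∈ Finset.range K, 1 / ((2 * k + 1 : ℕ) : ℝ) ^ 2 with hs'
    have hs0 : 0 < s := Finset.sum_pos (fun k _ => by positivity) ⟨0, Finset.mem_range.2 hK1⟩
    filter_upwards [hev,
        (hlim (π / 2 / s) (C / s) (π / 2 * log ((2 * K + 1) ^ 2 : ℝ) / s)).eventually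
      (gt_mem_nhds hK)] with H ⟨hH, hl⟩ h
    refine lt_of_le_of_lt ?_ h
    have h1 := (abs_le.1 (hC ((2 * K + 1) ^ 2 * H) (Nat.mul_pos (by positivity) hH))).2
    have h2 := sum_mul_conjLogSum_le K H
    have hH' : (H : ℝ) ≠ 0 := by exact_mod_cast (by omega : H ≠ 0)
    push_cast at h1
    rw [log_mul (by positivity) hH'] at h1
    rw [add_div' _ _ _ hl.ne', add_mul, div_mul_cancel₀ _ hl.ne', div_le_div_iff_of_pos_right hl]
    have h3 : s * conjLogSum H ≤ π / 2 * log H + C + π / 2 * log ((2 * K + 1) ^ 2) := by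
      rw [hs']; linarith
    calc conjLogSum H = s * conjLogSum H / s := by field_simp
      _ ≤ (π / 2 * log H + C + π / 2 * log ((2 * K + 1) ^ 2)) / s := by gcongr
      _ = _ := by ring

theorem exists_sum_repCount_rpow_tail_le : ∃ D : ℝ, 0 ≤ D ∧ ∀ N : ℕ, 1 ≤ N → ∀ s : Finset ℕ,
    (∀ n ∈ s, N < n) → ∑ n ∈ s, (repCount n : ℝ) * (n : ℝ) ^ (-(3 / 2) : ℝ) ≤ D / √N := by
  obtain ⟨C, hC0, hC⟩ := exists_abs_sum_repCount_div_sub_log_le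
  set E := π * log 2 + 2 * C with hE
  have hE0 : 0 ≤ E := by have := log_nonneg (by norm_num : (1 : ℝ) ≤ 2); positivity
  have h2 : 0 < 1 - 1 / √2 := by
    rw [sub_pos, div_lt_one (by positivity)]
    exact Real.lt_sqrt_of_sq_lt (by norm_num)
  set D := E / (1 - 1 / √2) with hD
  have hdy : ∀ M : ℕ, 1 ≤ M →
      ∑ n ∈ Finset.Ioc M (2 * M), (repCount n : ℝ) * (n : ℝ) ^ (-(3 / 2) : ℝ) ≤ E / √M := by
    intro M hM
    have hM' : (0 : ℝ) < M := by exact_mod_cast hM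
    calc _ ≤ ∑ n ∈ Finset.Ioc M (2 * M), 1 / √M * ((repCount n : ℝ) / n) := by
          refine Finset.sum_le_sum fun n hn => ?_
          have hn' : (M : ℝ) ≤ n := by exact_mod_cast (Finset.mem_Ioc.1 hn).1.le
          have hn0 : (0 : ℝ) < n := hM'.trans_le hn'
          rw [rpow_neg_three_halves, mul_one_div, one_div_mul_eq_div, div_div]
          refine div_le_div_of_nonneg_left (by positivity) (by positivity) ?_
          have : √(n : ℝ) ^ 3 = n * √n := by rw [pow_succ, sq_sqrt hn0.le]
          rw [this]
          gcongr
      _ ≤ 1 / √M * E := by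
          rw [← Finset.mul_sum]
          refine mul_le_mul_of_nonneg_left ?_ (by positivity)
          have h1 := abs_le.1 (hC M hM)
          have h3 := abs_le.1 (hC (2 * M) (by omega))
          rw [← Finset.sum_Ioc_consecutive _ (Nat.zero_le M) (by omega : M ≤ 2 * M)] at h3
          push_cast at h3
          rw [log_mul two_ne_zero hM'.ne'] at h3
          linarith [h1.1, h3.2]
      _ = _ := by ring
  refine ⟨D, div_nonneg hE0 h2.le, fun N hN s hs => ?_⟩
  have hN' : (0 : ℝ) < N := by exact_mod_cast hN
  have hJ : ∀ J : ℕ, ∑ n ∈ Finset.Ioc N (2 ^ J * N), (repCount n : ℝ) * (n : ℝ) ^ (-(3 / 2) : ℝ) ≤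
      D * (1 / √N - 1 / √((2 ^ J * N : ℕ) : ℝ)) := by
    intro J
    induction J with
    | zero => simp
    | succ J ih =>
      have hle : N ≤ 2 ^ J * N := Nat.le_mul_of_pos_left _ (by positivity)
      have h3 := hdy (2 ^ J * N) (hN.trans hle)
      rw [pow_succ', mul_assoc, ← Finset.sum_Ioc_consecutive _ hle (by omega)]
      have h4 : D * (1 / √((2 ^ J * N : ℕ) : ℝ) - 1 / √((2 * (2 ^ J * N) : ℕ) : ℝ)) =
          E / √((2 ^ J * N : ℕ) : ℝ) := by
        rw [Nat.cast_mul 2, Nat.cast_ofNat, Real.sqrt_mul (by norm_num),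
          show E = D * (1 - 1 / √2) from (div_mul_cancel₀ _ h2.ne').symm]
        field_simp
      linarith
  obtain ⟨J, hJs⟩ : ∃ J, ∀ n ∈ s, n ≤ 2 ^ J := ⟨s.sup id, fun n hn =>
    (Finset.le_sup (f := id) hn).trans Nat.lt_two_pow_self.le⟩
  calc _ ≤ ∑ n ∈ Finset.Ioc N (2 ^ J * N), (repCount n : ℝ) * (n : ℝ) ^ (-(3 / 2) : ℝ) :=
        Finset.sum_le_sum_of_subset_of_nonneg (fun n hn => Finset.mem_Ioc.2
          ⟨hs n hn, (hJs n hn).trans (Nat.le_mul_of_pos_right _ hN)⟩) fun n _ _ => by positivity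
    _ ≤ D * (1 / √N - 1 / √((2 ^ J * N : ℕ) : ℝ)) := hJ J
    _ ≤ D * (1 / √N) := mul_le_mul_of_nonneg_left (by simp) (div_nonneg hE0 h2.le)
    _ = _ := mul_one_div _ _

theorem summable_repCount_sq_rpow {s : ℝ} (hs : 1 < s) :
    Summable fun n : ℕ => (repCount n : ℝ) ^ 2 * (n : ℝ) ^ (-s) := by
  obtain ⟨C, hC0, hC⟩ := exists_repCount_le (ε := (s - 1) / 2) (by linarith)
  refine ((summable_repCount_rpow (s := (s + 1) / 2) (by linarith)).mul_left C).of_nonneg_of_le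
    (fun n => by positivity) fun n => ?_
  rcases Nat.eq_zero_or_pos n with rfl | hn
  · rw [Nat.cast_zero, zero_rpow (by linarith), zero_rpow (by linarith)]; simp
  · have hn' : (0 : ℝ) < n := by exact_mod_cast hn
    calc (repCount n : ℝ) ^ 2 * (n : ℝ) ^ (-s)
        ≤ (repCount n : ℝ) * (C * (n : ℝ) ^ ((s - 1) / 2)) * (n : ℝ) ^ (-s) := by
          rw [sq]; gcongr; exact hC n hn
      _ = C * (repCount n * ((n : ℝ) ^ ((s - 1) / 2) * (n : ℝ) ^ (-s))) := by ring
      _ = _ := by rw [← rpow_add hn']; congr 3; ring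

/-- The variance sum of the annulus of width `δ`. -/
noncomputable def annulusSq (δ : ℝ) : ℝ :=
  ∑' n : ℕ, (repCount n : ℝ) ^ 2 * ((n : ℝ) ^ (-(3 / 2) : ℝ) * sin (π * δ * √n) ^ 2)

theorem summable_annulusSq (δ : ℝ) : Summable fun n : ℕ =>
    (repCount n : ℝ) ^ 2 * ((n : ℝ) ^ (-(3 / 2) : ℝ) * sin (π * δ * √n) ^ 2) := by
  refine (summable_repCount_sq_rpow (s := 3 / 2) (by norm_num)).of_nonneg_of_le
    (fun n => by positivity) fun n => ?_
  exact mul_le_mul_of_nonneg_left (mul_le_of_le_one_right (by positivity) (sin_sq_le_one _))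
    (by positivity)

theorem annulusKernel_nonneg (η : ℝ) : 0 ≤ annulusKernel η :=
  tsum_nonneg fun n => by positivity

theorem annulusKernel_le (η : ℝ) :
    annulusKernel η ≤ ∑' n : ℕ, (repCount n : ℝ) * (n : ℝ) ^ (-(3 / 2) : ℝ) :=
  (summable_annulusKernel η).tsum_le_tsum (fun n => mul_le_mul_of_nonneg_left
    (mul_le_of_le_one_right (by positivity) (sin_sq_le_one _)) (by positivity))
    (summable_repCount_rpow (by norm_num))

theorem hasSum_annulusSq (δ : ℝ) : HasSum (fun m : ℕ =>
    (conjCount m : ℝ) * ((m : ℝ) ^ (-(3 / 2) : ℝ) * annulusKernel (δ * √m))) (annulusSq δ) := by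
  have hnn : ∀ m : ℕ, 0 ≤ (conjCount m : ℝ) * ((m : ℝ) ^ (-(3 / 2) : ℝ) * annulusKernel (δ * √m)) :=
    fun m => mul_nonneg (by positivity) (mul_nonneg (by positivity) (annulusKernel_nonneg _))
  have hs : Summable fun m : ℕ =>
      (conjCount m : ℝ) * ((m : ℝ) ^ (-(3 / 2) : ℝ) * annulusKernel (δ * √m)) := by
    refine ((summable_repCount_rpow (s := 3 / 2) (by norm_num)).mul_right
      (∑' n : ℕ, (repCount n : ℝ) * (n : ℝ) ^ (-(3 / 2) : ℝ))).of_nonneg_of_le hnn fun m => ?_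
    rw [mul_assoc]
    refine mul_le_mul (by exact_mod_cast conjCount_le m) ?_
      (mul_nonneg (by positivity) (annulusKernel_nonneg _)) (by positivity)
    exact mul_le_mul_of_nonneg_left (annulusKernel_le _) (by positivity)
  convert! hs.hasSum using 1
  rw [annulusSq,
    ← ENNReal.ofReal_eq_ofReal_iff (tsum_nonneg fun n => by positivity) (tsum_nonneg hnn),
    ENNReal.ofReal_tsum_of_nonneg (fun n => by positivity) (summable_annulusSq δ),
    ENNReal.ofReal_tsum_of_nonneg hnn hs]
  have h := tsum_repCount_sq_eq_tsum_conjCount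
    (fun n => ENNReal.ofReal ((n : ℝ) ^ (-(3 / 2) : ℝ) * sin (π * δ * √n) ^ 2)) (by simp)
  convert! h using 1
  · refine tsum_congr fun n => ?_
    rw [ENNReal.ofReal_mul (by positivity), ENNReal.ofReal_pow (by positivity),
      ENNReal.ofReal_natCast]
  · refine tsum_congr fun m => ?_
    rw [ENNReal.ofReal_mul (by positivity), ENNReal.ofReal_natCast, annulusKernel, ← tsum_mul_left,
      ENNReal.ofReal_tsum_of_nonneg (fun n => by positivity)
        ((summable_annulusKernel _).mul_left _)]
    congr 1
    refine tsum_congr fun n => ?_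
    rw [← ENNReal.ofReal_natCast (repCount n), ← ENNReal.ofReal_mul (by positivity)]
    push_cast
    rw [mul_rpow (by positivity) (by positivity), sqrt_mul (by positivity)]
    congr 1
    rw [show π * (δ * √m) * √n = π * δ * (√n * √m) by ring]
    ring

theorem exists_abs_annulusSq_sub_le : ∃ C : ℝ, 0 ≤ C ∧ ∀ δ η : ℝ, 0 < δ → δ ≤ η → η ≤ 1 →
    |annulusSq δ - π ^ 3 * δ * conjLogSum ⌊(η / δ) ^ 2⌋₊| ≤
      C * (√η * δ * conjLogSum ⌊(η / δ) ^ 2⌋₊ + δ / η) := by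
  obtain ⟨C, hC0, hC⟩ := exists_abs_annulusKernel_sub_le
  obtain ⟨D, hD0, hD⟩ := exists_sum_repCount_rpow_tail_le
  set B := ∑' n : ℕ, (repCount n : ℝ) * (n : ℝ) ^ (-(3 / 2) : ℝ) with hB
  have hB0 : 0 ≤ B := tsum_nonneg fun n => by positivity
  refine ⟨C + B * D * 2, by positivity, fun δ η hδ hδη hη => ?_⟩
  have hη0 : 0 < η := hδ.trans_le hδη
  set H := ⌊(η / δ) ^ 2⌋₊ with hH
  have h1 : 1 ≤ η / δ := (one_le_div hδ).2 hδη
  have hH1 : 1 ≤ H := Nat.le_floor (by simpa only [Nat.cast_one] using one_le_pow₀ h1)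
  have hHle : (H : ℝ) ≤ (η / δ) ^ 2 := Nat.floor_le (by positivity)
  have hHge : (η / δ) ^ 2 ≤ 4 * H := by
    have := (Nat.lt_floor_add_one ((η / δ) ^ 2)).le
    have : (1 : ℝ) ≤ H := by exact_mod_cast hH1
    linarith
  have hsq : 1 / √(H : ℝ) ≤ 2 * (δ / η) := by
    have h2 : η / δ ≤ 2 * √H := by
      rw [show (2 : ℝ) * √H = √(4 * H) by
        rw [sqrt_mul (by norm_num), show (4 : ℝ) = 2 ^ 2 by norm_num, sqrt_sq (by norm_num)]]
      exact Real.le_sqrt_of_sq_le hHge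
    have hH0 : 0 < √(H : ℝ) := by positivity
    rw [div_le_iff₀ hH0]
    calc (1 : ℝ) = δ / η * (η / δ) := by field_simp
      _ ≤ δ / η * (2 * √H) := by gcongr
      _ = _ := by ring
  set g : ℕ → ℝ := fun m => (conjCount m : ℝ) * ((m : ℝ) ^ (-(3 / 2) : ℝ) *
    annulusKernel (δ * √m)) with hg
  have hg0 : g 0 = 0 := by simp [hg, conjCount_zero]
  have hlim := tendsto_sum_Ioc (hasSum_annulusSq δ).summable hg0
  rw [(hasSum_annulusSq δ).tsum_eq] at hlim
  refine le_of_tendsto (hlim.sub_const _).abs ?_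
  filter_upwards [eventually_ge_atTop H] with M hM
  rw [← Finset.sum_Ioc_consecutive _ (Nat.zero_le H) hM]
  have hpt : ∀ m ∈ Finset.Ioc 0 H, |g m - π ^ 3 * δ * ((conjCount m : ℝ) / m)| ≤
      C * (√η * δ * ((conjCount m : ℝ) / m)) := by
    intro m hm
    rw [Finset.mem_Ioc] at hm
    have hm0 : (0 : ℝ) < m := by exact_mod_cast hm.1
    have hsm : 0 < √(m : ℝ) := sqrt_pos.2 hm0
    have hss : √(m : ℝ) ^ 2 = m := sq_sqrt hm0.le
    have hdm : (conjCount m : ℝ) / m = conjCount m / √m ^ 2 := by rw [hss]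
    have h3 : δ * √m ≤ η := by
      have : √(m : ℝ) ≤ η / δ := by
        rw [sqrt_le_left (by positivity)]
        exact le_trans (by exact_mod_cast hm.2) hHle
      calc δ * √m ≤ δ * (η / δ) := by gcongr
        _ = η := by field_simp
    have h4 := hC (δ * √m) (by positivity) (h3.trans hη)
    have e1 : g m - π ^ 3 * δ * ((conjCount m : ℝ) / m) = (conjCount m : ℝ) *
        (1 / √m ^ 3) * (annulusKernel (δ * √m) - π ^ 3 * (δ * √m)) := by
      simp only [hg]
      rw [rpow_neg_three_halves, hdm]
      field_simp
    rw [e1, abs_mul, abs_of_nonneg (by positivity)]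
    calc _ ≤ (conjCount m : ℝ) * (1 / √m ^ 3) * (C * (δ * √m * √η)) := by
          refine mul_le_mul_of_nonneg_left (h4.trans ?_) (by positivity)
          gcongr
      _ = _ := by
          rw [hdm]
          field_simp
  have htail : |∑ m ∈ Finset.Ioc H M, g m| ≤ B * (D / √H) := by
    rw [abs_of_nonneg (Finset.sum_nonneg fun m _ => mul_nonneg (by positivity)
      (mul_nonneg (by positivity) (annulusKernel_nonneg _)))]
    refine le_trans ?_ (mul_le_mul_of_nonneg_left (hD H hH1 (Finset.Ioc H M) fun n hn =>
      (Finset.mem_Ioc.1 hn).1) hB0)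
    rw [Finset.mul_sum]
    refine Finset.sum_le_sum fun m _ => ?_
    rw [mul_comm B, mul_assoc]
    refine mul_le_mul (by exact_mod_cast conjCount_le m) ?_
      (mul_nonneg (by positivity) (annulusKernel_nonneg _)) (by positivity)
    exact mul_le_mul_of_nonneg_left (annulusKernel_le _) (by positivity)
  have hmain : |∑ m ∈ Finset.Ioc 0 H, g m - π ^ 3 * δ * conjLogSum H| ≤
      C * (√η * δ * conjLogSum H) := by
    simp only [conjLogSum]
    simp only [Finset.mul_sum]
    rw [← Finset.sum_sub_distrib]
    exact (Finset.abs_sum_le_sum_abs _ _).trans (Finset.sum_le_sum hpt)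
  have hL := conjLogSum_nonneg H
  have hlast : B * (D / √H) ≤ B * D * 2 * (δ / η) := by
    rw [div_eq_mul_one_div, ← mul_assoc, mul_assoc (B * D) 2]
    gcongr
  calc _ = |(∑ m ∈ Finset.Ioc 0 H, g m - π ^ 3 * δ * conjLogSum H) +
        ∑ m ∈ Finset.Ioc H M, g m| := by congr 1; ring
    _ ≤ C * (√η * δ * conjLogSum H) + B * D * 2 * (δ / η) :=
        (abs_add_le _ _).trans (add_le_add hmain (htail.trans hlast))
    _ ≤ _ := by
        have h5 : 0 ≤ C * (δ / η) := by positivity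
        have h6 : 0 ≤ B * D * 2 * (√η * δ * conjLogSum H) := by positivity
        nlinarith

theorem tendsto_conjLogSum_floor_div_log {η : ℝ} (hη : 0 < η) :
    Tendsto (fun x : ℝ => conjLogSum ⌊(η * x) ^ 2⌋₊ / log x) atTop (𝓝 (8 / π)) := by
  have hsq : Tendsto (fun x : ℝ => (η * x) ^ 2) atTop atTop :=
    (tendsto_pow_atTop two_ne_zero).comp (tendsto_id.const_mul_atTop hη)
  have hfl : Tendsto (fun x : ℝ => ⌊(η * x) ^ 2⌋₊) atTop atTop := tendsto_nat_floor_atTop.comp hsq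
  have h1 := tendsto_conjLogSum_div_log.comp hfl
  have h2 : Tendsto (fun x : ℝ => log (⌊(η * x) ^ 2⌋₊ : ℝ) / log x) atTop (𝓝 2) := by
    have h3 := ((tendsto_nat_floor_div_atTop (R := ℝ)).comp hsq).log one_ne_zero
    have h4 : Tendsto
        (fun x : ℝ => (log ((⌊(η * x) ^ 2⌋₊ : ℝ) / (η * x) ^ 2) + 2 * log η) / log x + 2)
        atTop (𝓝 2) := by
      simpa using ((h3.add_const (2 * log η)).div_atTop tendsto_log_atTop).add_const 2
    refine h4.congr' ?_
    filter_upwards [eventually_gt_atTop 1, hfl.eventually_gt_atTop 0] with x hx hH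
    have hl := log_pos hx
    have hx0 : 0 < x := by linarith
    have hH' : (⌊(η * x) ^ 2⌋₊ : ℝ) ≠ 0 := by exact_mod_cast hH.ne'
    rw [log_div hH' (by positivity), log_pow, log_mul hη.ne' hx0.ne']
    field_simp
    push_cast
    ring
  have h5 := h1.mul h2
  rw [show 4 / π * 2 = 8 / π by ring] at h5
  refine h5.congr' ?_
  filter_upwards [hfl.eventually_gt_atTop 1] with x hH
  exact div_mul_div_cancel₀ (log_pos (by exact_mod_cast hH)).ne'

theorem tendsto_annulusSq_div :
    Tendsto (fun δ : ℝ => annulusSq δ / (δ * log (1 / δ))) (𝓝[>] 0) (𝓝 (8 * π ^ 2)) := by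
  obtain ⟨C, hC0, hC⟩ := exists_abs_annulusSq_sub_le
  have hp := pi_pos
  suffices h : Tendsto (fun x : ℝ => annulusSq x⁻¹ / (x⁻¹ * log x)) atTop (𝓝 (8 * π ^ 2)) by
    refine (h.comp tendsto_inv_nhdsGT_zero).congr fun x => ?_
    simp
  rw [Metric.tendsto_nhds]
  intro ε hε
  obtain ⟨η, hη0, hη1, hη⟩ : ∃ η : ℝ, 0 < η ∧ η ≤ 1 ∧ C * √η * (8 / π) < ε / 2 := by
    have h : Tendsto (fun η : ℝ => C * √η * (8 / π)) (𝓝[>] 0) (𝓝 0) := by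
      refine Tendsto.mono_left ?_ nhdsWithin_le_nhds
      have : ContinuousAt (fun η : ℝ => C * √η * (8 / π)) 0 := by fun_prop
      simpa [ContinuousAt] using this
    obtain ⟨η, h1, h2, h3⟩ := ((h.eventually (gt_mem_nhds (half_pos hε))).and
      ((eventually_mem_nhdsWithin).and (nhdsWithin_le_nhds (ge_mem_nhds one_pos)))).exists
    exact ⟨η, h2, h3, h1⟩
  have hL := tendsto_conjLogSum_floor_div_log hη0
  have h1 : Tendsto (fun x : ℝ => C * √η * (conjLogSum ⌊(η * x) ^ 2⌋₊ / log x) + C / η / log x)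
      atTop (𝓝 (C * √η * (8 / π))) := by
    simpa using (hL.const_mul (C * √η)).add (tendsto_log_atTop.const_div_atTop (C / η))
  have h2 : Tendsto (fun x : ℝ => π ^ 3 * (conjLogSum ⌊(η * x) ^ 2⌋₊ / log x)) atTop
      (𝓝 (8 * π ^ 2)) := by
    convert! hL.const_mul (π ^ 3) using 2
    field_simp
  filter_upwards [h1.eventually (gt_mem_nhds hη), Metric.tendsto_nhds.1 h2 _ (half_pos hε),
    eventually_gt_atTop 1, eventually_ge_atTop (1 / η)] with x hx1 hx2 hx hxη
  have hx0 : 0 < x := by linarith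
  have hl := log_pos hx
  have h3 := hC x⁻¹ η (by positivity) (by
    rw [inv_le_comm₀ hx0 hη0]; simpa using hxη) hη1
  rw [div_inv_eq_mul] at h3
  rw [dist_eq] at hx2 ⊢
  set L := conjLogSum ⌊(η * x) ^ 2⌋₊
  have h4 : |annulusSq x⁻¹ / (x⁻¹ * log x) - π ^ 3 * (L / log x)| < ε / 2 := by
    refine lt_of_le_of_lt ?_ hx1
    have e : annulusSq x⁻¹ / (x⁻¹ * log x) - π ^ 3 * (L / log x) =
        (annulusSq x⁻¹ - π ^ 3 * x⁻¹ * L) / (x⁻¹ * log x) := by field_simp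
    rw [e, abs_div, abs_of_pos (by positivity : 0 < x⁻¹ * log x), div_le_iff₀ (by positivity)]
    refine h3.trans_eq ?_
    field_simp
  calc _ ≤ _ := abs_sub_le _ (π ^ 3 * (L / log x)) _
    _ < ε / 2 + ε / 2 := add_lt_add h4 hx2
    _ = ε := add_halves ε

theorem Nat.eq_of_isSquare_mul_of_squarefree {a b : ℕ} (ha : Squarefree a) (hb : Squarefree b)
    (h : IsSquare (a * b)) : a = b := by
  obtain ⟨c, hc⟩ := h
  have ha0 : a ≠ 0 := ha.ne_zero
  have hac : a ∣ c := by
    have : a ∣ c ^ 2 := ⟨b, by rw [hc, sq]⟩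
    exact (ha.dvd_pow_iff_dvd two_ne_zero).1 this
  obtain ⟨d, rfl⟩ := hac
  have hb' : b = a * (d * d) := by
    apply Nat.eq_of_mul_eq_mul_left (Nat.pos_of_ne_zero ha0)
    rw [hc]; ring
  have hd : IsUnit d := hb d ⟨a, by rw [hb']; ring⟩
  rw [Nat.isUnit_iff] at hd
  rw [hb', hd]; ring

theorem Algebra.trace_eq_zero_of_sq_eq {K L : Type*} [Field K] [Field L] [Algebra K L]
    [FiniteDimensional K L] {x : L} {a : K} (hx : x ^ 2 = algebraMap K L a)
    (ha : ¬ IsSquare a) : Algebra.trace K L x = 0 := by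
  have hirr : Irreducible (Polynomial.X ^ 2 - Polynomial.C a) :=
    X_pow_sub_C_irreducible_of_prime Nat.prime_two fun b hb => ha ⟨b, by rw [← hb, sq]⟩
  have hmin : Polynomial.X ^ 2 - Polynomial.C a = minpoly K x :=
    minpoly.eq_of_irreducible_of_monic hirr (by simp [hx])
      (Polynomial.monic_X_pow_sub_C a two_ne_zero)
  rw [trace_eq_finrank_mul_minpoly_nextCoeff, ← hmin,
    Polynomial.nextCoeff_of_natDegree_pos (by simp)]
  simp

theorem finrank_adjoin_sqrt_le (s : Finset ℕ) :
    FiniteDimensional ℚ (IntermediateField.adjoin ℚ ((fun q : ℕ => ((√(q : ℝ) : ℝ) : ℂ)) '' s)) ∧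
    Module.finrank ℚ (IntermediateField.adjoin ℚ ((fun q : ℕ => ((√(q : ℝ) : ℝ) : ℂ)) '' s))
      ≤ 2 ^ s.card := by
  classical
  induction s using Finset.induction_on with
  | empty =>
    rw [Finset.coe_empty, Set.image_empty, IntermediateField.adjoin_empty]
    exact ⟨inferInstance, by simp⟩
  | insert a s has ih =>
    obtain ⟨ih1, ih2⟩ := ih
    have hroot : ((√(a : ℝ) : ℝ) : ℂ) ^ 2 = (a : ℂ) := by
      rw [← Complex.ofReal_pow, Real.sq_sqrt (Nat.cast_nonneg a), Complex.ofReal_natCast]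
    have hmonic := Polynomial.monic_X_pow_sub_C (a : ℚ) two_ne_zero
    have haeval : Polynomial.aeval ((√(a : ℝ) : ℝ) : ℂ)
        (Polynomial.X ^ 2 - Polynomial.C (a : ℚ)) = 0 := by
      simp [hroot]
    have hintg : IsIntegral ℚ ((√(a : ℝ) : ℝ) : ℂ) := ⟨_, hmonic, haeval⟩
    have hfd := IntermediateField.adjoin.finiteDimensional hintg
    have h2 : Module.finrank ℚ (IntermediateField.adjoin ℚ {((√(a : ℝ) : ℝ) : ℂ)}) ≤ 2 := by
      rw [IntermediateField.adjoin.finrank hintg]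
      refine (Polynomial.natDegree_le_of_dvd (minpoly.dvd _ _ haeval) hmonic.ne_zero).trans ?_
      rw [Polynomial.natDegree_X_pow_sub_C]
    rw [Finset.coe_insert, Set.image_insert_eq, Set.insert_eq, IntermediateField.adjoin_union,
      Finset.card_insert_of_notMem has, pow_succ']
    exact ⟨IntermediateField.finiteDimensional_sup _ _,
      IntermediateField.finrank_sup_le _ _ |>.trans (Nat.mul_le_mul h2 ih2)⟩

theorem one_le_pow_mul_abs_sum_sqrt {s : Finset ℕ} (hs : ∀ q ∈ s, Squarefree q) {k : ℕ → ℤ}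
    (hk : ∃ q ∈ s, k q ≠ 0) {J : ℕ} (hJ : s.card ≤ J) {B : ℝ} (hB1 : 1 ≤ B)
    (hB : ∑ q ∈ s, |(k q : ℝ)| * √(q : ℝ) ≤ B) :
    1 ≤ B ^ (2 ^ J) * |∑ q ∈ s, (k q : ℝ) * √(q : ℝ)| := by
  classical
  obtain ⟨hfd, hrank⟩ := finrank_adjoin_sqrt_le s
  set K := IntermediateField.adjoin ℚ ((fun q : ℕ => ((√(q : ℝ) : ℝ) : ℂ)) '' s) with hK
  have hmem : ∀ q ∈ s, ((√(q : ℝ) : ℝ) : ℂ) ∈ K := fun q hq =>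
    IntermediateField.subset_adjoin _ _ ⟨q, hq, rfl⟩
  set ρ : ℕ → K := fun q => if h : q ∈ s then ⟨((√(q : ℝ) : ℝ) : ℂ), hmem q h⟩ else 0 with hρ
  have hρval : ∀ q ∈ s, ((ρ q : K) : ℂ) = ((√(q : ℝ) : ℝ) : ℂ) := fun q hq => by simp [hρ, hq]
  have hρsq : ∀ q ∈ s, ρ q ^ 2 = (q : K) := by
    intro q hq
    apply Subtype.ext
    have : ((√(q : ℝ) : ℝ) : ℂ) ^ 2 = (q : ℂ) := by
      rw [← Complex.ofReal_pow, Real.sq_sqrt (Nat.cast_nonneg q), Complex.ofReal_natCast]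
    simpa [hρval q hq] using this
  set α : K := ∑ q ∈ s, (k q : K) * ρ q with hα
  have hα0 : α ≠ 0 := by
    intro h0
    obtain ⟨p, hp, hkp⟩ := hk
    have h1 : Algebra.trace ℚ K (α * ρ p) = 0 := by rw [h0, zero_mul, map_zero]
    rw [hα, Finset.sum_mul, map_sum, Finset.sum_eq_single_of_mem p hp] at h1
    · have : (k p : K) * ρ p * ρ p = algebraMap ℚ K ((k p : ℚ) * (p : ℚ)) := by
        rw [mul_assoc, ← sq, hρsq p hp]; simp
      rw [this, Algebra.trace_algebraMap] at h1
      have hp0 : p ≠ 0 := (hs p hp).ne_zero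
      have hfr : Module.finrank ℚ K ≠ 0 := Module.finrank_pos.ne'
      simp [hkp, hp0, hfr] at h1
    · intro q hq hqp
      have : (k q : K) * ρ q * ρ p = (k q : ℚ) • (ρ q * ρ p) := by
        rw [Algebra.smul_def]; simp [mul_assoc]
      rw [this, map_smul, Algebra.trace_eq_zero_of_sq_eq (a := ((q * p : ℕ) : ℚ)), smul_zero]
      · rw [mul_pow, hρsq q hq, hρsq p hp]; simp
      · rw [Rat.isSquare_natCast_iff]
        exact fun h => hqp (Nat.eq_of_isSquare_mul_of_squarefree (hs q hq) (hs p hp) h)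
  have hαint : IsIntegral ℤ α := by
    refine IsIntegral.sum _ fun q hq => IsIntegral.mul (isIntegral_algebraMap (x := k q)) ?_
    refine IsIntegral.of_pow two_pos ?_
    rw [hρsq q hq]
    exact isIntegral_algebraMap (x := (q : ℤ))
  have hnorm : (1 : ℝ) ≤ ‖algebraMap ℚ ℂ (Algebra.norm ℚ α)‖ := by
    obtain ⟨m, hm⟩ := IsIntegrallyClosed.isIntegral_iff.1 (Algebra.isIntegral_norm ℚ hαint)
    have hm0 : m ≠ 0 := by
      rintro rfl
      exact Algebra.norm_ne_zero_iff.2 hα0 (by rw [← hm]; simp)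
    rw [← hm]
    simpa using (by exact_mod_cast Int.one_le_abs hm0 : (1 : ℝ) ≤ |(m : ℝ)|)
  have hemb : ∀ σ : K →ₐ[ℚ] ℂ, ‖σ α‖ ≤ B := by
    intro σ
    refine le_trans ?_ hB
    rw [hα, map_sum]
    refine (norm_sum_le _ _).trans (Finset.sum_le_sum fun q hq => ?_)
    rw [map_mul, norm_mul, map_intCast, Complex.norm_intCast]
    refine mul_le_mul_of_nonneg_left (le_of_eq ?_) (abs_nonneg _)
    have h2 : ‖σ (ρ q)‖ ^ 2 = q := by
      rw [← norm_pow, ← map_pow, hρsq q hq, map_natCast, Complex.norm_natCast]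
    rw [← h2, Real.sqrt_sq (norm_nonneg _)]
  have hval : ‖K.val α‖ = |∑ q ∈ s, (k q : ℝ) * √(q : ℝ)| := by
    rw [← Real.norm_eq_abs, ← Complex.norm_real, hα, map_sum]
    push_cast
    congr 1
    refine Finset.sum_congr rfl fun q hq => ?_
    rw [map_mul, map_intCast, IntermediateField.coe_val, hρval q hq]
  have hprod : ∀ t : Finset (K →ₐ[ℚ] ℂ), K.val ∈ t → t.card ≤ 2 ^ J →
      ∏ σ ∈ t, ‖σ α‖ ≤ B ^ (2 ^ J) * ‖K.val α‖ := by
    intro t ht htc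
    rw [← Finset.mul_prod_erase t (fun σ => ‖σ α‖) ht, mul_comm]
    refine mul_le_mul_of_nonneg_right ?_ (norm_nonneg _)
    exact (Finset.prod_le_prod (fun σ _ => norm_nonneg _) fun σ _ => hemb σ).trans
      ((Finset.prod_const B).le.trans
      (pow_le_pow_right₀ hB1 ((Finset.card_erase_le).trans htc)))
  rw [Algebra.norm_eq_prod_embeddings, norm_prod] at hnorm
  rw [← hval]
  refine hnorm.trans (hprod _ (Finset.mem_univ _) ?_)
  rw [Finset.card_univ, AlgHom.card]
  exact hrank.trans (Nat.pow_le_pow_right two_pos hJ)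

/-- The uniform probability measure on sequences of phases in `(0, 1]`. -/
noncomputable def phaseMeasure : Measure (ℕ → ℝ) :=
  Measure.infinitePi fun _ => volume.restrict (Set.Ioc 0 1)

instance : IsProbabilityMeasure ((volume : Measure ℝ).restrict (Set.Ioc 0 1)) := ⟨by simp⟩

instance : IsProbabilityMeasure phaseMeasure := by unfold phaseMeasure; infer_instance

theorem integral_phaseMeasure_prod {𝕜 : Type*} [RCLike 𝕜] (Q : Finset ℕ) {f : ℕ → ℝ → 𝕜}
    (hf : ∀ r, Continuous (f r)) :
    ∫ y, ∏ r ∈ Q, f r (y r) ∂phaseMeasure = ∏ r ∈ Q, ∫ t in (0 : ℝ)..1, f r t := by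
  have h := integral_restrict_infinitePi (μ := fun _ : ℕ => volume.restrict (Set.Ioc (0:ℝ) 1))
    (s := Q) (f := fun y : Q → ℝ => ∏ r : Q, f r (y r))
    (Continuous.aestronglyMeasurable (by fun_prop))
  rw [integral_fintype_prod_eq_prod (fun r : Q => f r),
    Finset.prod_coe_sort Q fun r => ∫ t in Set.Ioc (0:ℝ) 1, f r t] at h
  simp only [intervalIntegral.integral_of_le zero_le_one]
  rw [← h, phaseMeasure]
  congr 1
  ext y
  exact (Finset.prod_coe_sort Q fun r => f r (y r)).symm

open Complex in
theorem intervalIntegral_cexp_two_pi (k : ℤ) :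
    ∫ t in (0 : ℝ)..1, cexp (2 * π * I * (k * t)) = if k = 0 then 1 else 0 := by
  split_ifs with h
  · simp [h]
  · have hc : 2 * (π : ℂ) * I * k ≠ 0 := by
      simp [h, pi_ne_zero, I_ne_zero]
    have := integral_exp_mul_complex (a := 0) (b := 1) hc
    simp only [mul_assoc] at this ⊢
    rw [this, show 2 * ((π : ℂ) * (I * (k * (1 : ℝ)))) = k * (2 * π * I) by push_cast; ring,
      exp_int_mul_two_pi_mul_I]
    simp

open Complex in
theorem integral_phaseMeasure_cexp (Q : Finset ℕ) (k : ℕ → ℤ) :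
    ∫ y, cexp (2 * π * I * (∑ r ∈ Q, (k r : ℝ) * y r : ℝ)) ∂phaseMeasure =
      if ∃ r ∈ Q, k r ≠ 0 then 0 else 1 := by
  have h := integral_phaseMeasure_prod Q (f := fun r t => cexp (2 * π * I * (k r * t)))
    (fun r => by fun_prop)
  simp only [intervalIntegral_cexp_two_pi] at h
  convert! h using 1
  · congr 1
    ext y
    rw [← Complex.exp_sum, ← Finset.mul_sum]
    push_cast
    rfl
  · split_ifs with h0
    · obtain ⟨r, hr, hk⟩ := h0
      rw [Finset.prod_eq_zero hr (if_neg hk)]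
    · push Not at h0
      exact (Finset.prod_eq_one fun r hr => if_pos (h0 r hr)).symm

/-- The mean value of `f` over `[X, 2 * X]`. -/
noncomputable def dyadicMean {E : Type*} [NormedAddCommGroup E] [NormedSpace ℝ E] (X : ℝ)
    (f : ℝ → E) : E := X⁻¹ • ∫ x in X..2 * X, f x

open Complex in
theorem norm_dyadicMean_cexp_le {X Λ : ℝ} (hX : 0 < X) (hΛ : Λ ≠ 0) :
    ‖dyadicMean X fun x => cexp (2 * π * I * (Λ * x : ℝ))‖ ≤ 1 / (π * X * |Λ|) := by
  have hc : 2 * (π : ℂ) * I * Λ ≠ 0 := by simp [hΛ, pi_ne_zero, I_ne_zero]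
  have h := integral_exp_mul_complex (a := X) (b := 2 * X) hc
  have hn : ∀ x : ℝ, ‖cexp (2 * π * I * Λ * x)‖ = 1 := fun x => by
    rw [show 2 * (π : ℂ) * I * Λ * x = (2 * π * Λ * x : ℝ) * I by push_cast; ring,
      norm_exp_ofReal_mul_I]
  rw [dyadicMean, norm_smul]
  push_cast
  simp only [← mul_assoc]
  rw [h, norm_div, Real.norm_of_nonneg (inv_nonneg.2 hX.le)]
  have h2 : ‖cexp (2 * π * I * Λ * (2 * X : ℝ)) - cexp (2 * π * I * Λ * X)‖ ≤ 2 := by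
    refine (norm_sub_le _ _).trans ?_
    rw [hn, hn]; norm_num
  have h3 : ‖2 * (π : ℂ) * I * Λ‖ = 2 * π * |Λ| := by
    simp [abs_of_pos pi_pos]
  rw [h3]
  have hΛ' : 0 < |Λ| := abs_pos.2 hΛ
  have hp := pi_pos
  calc X⁻¹ * (‖cexp (2 * π * I * Λ * (2 * X : ℝ)) - cexp (2 * π * I * Λ * X)‖ / (2 * π * |Λ|))
      ≤ X⁻¹ * (2 / (2 * π * |Λ|)) := by gcongr
    _ = _ := by field_simp

section PhaseSum

variable {ι : Type*} (S : Finset ι) (q m : ι → ℕ) (a φ : ι → ℝ)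

/-- The trigonometric sum whose `i`-th term depends only on the phase `y (q i)`. -/
noncomputable def phaseSum (y : ℕ → ℝ) : ℝ :=
  ∑ i ∈ S, a i * cos (2 * π * (m i * y (q i)) + φ i)

theorem continuous_phaseSum : Continuous (phaseSum S q m a φ) := by
  unfold phaseSum
  fun_prop

theorem abs_phaseSum_le (y : ℕ → ℝ) : |phaseSum S q m a φ y| ≤ ∑ i ∈ S, |a i| :=
  (Finset.abs_sum_le_sum_abs _ _).trans <| Finset.sum_le_sum fun i _ => by
    rw [abs_mul]
    exact mul_le_of_le_one_right (abs_nonneg _) (abs_cos_le_one _)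

variable {q m} in
/-- The frequency vector of a product of exponentials. -/
def phaseFreq {k : ℕ} (q m : ι → ℕ) (p : Fin k → ι × ℤ) (r : ℕ) : ℤ :=
  ∑ j, if q (p j).1 = r then (p j).2 * m (p j).1 else 0

theorem sum_phaseFreq_mul {k : ℕ} (p : Fin k → ι × ℤ) {Q : Finset ℕ}
    (hp : ∀ j, q (p j).1 ∈ Q) (y : ℕ → ℝ) :
    ∑ r ∈ Q, (phaseFreq q m p r : ℝ) * y r =
      ∑ j, ((p j).2 * m (p j).1 : ℝ) * y (q (p j).1) := by
  simp only [phaseFreq, Int.cast_sum, Finset.sum_mul]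
  rw [Finset.sum_comm]
  refine Finset.sum_congr rfl fun j _ => ?_
  simp only [Int.cast_ite, Int.cast_mul, Int.cast_natCast, Int.cast_zero, ite_mul, zero_mul]
  rw [Finset.sum_ite_eq, if_pos (hp j)]

open Complex in
/-- The coefficient of an exponential in a phase sum. -/
noncomputable def phaseCoeff (x : ι × ℤ) : ℂ := a x.1 / 2 * cexp (x.2 * φ x.1 * I)

theorem norm_phaseCoeff (x : ι × ℤ) : ‖phaseCoeff a φ x‖ = |a x.1| / 2 := by
  rw [phaseCoeff, norm_mul, ← Complex.ofReal_intCast, ← Complex.ofReal_mul,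
    Complex.norm_exp_ofReal_mul_I]
  simp

open Complex in
theorem ofReal_phaseSum (y : ℕ → ℝ) : (phaseSum S q m a φ y : ℂ) =
    ∑ x ∈ S ×ˢ ({1, -1} : Finset ℤ), phaseCoeff a φ x *
      cexp (2 * π * I * ((x.2 * m x.1 : ℝ) * y (q x.1) : ℝ)) := by
  rw [Finset.sum_product, phaseSum, ofReal_sum]
  refine Finset.sum_congr rfl fun i _ => ?_
  rw [Finset.sum_pair (by norm_num)]
  simp only [phaseCoeff]
  push_cast
  rw [Complex.cos, mul_assoc (_ / 2), mul_assoc (_ / 2), ← Complex.exp_add, ← Complex.exp_add]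
  ring_nf

open Complex in
theorem ofReal_phaseSum_pow (k : ℕ) (y : ℕ → ℝ) : ((phaseSum S q m a φ y ^ k : ℝ) : ℂ) =
    ∑ p ∈ Fintype.piFinset fun _ : Fin k => S ×ˢ ({1, -1} : Finset ℤ),
      (∏ j, phaseCoeff a φ (p j)) *
        cexp (2 * π * I * (∑ r ∈ S.image q, (phaseFreq q m p r : ℝ) * y r : ℝ)) := by
  rw [ofReal_pow, ofReal_phaseSum, ← Fin.prod_const, Finset.prod_univ_sum]
  refine Finset.sum_congr rfl fun p hp => ?_
  rw [Finset.prod_mul_distrib, ← Complex.exp_sum, ← Finset.mul_sum,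
    sum_phaseFreq_mul q m p (fun j => Finset.mem_image_of_mem q
      (Finset.mem_product.1 (Fintype.mem_piFinset.1 hp j)).1) y, ofReal_sum]

theorem sum_prod_norm_phaseCoeff (k : ℕ) :
    ∑ p ∈ Fintype.piFinset fun _ : Fin k => S ×ˢ ({1, -1} : Finset ℤ),
      ∏ j, ‖phaseCoeff a φ (p j)‖ = (∑ i ∈ S, |a i|) ^ k := by
  rw [Finset.sum_prod_piFinset _ fun _ x => ‖phaseCoeff a φ x‖, Fin.prod_const,
    Finset.sum_product]
  congr 1
  refine Finset.sum_congr rfl fun i _ => ?_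
  rw [Finset.sum_pair (by norm_num), norm_phaseCoeff, norm_phaseCoeff, add_halves]

theorem one_le_pow_mul_abs_phaseFreq {k : ℕ} {p : Fin k → ι × ℤ}
    (hp : p ∈ Fintype.piFinset fun _ : Fin k => S ×ˢ ({1, -1} : Finset ℤ))
    (hq : ∀ i ∈ S, Squarefree (q i)) {Y : ℝ} (hY1 : 1 ≤ Y) (hY : ∀ i ∈ S, m i * √(q i) ≤ Y)
    (h : ∃ r ∈ S.image q, phaseFreq q m p r ≠ 0) :
    1 ≤ ((k + 1) * Y) ^ 2 ^ k * |∑ r ∈ S.image q, (phaseFreq q m p r : ℝ) * √r| := by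
  have hpS : ∀ j, (p j).1 ∈ S := fun j => (Finset.mem_product.1 (Fintype.mem_piFinset.1 hp j)).1
  have hp1 : ∀ j, |((p j).2 : ℝ)| = 1 := fun j => by
    have := (Finset.mem_product.1 (Fintype.mem_piFinset.1 hp j)).2
    simp only [Finset.mem_insert, Finset.mem_singleton] at this
    rcases this with h | h <;> simp [h]
  set s := Finset.univ.image fun j => q (p j).1 with hs
  have hps : ∀ j, q (p j).1 ∈ s := fun j => Finset.mem_image_of_mem _ (Finset.mem_univ j)
  have hsupp : ∀ r, phaseFreq q m p r ≠ 0 → r ∈ s := fun r hr => by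
    obtain ⟨j, _, hj⟩ := Finset.exists_ne_zero_of_sum_ne_zero hr
    rw [hs, Finset.mem_image]
    exact ⟨j, Finset.mem_univ j, by by_contra h0; exact hj (if_neg h0)⟩
  rw [sum_phaseFreq_mul q m p (fun j => Finset.mem_image_of_mem q (hpS j)) fun r => √r,
    ← sum_phaseFreq_mul q m p hps fun r => √r]
  refine one_le_pow_mul_abs_sum_sqrt ?_ ?_ ?_ ?_ ?_
  · intro r hr
    obtain ⟨j, _, rfl⟩ := Finset.mem_image.1 hr
    exact hq _ (hpS j)
  · obtain ⟨r, _, hr⟩ := h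
    exact ⟨r, hsupp r hr, hr⟩
  · exact Finset.card_image_le.trans (by simp)
  · have : (0 : ℝ) ≤ k := by positivity
    nlinarith
  · calc ∑ r ∈ s, |(phaseFreq q m p r : ℝ)| * √r
        ≤ ∑ r ∈ s, ∑ j, (if q (p j).1 = r then (m (p j).1 : ℝ) * √r else 0) := by
          refine Finset.sum_le_sum fun r _ => ?_
          rw [phaseFreq, Int.cast_sum]
          refine (mul_le_mul_of_nonneg_right (Finset.abs_sum_le_sum_abs _ _)
            (sqrt_nonneg _)).trans_eq ?_
          rw [Finset.sum_mul]
          refine Finset.sum_congr rfl fun j _ => ?_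
          split_ifs
          · rw [Int.cast_mul, abs_mul, hp1, one_mul, Int.cast_natCast, Nat.abs_cast]
          · simp
      _ = ∑ j, (m (p j).1 : ℝ) * √(q (p j).1) := by
          rw [Finset.sum_comm]
          refine Finset.sum_congr rfl fun j _ => ?_
          rw [Finset.sum_ite_eq, if_pos (hps j)]
      _ ≤ ∑ _j : Fin k, Y := Finset.sum_le_sum fun j _ => hY _ (hpS j)
      _ = k * Y := by simp
      _ ≤ (k + 1) * Y := by nlinarith

open Complex in
theorem abs_dyadicMean_phaseSum_pow_sub_le {X : ℝ} (hX : 0 < X)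
    (hq : ∀ i ∈ S, Squarefree (q i)) {Y : ℝ} (hY1 : 1 ≤ Y) (hY : ∀ i ∈ S, m i * √(q i) ≤ Y)
    (k : ℕ) :
    |dyadicMean X (fun x => phaseSum S q m a φ (fun r => √r * x) ^ k) -
      ∫ y, phaseSum S q m a φ y ^ k ∂phaseMeasure| ≤
      (∑ i ∈ S, |a i|) ^ k * ((k + 1) * Y) ^ 2 ^ k / (π * X) := by
  set P := Fintype.piFinset fun _ : Fin k => S ×ˢ ({1, -1} : Finset ℤ)
  set Λ : (Fin k → ι × ℤ) → ℝ := fun p => ∑ r ∈ S.image q, (phaseFreq q m p r : ℝ) * √r with hΛ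
  have h1 : ((dyadicMean X (fun x => phaseSum S q m a φ (fun r => √r * x) ^ k) : ℝ) : ℂ) =
      ∑ p ∈ P, (∏ j, phaseCoeff a φ (p j)) *
        dyadicMean X fun x => cexp (2 * π * I * (Λ p * x : ℝ)) := by
    rw [dyadicMean, smul_eq_mul, ofReal_mul, ← intervalIntegral.integral_ofReal]
    simp only [ofReal_phaseSum_pow, ← mul_assoc, ← Finset.sum_mul]
    rw [intervalIntegral.integral_finsetSum fun p _ =>
      (Continuous.intervalIntegrable (by fun_prop) _ _), Finset.mul_sum]
    refine Finset.sum_congr rfl fun p _ => ?_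
    rw [intervalIntegral.integral_const_mul, dyadicMean, real_smul]
    simp only [mul_assoc]
    ring
  have h2 : ((∫ y, phaseSum S q m a φ y ^ k ∂phaseMeasure : ℝ) : ℂ) =
      ∑ p ∈ P, (∏ j, phaseCoeff a φ (p j)) *
        if ∃ r ∈ S.image q, phaseFreq q m p r ≠ 0 then 0 else 1 := by
    rw [← integral_complex_ofReal]
    simp only [ofReal_phaseSum_pow]
    rw [integral_finsetSum]
    · refine Finset.sum_congr rfl fun p _ => ?_
      rw [integral_const_mul, integral_phaseMeasure_cexp]
    · intro p _
      refine Integrable.const_mul (Integrable.of_bound (C := 1)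
        (Continuous.aestronglyMeasurable (by fun_prop)) (ae_of_all _ fun y => ?_)) _
      rw [show 2 * (π : ℂ) * I * (∑ r ∈ S.image q, (phaseFreq q m p r : ℝ) * y r : ℝ) =
        (2 * π * ∑ r ∈ S.image q, (phaseFreq q m p r : ℝ) * y r : ℝ) * I by push_cast; ring,
        norm_exp_ofReal_mul_I]
  rw [← Real.norm_eq_abs, ← norm_real, ofReal_sub, h1, h2, ← Finset.sum_sub_distrib]
  refine (norm_sum_le _ _).trans ?_
  rw [← sum_prod_norm_phaseCoeff S a φ k, mul_div_assoc, Finset.sum_mul]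
  refine Finset.sum_le_sum fun p hp => ?_
  rw [← mul_sub, norm_mul, norm_prod]
  refine mul_le_mul_of_nonneg_left ?_ (Finset.prod_nonneg fun _ _ => norm_nonneg _)
  have hp0 := pi_pos
  split_ifs with h
  · rw [sub_zero]
    have h3 := one_le_pow_mul_abs_phaseFreq S q m hp hq hY1 hY h
    have hΛ0 : Λ p ≠ 0 := fun h0 => by
      have h4 : ∑ r ∈ S.image q, (phaseFreq q m p r : ℝ) * √r = 0 := h0
      rw [h4, abs_zero, mul_zero] at h3
      linarith
    refine (norm_dyadicMean_cexp_le hX hΛ0).trans ?_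
    rw [div_le_div_iff₀ (by positivity) (by positivity)]
    calc 1 * (π * X) ≤ (((k + 1) * Y) ^ 2 ^ k * |Λ p|) * (π * X) := by gcongr
      _ = _ := by ring
  · have h0 : Λ p = 0 := by
      push Not at h
      exact Finset.sum_eq_zero fun r hr => by rw [h r hr, Int.cast_zero, zero_mul]
    have h5 : dyadicMean X (fun x => cexp (2 * π * I * (Λ p * x : ℝ))) = 1 := by
      have : 2 * X - X = X := by ring
      simp [dyadicMean, h0, this, hX.ne']
    rw [h5, sub_self, norm_zero]
    have : 0 ≤ Y := by linarith
    positivity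

end PhaseSum

theorem integral_cos_two_pi_int_mul_add {k : ℤ} (hk : k ≠ 0) (φ : ℝ) :
    ∫ t in (0 : ℝ)..1, cos (2 * π * (k * t) + φ) = 0 := by
  have hk' : 2 * π * (k : ℝ) ≠ 0 := by simp [hk, pi_ne_zero]
  simp only [← mul_assoc]
  rw [intervalIntegral.integral_comp_mul_add _ hk', integral_cos]
  rw [show 2 * π * (k : ℝ) * 1 + φ = φ + k * (2 * π) by ring, sin_add_int_mul_two_pi]
  simp

section Block

variable {g : ℝ → ℝ} {b s : ℝ}

/-- Sub-Gaussian bound for the exponential moments of a bounded centred function. -/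
theorem integral_exp_mul_le_exp (hg : Continuous g) (hb : ∀ t, |g t| ≤ b)
    (h0 : ∫ t in (0 : ℝ)..1, g t = 0) (hs : ∫ t in (0 : ℝ)..1, g t ^ 2 = s) {l : ℝ}
    (hl : |l| * b ≤ 1) : ∫ t in (0 : ℝ)..1, exp (l * g t) ≤ exp (l ^ 2 * s) := by
  have hpt : ∀ t, exp (l * g t) ≤ 1 + l * g t + l ^ 2 * g t ^ 2 := fun t => by
    have h1 : |l * g t| ≤ 1 := by
      rw [abs_mul]
      exact (mul_le_mul_of_nonneg_left (hb t) (abs_nonneg _)).trans hl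
    have := (abs_le.1 (abs_exp_sub_one_sub_id_le h1)).2
    linarith [mul_pow l (g t) 2]
  calc ∫ t in (0 : ℝ)..1, exp (l * g t)
      ≤ ∫ t in (0 : ℝ)..1, (1 + l * g t + l ^ 2 * g t ^ 2) :=
        intervalIntegral.integral_mono_on zero_le_one
          (Continuous.intervalIntegrable (by fun_prop) _ _)
          (Continuous.intervalIntegrable (by fun_prop) _ _) fun t _ => hpt t
    _ = 1 + l ^ 2 * s := by
        rw [intervalIntegral.integral_add, intervalIntegral.integral_add,
          intervalIntegral.integral_const_mul, intervalIntegral.integral_const_mul, h0, hs]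
        · simp
        all_goals exact Continuous.intervalIntegrable (by fun_prop) _ _
    _ ≤ exp (l ^ 2 * s) := by linarith [add_one_le_exp (l ^ 2 * s)]

open Complex in
/-- Comparison of the characteristic function of a bounded centred function with a Gaussian. -/
theorem norm_integral_cexp_sub_exp_le (hg : Continuous g) (hb : ∀ t, |g t| ≤ b)
    (h0 : ∫ t in (0 : ℝ)..1, g t = 0) (hs : ∫ t in (0 : ℝ)..1, g t ^ 2 = s) {l : ℝ}
    (hl : |l| * b ≤ 1) :
    ‖(∫ t in (0 : ℝ)..1, cexp (I * (l * g t : ℝ))) - Real.exp (-(l ^ 2 * s / 2))‖ ≤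
      |l| ^ 3 * b * s := by
  have hb0 : 0 ≤ b := (abs_nonneg _).trans (hb 0)
  have hl0 := abs_nonneg l
  have hs0 : 0 ≤ s := by
    rw [← hs]
    exact intervalIntegral.integral_nonneg zero_le_one fun t _ => sq_nonneg _
  have hs1 : s ≤ b ^ 2 := by
    calc s = ∫ t in (0 : ℝ)..1, g t ^ 2 := hs.symm
      _ ≤ ∫ t in (0 : ℝ)..1, b ^ 2 := intervalIntegral.integral_mono_on zero_le_one
          (Continuous.intervalIntegrable (by fun_prop) _ _)
          (Continuous.intervalIntegrable (by fun_prop) _ _) fun t _ =>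
              sq_le_sq' (abs_le.1 (hb t)).1 (abs_le.1 (hb t)).2
      _ = b ^ 2 := by simp
  have hpt : ∀ t,
      ‖cexp (I * (l * g t : ℝ)) - ((1 - (l ^ 2 * g t ^ 2) / 2 : ℝ) + (l * g t : ℝ) * I)‖ ≤
      |l| ^ 3 * b / 3 * g t ^ 2 := fun t => by
    have h1 : ‖I * ((l * g t : ℝ) : ℂ)‖ ≤ 1 := by
      rw [norm_mul, norm_I, one_mul, Complex.norm_real, Real.norm_eq_abs, abs_mul]
      exact (mul_le_mul_of_nonneg_left (hb t) (abs_nonneg _)).trans hl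
    have := Complex.exp_bound h1 (n := 3) (by norm_num)
    have he : ∑ m ∈ Finset.range 3, (I * ((l * g t : ℝ) : ℂ)) ^ m / (m.factorial : ℂ) =
        ((1 - (l ^ 2 * g t ^ 2) / 2 : ℝ) + (l * g t : ℝ) * I) := by
      simp only [Finset.sum_range_succ, Finset.sum_range_zero, Nat.factorial]
      push_cast
      linear_combination ((l:ℂ) ^ 2 * g t ^ 2 / 2) * I_sq
    rw [he] at this
    refine this.trans ?_
    rw [norm_mul, norm_I, one_mul, Complex.norm_real, Real.norm_eq_abs, abs_mul]
    norm_num [Nat.factorial]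
    have := hb t
    rw [mul_pow, pow_succ |g t| 2, sq_abs]
    have h3 : 0 ≤ |l| ^ 3 * g t ^ 2 := by positivity
    nlinarith [mul_le_mul_of_nonneg_left this h3, mul_nonneg h3 (abs_nonneg (g t))]
  have hintg : ∫ t in (0 : ℝ)..1, (((1 - (l ^ 2 * g t ^ 2) / 2 : ℝ) : ℂ) + (l * g t : ℝ) * I) =
      ((1 - l ^ 2 * s / 2 : ℝ) : ℂ) := by
    rw [intervalIntegral.integral_add, intervalIntegral.integral_mul_const,
      intervalIntegral.integral_ofReal, intervalIntegral.integral_ofReal,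
      intervalIntegral.integral_sub, intervalIntegral.integral_div,
      intervalIntegral.integral_const_mul, intervalIntegral.integral_const_mul, h0, hs]
    · simp
    all_goals exact Continuous.intervalIntegrable (by fun_prop) _ _
  have h1 : ‖(∫ t in (0 : ℝ)..1, cexp (I * (l * g t : ℝ))) - ((1 - l ^ 2 * s / 2 : ℝ) : ℂ)‖ ≤
      |l| ^ 3 * b / 3 * s := by
    rw [← hintg, ← intervalIntegral.integral_sub
      (Continuous.intervalIntegrable (by fun_prop) _ _)
      (Continuous.intervalIntegrable (by fun_prop) _ _), ← hs,
      ← intervalIntegral.integral_const_mul]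
    exact intervalIntegral.norm_integral_le_of_norm_le zero_le_one
      (Eventually.of_forall fun t _ => hpt t) (Continuous.intervalIntegrable (by fun_prop) _ _)
  have hl2 : l ^ 2 * b ^ 2 ≤ 1 := by
    rw [← sq_abs l, ← mul_pow]
    exact pow_le_one₀ (by positivity) hl
  have hu : l ^ 2 * s ≤ 1 := (mul_le_mul_of_nonneg_left hs1 (sq_nonneg l)).trans hl2
  have hu0 : 0 ≤ l ^ 2 * s := by positivity
  have h2 : ‖((1 - l ^ 2 * s / 2 : ℝ) : ℂ) - Real.exp (-(l ^ 2 * s / 2))‖ ≤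
      |l| ^ 3 * b * s / 4 := by
    rw [← ofReal_sub, Complex.norm_real, Real.norm_eq_abs, abs_sub_comm]
    have := Real.abs_exp_sub_one_sub_id_le (x := -(l ^ 2 * s / 2)) (by
      rw [abs_neg, abs_of_nonneg (by positivity)]; linarith)
    rw [show Real.exp (-(l ^ 2 * s / 2)) - (1 - l ^ 2 * s / 2) =
      Real.exp (-(l ^ 2 * s / 2)) - 1 - -(l ^ 2 * s / 2) by ring]
    refine this.trans ?_
    have h4 : l ^ 2 * s ≤ |l| * b := by
      calc l ^ 2 * s ≤ l ^ 2 * b ^ 2 := by gcongr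
        _ = (|l| * b) * (|l| * b) := by rw [← sq_abs l]; ring
        _ ≤ (|l| * b) * 1 := by gcongr
        _ = _ := mul_one _
    calc (-(l ^ 2 * s / 2)) ^ 2 = (l ^ 2 * s) * (l ^ 2 * s) / 4 := by ring
      _ ≤ (l ^ 2 * s) * (|l| * b) / 4 := by gcongr
      _ = |l| ^ 3 * b * s / 4 := by rw [← sq_abs l]; ring
  calc _ ≤ _ := norm_sub_le_norm_sub_add_norm_sub _ ((1 - l ^ 2 * s / 2 : ℝ) : ℂ) _
    _ ≤ |l| ^ 3 * b / 3 * s + |l| ^ 3 * b * s / 4 := add_le_add h1 h2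
    _ ≤ |l| ^ 3 * b * s := by
      have : 0 ≤ |l| ^ 3 * b * s := by positivity
      linarith

end Block

theorem norm_prod_sub_prod_le_sum {ι : Type*} (s : Finset ι) {f g : ι → ℂ}
    (hf : ∀ i ∈ s, ‖f i‖ ≤ 1) (hg : ∀ i ∈ s, ‖g i‖ ≤ 1) :
    ‖∏ i ∈ s, f i - ∏ i ∈ s, g i‖ ≤ ∑ i ∈ s, ‖f i - g i‖ := by
  classical
  induction s using Finset.induction_on with
  | empty => simp
  | insert i s hi ih =>
    rw [Finset.prod_insert hi, Finset.prod_insert hi, Finset.sum_insert hi]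
    have hfi := hf i (Finset.mem_insert_self _ _)
    have hgs : ‖∏ j ∈ s, g j‖ ≤ 1 := by
      rw [norm_prod]
      exact Finset.prod_le_one (fun _ _ => norm_nonneg _)
        fun j hj => hg j (Finset.mem_insert_of_mem hj)
    calc ‖f i * ∏ j ∈ s, f j - g i * ∏ j ∈ s, g j‖
        = ‖f i * (∏ j ∈ s, f j - ∏ j ∈ s, g j) + (f i - g i) * ∏ j ∈ s, g j‖ := by ring_nf
      _ ≤ ‖f i‖ * ‖∏ j ∈ s, f j - ∏ j ∈ s, g j‖ + ‖f i - g i‖ * ‖∏ j ∈ s, g j‖ := by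
          rw [← norm_mul, ← norm_mul]; exact norm_add_le _ _
      _ ≤ 1 * ‖∏ j ∈ s, f j - ∏ j ∈ s, g j‖ + ‖f i - g i‖ * 1 := by gcongr
      _ ≤ _ := by
          have := ih (fun j hj => hf j (Finset.mem_insert_of_mem hj))
            fun j hj => hg j (Finset.mem_insert_of_mem hj)
          linarith

section PhaseBlock

variable {ι : Type*} (S : Finset ι) (q m : ι → ℕ) (a φ : ι → ℝ)

/-- The part of a phase sum depending on the phase with index `r`. -/
noncomputable def phaseBlock (r : ℕ) (t : ℝ) : ℝ :=
  ∑ i ∈ S with q i = r, a i * cos (2 * π * (m i * t) + φ i)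

theorem continuous_phaseBlock (r : ℕ) : Continuous (phaseBlock S q m a φ r) := by
  unfold phaseBlock
  fun_prop

theorem phaseSum_eq_sum_phaseBlock (y : ℕ → ℝ) :
    phaseSum S q m a φ y = ∑ r ∈ S.image q, phaseBlock S q m a φ r (y r) := by
  rw [phaseSum, ← Finset.sum_fiberwise_of_maps_to fun i hi => Finset.mem_image_of_mem q hi]
  refine Finset.sum_congr rfl fun r _ => Finset.sum_congr rfl fun i hi => ?_
  rw [(Finset.mem_filter.1 hi).2]

theorem abs_phaseBlock_le (r : ℕ) (t : ℝ) :
    |phaseBlock S q m a φ r t| ≤ ∑ i ∈ S with q i = r, |a i| :=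
  (Finset.abs_sum_le_sum_abs _ _).trans <| Finset.sum_le_sum fun i _ => by
    rw [abs_mul]
    exact mul_le_of_le_one_right (abs_nonneg _) (abs_cos_le_one _)

variable {S m}

theorem integral_phaseBlock (hm : ∀ i ∈ S, m i ≠ 0) (r : ℕ) :
    ∫ t in (0 : ℝ)..1, phaseBlock S q m a φ r t = 0 := by
  unfold phaseBlock
  rw [intervalIntegral.integral_finsetSum fun i _ =>
    Continuous.intervalIntegrable (by fun_prop) _ _]
  refine Finset.sum_eq_zero fun i hi => ?_
  have := integral_cos_two_pi_int_mul_add (k := m i)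
    (by exact_mod_cast hm i (Finset.mem_filter.1 hi).1) (φ i)
  rw [intervalIntegral.integral_const_mul]
  push_cast at this
  rw [this, mul_zero]

theorem integral_phaseBlock_sq (hm : ∀ i ∈ S, m i ≠ 0) {q : ι → ℕ}
    (hinj : ∀ i ∈ S, ∀ j ∈ S, q i = q j → m i = m j → i = j) (r : ℕ) :
    ∫ t in (0 : ℝ)..1, phaseBlock S q m a φ r t ^ 2 = ∑ i ∈ S with q i = r, a i ^ 2 / 2 := by
  have hexp : ∀ t, phaseBlock S q m a φ r t ^ 2 =
      ∑ i ∈ S with q i = r, ∑ j ∈ S with q j = r, a i * a j / 2 *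
        (cos (2 * π * (((m i : ℤ) - m j : ℤ) * t) + (φ i - φ j)) +
          cos (2 * π * (((m i : ℤ) + m j : ℤ) * t) + (φ i + φ j))) := fun t => by
    rw [phaseBlock, sq, Finset.sum_mul_sum]
    refine Finset.sum_congr rfl fun i _ => Finset.sum_congr rfl fun j _ => ?_
    push_cast
    rw [show 2 * π * (((m i : ℝ) - m j) * t) + (φ i - φ j) =
      (2 * π * (m i * t) + φ i) - (2 * π * (m j * t) + φ j) by ring,
      show 2 * π * (((m i : ℝ) + m j) * t) + (φ i + φ j) =
      (2 * π * (m i * t) + φ i) + (2 * π * (m j * t) + φ j) by ring,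
      cos_sub (_ + φ i), cos_add (_ + φ i)]
    ring
  simp only [hexp]
  rw [intervalIntegral.integral_finsetSum fun i _ =>
    Continuous.intervalIntegrable (by fun_prop) _ _]
  refine Finset.sum_congr rfl fun i hi => ?_
  obtain ⟨hiS, hir⟩ := Finset.mem_filter.1 hi
  rw [intervalIntegral.integral_finsetSum fun i _ =>
    Continuous.intervalIntegrable (by fun_prop) _ _]
  rw [Finset.sum_eq_single_of_mem i hi]
  · rw [intervalIntegral.integral_const_mul, intervalIntegral.integral_add
      (Continuous.intervalIntegrable (by fun_prop) _ _)
      (Continuous.intervalIntegrable (by fun_prop) _ _),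
      integral_cos_two_pi_int_mul_add (k := (m i : ℤ) + m i) (by have := hm i hiS; omega)]
    simp
    ring
  · intro j hj hji
    obtain ⟨hjS, hjr⟩ := Finset.mem_filter.1 hj
    rw [intervalIntegral.integral_const_mul, intervalIntegral.integral_add
      (Continuous.intervalIntegrable (by fun_prop) _ _)
      (Continuous.intervalIntegrable (by fun_prop) _ _),
      integral_cos_two_pi_int_mul_add (k := (m i : ℤ) + m j) (by have := hm i hiS; omega),
      integral_cos_two_pi_int_mul_add, add_zero, mul_zero]
    intro h
    exact hji (hinj j hjS i hiS (hjr.trans hir.symm) (by omega))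

theorem integral_exp_phaseSum_le (hm : ∀ i ∈ S, m i ≠ 0) {q : ι → ℕ}
    (hinj : ∀ i ∈ S, ∀ j ∈ S, q i = q j → m i = m j → i = j)
    {b : ℝ} (hb : ∀ r, ∑ i ∈ S with q i = r, |a i| ≤ b) {l : ℝ} (hl : |l| * b ≤ 1) :
    ∫ y, exp (l * phaseSum S q m a φ y) ∂phaseMeasure ≤ exp (l ^ 2 * ∑ i ∈ S, a i ^ 2 / 2) := by
  simp only [phaseSum_eq_sum_phaseBlock, Finset.mul_sum, exp_sum]
  have := integral_phaseMeasure_prod (S.image q)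
    (f := fun r t => exp (l * phaseBlock S q m a φ r t)) fun r => by
      have := continuous_phaseBlock S q m a φ r
      fun_prop
  rw [this, ← Finset.prod_fiberwise_of_maps_to fun i hi => Finset.mem_image_of_mem q hi]
  refine Finset.prod_le_prod (fun r _ => intervalIntegral.integral_nonneg zero_le_one
    fun t _ => (exp_pos _).le) fun r _ => ?_
  rw [← exp_sum, ← Finset.mul_sum]
  exact integral_exp_mul_le_exp (continuous_phaseBlock S q m a φ r)
    (fun t => (abs_phaseBlock_le S q m a φ r t).trans (hb r)) (integral_phaseBlock q a φ hm r)
    (integral_phaseBlock_sq a φ hm hinj r) hl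

theorem integral_phaseSum_pow_le (hm : ∀ i ∈ S, m i ≠ 0) {q : ι → ℕ}
    (hinj : ∀ i ∈ S, ∀ j ∈ S, q i = q j → m i = m j → i = j)
    {b : ℝ} (hb : ∀ r, ∑ i ∈ S with q i = r, |a i| ≤ b) {l : ℝ} (hl0 : 0 < l) (hl : l * b ≤ 1)
    {K : ℕ} (hK : Even K) :
    ∫ y, phaseSum S q m a φ y ^ K ∂phaseMeasure ≤
      K.factorial / l ^ K * (2 * exp (l ^ 2 * ∑ i ∈ S, a i ^ 2 / 2)) := by
  have hF := continuous_phaseSum S q m a φ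
  have hintg : ∀ c : ℝ, Integrable (fun y => exp (c * phaseSum S q m a φ y)) phaseMeasure :=
    fun c => Integrable.of_bound (Continuous.aestronglyMeasurable (by fun_prop))
      (exp (|c| * ∑ i ∈ S, |a i|)) (Eventually.of_forall fun y => by
        rw [Real.norm_of_nonneg (exp_pos _).le]
        refine exp_le_exp.2 ((le_abs_self _).trans ?_)
        rw [abs_mul]
        exact mul_le_mul_of_nonneg_left (abs_phaseSum_le S q m a φ y) (abs_nonneg _))
  have hpt : ∀ u : ℝ, u ^ K ≤ K.factorial / l ^ K * (exp (l * u) + exp (-l * u)) := fun u => by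
    have h := pow_div_factorial_le_exp (l * |u|) (by positivity) K
    have h2 : exp (l * |u|) ≤ exp (l * u) + exp (-l * u) := by
      rcases abs_cases u with ⟨h, _⟩ | ⟨h, _⟩ <;> rw [h]
      · linarith [exp_pos (-l * u)]
      · rw [mul_neg, ← neg_mul]
        linarith [exp_pos (l * u)]
    rw [mul_pow, hK.pow_abs, div_le_iff₀ (by positivity)] at h
    rw [div_mul_eq_mul_div, le_div_iff₀ (by positivity)]
    nlinarith [(by positivity : (0:ℝ) < K.factorial)]
  calc ∫ y, phaseSum S q m a φ y ^ K ∂phaseMeasure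
      ≤ ∫ y, K.factorial / l ^ K * (exp (l * phaseSum S q m a φ y) +
          exp (-l * phaseSum S q m a φ y)) ∂phaseMeasure := by
        refine integral_mono_of_nonneg (Eventually.of_forall fun y => hK.pow_nonneg _)
          (((hintg l).add (hintg (-l))).const_mul _) (Eventually.of_forall fun y => hpt _)
    _ = K.factorial / l ^ K * ((∫ y, exp (l * phaseSum S q m a φ y) ∂phaseMeasure) +
          ∫ y, exp (-l * phaseSum S q m a φ y) ∂phaseMeasure) := by
        rw [integral_const_mul, integral_add (hintg l) (hintg (-l))]
    _ ≤ K.factorial / l ^ K * (2 * exp (l ^ 2 * ∑ i ∈ S, a i ^ 2 / 2)) := by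
        have hl' : |l| * b ≤ 1 := by rwa [abs_of_pos hl0]
        have h1 := integral_exp_phaseSum_le a φ hm hinj hb hl'
        have h2 := integral_exp_phaseSum_le a φ hm hinj hb (l := -l) (by rwa [abs_neg])
        rw [neg_sq] at h2
        gcongr
        linarith

open Complex in
theorem norm_integral_cexp_phaseSum_sub_le (hm : ∀ i ∈ S, m i ≠ 0) {q : ι → ℕ}
    (hinj : ∀ i ∈ S, ∀ j ∈ S, q i = q j → m i = m j → i = j)
    {b : ℝ} (hb : ∀ r, ∑ i ∈ S with q i = r, |a i| ≤ b) {l : ℝ} (hl : |l| * b ≤ 1) :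
    ‖(∫ y, cexp (I * (l * phaseSum S q m a φ y : ℝ)) ∂phaseMeasure) -
        Real.exp (-(l ^ 2 * (∑ i ∈ S, a i ^ 2 / 2) / 2))‖ ≤
      |l| ^ 3 * b * ∑ i ∈ S, a i ^ 2 / 2 := by
  simp only [phaseSum_eq_sum_phaseBlock, Finset.mul_sum, ofReal_sum, Complex.exp_sum]
  have := integral_phaseMeasure_prod (S.image q)
    (f := fun r t => cexp (I * (l * phaseBlock S q m a φ r t : ℝ))) fun r => by
      have := continuous_phaseBlock S q m a φ r
      fun_prop
  rw [this, Finset.sum_div, ← Finset.sum_neg_distrib,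
    ← Finset.sum_fiberwise_of_maps_to fun i hi => Finset.mem_image_of_mem q hi, Real.exp_sum,
    ofReal_prod, ← Finset.sum_fiberwise_of_maps_to (g := q) (t := S.image q)
    (f := fun i => |l| ^ 3 * b * (a i ^ 2 / 2)) fun i hi => Finset.mem_image_of_mem q hi]
  refine (norm_prod_sub_prod_le_sum _ (fun r _ => ?_) fun r _ => ?_).trans
    (Finset.sum_le_sum fun r _ => ?_)
  · refine (intervalIntegral.norm_integral_le_of_norm_le_const (C := 1) fun t _ => ?_).trans
      (by simp)
    rw [mul_comm, norm_exp_ofReal_mul_I]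
  · rw [Complex.norm_real, Real.norm_of_nonneg (Real.exp_pos _).le, Real.exp_le_one_iff]
    exact Finset.sum_nonpos fun i _ => by simp only [neg_nonpos]; positivity
  · have := norm_integral_cexp_sub_exp_le (continuous_phaseBlock S q m a φ r)
      (fun t => (abs_phaseBlock_le S q m a φ r t).trans (hb r)) (integral_phaseBlock q a φ hm r)
      (integral_phaseBlock_sq a φ hm hinj r) hl
    rw [Finset.sum_neg_distrib, ← Finset.sum_div, ← Finset.mul_sum, ← Finset.mul_sum]
    exact this

end PhaseBlock

/-- The uniform probability measure on `[X, 2 * X]`. -/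
noncomputable def dyadicMeasure (X : ℝ) : Measure ℝ :=
  ENNReal.ofReal X⁻¹ • volume.restrict (Set.Ioc X (2 * X))

theorem isProbabilityMeasure_dyadicMeasure {X : ℝ} (hX : 0 < X) :
    IsProbabilityMeasure (dyadicMeasure X) := ⟨by
  rw [dyadicMeasure, Measure.smul_apply, Measure.restrict_apply_univ, Real.volume_Ioc,
    smul_eq_mul, ← ENNReal.ofReal_mul (by positivity)]
  rw [show X⁻¹ * (2 * X - X) = 1 by field_simp; ring, ENNReal.ofReal_one]⟩

theorem dyadicMean_eq_integral {E : Type*} [NormedAddCommGroup E] [NormedSpace ℝ E] {X : ℝ}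
    (hX : 0 < X) (f : ℝ → E) : dyadicMean X f = ∫ x, f x ∂dyadicMeasure X := by
  rw [dyadicMean, dyadicMeasure, integral_smul_measure, ENNReal.toReal_ofReal (by positivity),
    intervalIntegral.integral_of_le (by linarith)]

open Complex in
/-- Taylor's theorem for the exponential function along a ray in the closed left half-plane. -/
theorem norm_cexp_mul_sub_sum_le {z : ℂ} (hz : ‖z‖ ≤ 1) (hre : z.re ≤ 0) (K : ℕ) {u : ℝ}
    (hu : 0 ≤ u) : ‖cexp (z * u) - ∑ k ∈ Finset.range K, (z * u) ^ k / k.factorial‖ ≤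
      u ^ K / K.factorial := by
  induction K generalizing u with
  | zero =>
    simp only [Finset.range_zero, Finset.sum_empty, sub_zero, pow_zero, Nat.factorial_zero,
      Nat.cast_one, div_one, Complex.norm_exp, Real.exp_le_one_iff]
    rw [re_mul_ofReal]
    exact mul_nonpos_of_nonpos_of_nonneg hre hu
  | succ K ih =>
    have hd : ∀ x : ℝ, HasDerivAt (fun x : ℝ => cexp (z * x) -
        ∑ k ∈ Finset.range (K + 1), (z * x) ^ k / k.factorial)
        (z * (cexp (z * x) - ∑ k ∈ Finset.range K, (z * x) ^ k / k.factorial)) x := fun x => by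
      have h1 : HasDerivAt (fun x : ℝ => z * (x : ℂ)) z x := by
        simpa using (ofRealCLM.hasDerivAt (x := x)).const_mul z
      have h2 : HasDerivAt (fun x : ℝ => ∑ k ∈ Finset.range (K + 1), (z * x) ^ k / k.factorial)
          (∑ k ∈ Finset.range (K + 1), k * (z * x) ^ (k - 1) * z / (k.factorial : ℂ)) x :=
        HasDerivAt.fun_sum fun k _ => (h1.fun_pow k).div_const _
      refine (h1.cexp.sub h2).congr_deriv ?_
      rw [Finset.sum_range_succ']
      simp only [Nat.cast_zero, zero_mul, zero_div, add_zero, Nat.add_sub_cancel, mul_sub,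
        Finset.mul_sum]
      congr 1
      · ring
      · refine Finset.sum_congr rfl fun k _ => ?_
        have : (k.factorial : ℂ) ≠ 0 := by exact_mod_cast k.factorial_ne_zero
        have : (k + 1 : ℂ) ≠ 0 := by exact_mod_cast k.succ_ne_zero
        rw [Nat.factorial_succ]
        push_cast
        field_simp
    have hB : ∀ x : ℝ, HasDerivAt (fun x : ℝ => x ^ (K + 1) / (K + 1).factorial)
        (x ^ K / K.factorial) x := fun x => by
      refine ((hasDerivAt_pow (K + 1) x).div_const _).congr_deriv ?_
      have : (K.factorial : ℝ) ≠ 0 := by exact_mod_cast K.factorial_ne_zero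
      have : (K + 1 : ℝ) ≠ 0 := by exact_mod_cast K.succ_ne_zero
      rw [Nat.factorial_succ]
      push_cast
      field_simp
    refine image_norm_le_of_norm_deriv_right_le_deriv_boundary (a := 0) (b := u)
      (fun x _ => (hd x).continuousAt.continuousWithinAt) (fun x _ => (hd x).hasDerivWithinAt)
      ?_ hB (fun x hx => ?_) ⟨hu, le_rfl⟩
    · rw [Finset.sum_range_succ']
      simp
    · rw [norm_mul]
      exact (mul_le_of_le_one_left (norm_nonneg _) hz).trans (ih hx.1)

open Complex in
theorem norm_cexp_I_mul_sub_sum_le (K : ℕ) (u : ℝ) :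
    ‖cexp (I * u) - ∑ k ∈ Finset.range K, (I * u) ^ k / k.factorial‖ ≤
      |u| ^ K / K.factorial := by
  rcases abs_cases u with ⟨h, _⟩ | ⟨h, _⟩
  · have := norm_cexp_mul_sub_sum_le (z := I) (by simp) (by simp) K (abs_nonneg u)
    rwa [h] at this ⊢
  · have := norm_cexp_mul_sub_sum_le (z := -I) (by simp) (by simp) K (abs_nonneg u)
    rw [h] at this ⊢
    simpa using this

open Complex in
/-- Approximation of the characteristic function of a bounded function by its moments. -/
theorem norm_integral_cexp_sub_sum_le {α : Type*} [MeasurableSpace α] (μ : Measure α)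
    [IsProbabilityMeasure μ] {G : α → ℝ} (hG : AEStronglyMeasurable G μ) {A : ℝ}
    (hA : ∀ x, |G x| ≤ A) (ξ : ℝ) {K : ℕ} (hK : Even K) :
    ‖(∫ x, cexp (I * (ξ * G x : ℝ)) ∂μ) -
        ∑ k ∈ Finset.range K, (I * ξ) ^ k / k.factorial * (∫ x, G x ^ k ∂μ : ℝ)‖ ≤
      |ξ| ^ K / K.factorial * ∫ x, G x ^ K ∂μ := by
  have hpow : ∀ k, Integrable (fun x => G x ^ k) μ := fun k =>
    Integrable.of_bound (hG.pow k) (A ^ k) (Eventually.of_forall fun x => by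
      rw [norm_pow]
      exact pow_le_pow_left₀ (norm_nonneg _) (hA x) k)
  have h1 : ∀ k, (I * ξ) ^ k / k.factorial * (∫ x, G x ^ k ∂μ : ℝ) =
      ∫ x, (I * (ξ * G x : ℝ)) ^ k / k.factorial ∂μ := fun k => by
    rw [← integral_complex_ofReal, ← integral_const_mul]
    congr 1
    ext x
    push_cast
    ring
  have hintg : ∀ k, Integrable (fun x => (I * (ξ * G x : ℝ)) ^ k / (k.factorial : ℂ)) μ :=
      fun k => by
    refine ((hpow k).ofReal (𝕜 := ℂ)).const_mul ((I * ξ) ^ k / k.factorial) |>.congr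
      (Eventually.of_forall fun x => ?_)
    simp only [coe_algebraMap]
    push_cast
    ring
  have hexp : Integrable (fun x => cexp (I * (ξ * G x : ℝ))) μ := by
    refine Integrable.of_bound (C := 1) ?_ (Eventually.of_forall fun x => ?_)
    · exact (by fun_prop : Continuous fun t : ℝ => cexp (I * (ξ * t : ℝ))).comp_aestronglyMeasurable
        hG
    · rw [mul_comm, norm_exp_ofReal_mul_I]
  simp only [h1]
  rw [← integral_finsetSum _ fun k _ => hintg k, ← integral_sub hexp
    (integrable_finsetSum _ fun k _ => hintg k), ← integral_const_mul]
  refine norm_integral_le_of_norm_le ((hpow K).const_mul _) (Eventually.of_forall fun x => ?_)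
  refine (norm_cexp_I_mul_sub_sum_le K (ξ * G x)).trans_eq ?_
  rw [hK.pow_abs, mul_pow, ← hK.pow_abs ξ]
  ring

section CLT

variable {ι : Type*} {S : ℝ → Finset ι} {q m : ι → ℕ} {a φ : ℝ → ι → ℝ} {Y b : ℝ → ℝ}

theorem tendsto_dyadicMean_phaseSum_pow_sub
    (hq : ∀ᶠ X in atTop, ∀ i ∈ S X, Squarefree (q i))
    (hY1 : ∀ᶠ X in atTop, 1 ≤ Y X) (hY : ∀ᶠ X in atTop, ∀ i ∈ S X, m i * √(q i) ≤ Y X)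
    (hA : ∀ᶠ X in atTop, ∑ i ∈ S X, |a X i| ≤ Y X)
    (hYX : ∀ k : ℕ, Tendsto (fun X => Y X ^ k / X) atTop (𝓝 0)) (k : ℕ) :
    Tendsto (fun X => |dyadicMean X (fun x => phaseSum (S X) q m (a X) (φ X)
        (fun r => √r * x) ^ k) - ∫ y, phaseSum (S X) q m (a X) (φ X) y ^ k ∂phaseMeasure|)
      atTop (𝓝 0) := by
  have h := (hYX (k + 2 ^ k)).const_mul ((k + 1 : ℝ) ^ 2 ^ k / π)
  rw [mul_zero] at h
  refine squeeze_zero' (Eventually.of_forall fun X => abs_nonneg _) ?_ h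
  filter_upwards [hq, hY1, hY, hA, eventually_gt_atTop 0] with X hq hY1 hY hA hX
  refine (abs_dyadicMean_phaseSum_pow_sub_le (S X) q m (a X) (φ X) hX hq hY1 hY k).trans ?_
  have hs : 0 ≤ ∑ i ∈ S X, |a X i| := Finset.sum_nonneg fun _ _ => abs_nonneg _
  have hp := pi_pos
  calc (∑ i ∈ S X, |a X i|) ^ k * ((k + 1) * Y X) ^ 2 ^ k / (π * X)
      ≤ (Y X) ^ k * ((k + 1) * Y X) ^ 2 ^ k / (π * X) := by gcongr
    _ = _ := by rw [mul_pow, pow_add]; field_simp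

open Complex in
theorem tendsto_dyadicMean_cexp_phaseSum_sub
    (hq : ∀ᶠ X in atTop, ∀ i ∈ S X, Squarefree (q i))
    (hm : ∀ᶠ X in atTop, ∀ i ∈ S X, m i ≠ 0)
    (hinj : ∀ i j, q i = q j → m i = m j → i = j)
    (hY1 : ∀ᶠ X in atTop, 1 ≤ Y X) (hY : ∀ᶠ X in atTop, ∀ i ∈ S X, m i * √(q i) ≤ Y X)
    (hA : ∀ᶠ X in atTop, ∑ i ∈ S X, |a X i| ≤ Y X)
    (hYX : ∀ k : ℕ, Tendsto (fun X => Y X ^ k / X) atTop (𝓝 0))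
    (hv : Tendsto (fun X => ∑ i ∈ S X, a X i ^ 2 / 2) atTop (𝓝 1))
    (hb : ∀ᶠ X in atTop, ∀ r, ∑ i ∈ S X with q i = r, |a X i| ≤ b X)
    (hb0 : Tendsto b atTop (𝓝 0)) (ξ : ℝ) :
    Tendsto (fun X => ‖dyadicMean X (fun x => cexp (I * (ξ * phaseSum (S X) q m (a X) (φ X)
        (fun r => √r * x) : ℝ))) -
      ∫ y, cexp (I * (ξ * phaseSum (S X) q m (a X) (φ X) y : ℝ)) ∂phaseMeasure‖)
      atTop (𝓝 0) := by
  set D : ℕ → ℝ → ℝ := fun k X => |dyadicMean X (fun x => phaseSum (S X) q m (a X) (φ X)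
        (fun r => √r * x) ^ k) - ∫ y, phaseSum (S X) q m (a X) (φ X) y ^ k ∂phaseMeasure| with hD
  have hDt : ∀ k, Tendsto (D k) atTop (𝓝 0) := fun k =>
    tendsto_dyadicMean_phaseSum_pow_sub hq hY1 hY hA hYX k
  set l : ℝ := 2 * (|ξ| + 1) with hl
  have hl0 : 0 < l := by positivity
  have hmain : ∀ K, Even K → ∀ᶠ X in atTop,
      ‖dyadicMean X (fun x => cexp (I * (ξ * phaseSum (S X) q m (a X) (φ X)
        (fun r => √r * x) : ℝ))) -
      ∫ y, cexp (I * (ξ * phaseSum (S X) q m (a X) (φ X) y : ℝ)) ∂phaseMeasure‖ ≤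
      ∑ k ∈ Finset.range (K + 1), |ξ| ^ k / k.factorial * D k X +
        (1 / 2) ^ K * (4 * Real.exp (l ^ 2 * 2)) := by
    intro K hK
    have hbl : ∀ᶠ X in atTop, l * b X ≤ 1 := by
      have := hb0.const_mul l
      rw [mul_zero] at this
      exact this.eventually_le_const one_pos
    filter_upwards [hm, hv.eventually_le_const one_lt_two, hb, hbl, eventually_gt_atTop 0]
      with X hm hv hb hbl hX
    have := isProbabilityMeasure_dyadicMeasure hX
    have hF := continuous_phaseSum (S X) q m (a X) (φ X)
    have h1 := norm_integral_cexp_sub_sum_le (dyadicMeasure X)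
      (G := fun x => phaseSum (S X) q m (a X) (φ X) (fun r => √r * x))
      (Continuous.aestronglyMeasurable (by fun_prop))
      (fun x => abs_phaseSum_le (S X) q m (a X) (φ X) _) ξ hK
    have h2 := norm_integral_cexp_sub_sum_le phaseMeasure hF.aestronglyMeasurable
      (fun y => abs_phaseSum_le (S X) q m (a X) (φ X) y) ξ hK
    simp only [← dyadicMean_eq_integral hX] at h1
    have h3 := integral_phaseSum_pow_le (a X) (φ X) hm (fun i _ j _ => hinj i j) hb hl0 hbl hK
    set E1 := dyadicMean X (fun x => cexp (I * (ξ * phaseSum (S X) q m (a X) (φ X)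
        (fun r => √r * x) : ℝ)))
    set E2 := ∫ y, cexp (I * (ξ * phaseSum (S X) q m (a X) (φ X) y : ℝ)) ∂phaseMeasure
    set M1 : ℕ → ℝ := fun k => dyadicMean X (fun x => phaseSum (S X) q m (a X) (φ X)
        (fun r => √r * x) ^ k) with hM1
    set M2 : ℕ → ℝ := fun k => ∫ y, phaseSum (S X) q m (a X) (φ X) y ^ k ∂phaseMeasure with hM2
    have hDk : ∀ k, D k X = |M1 k - M2 k| := fun k => rfl
    change M2 K ≤ _ at h3
    change ‖E1 - ∑ k ∈ Finset.range K, (I * ξ) ^ k / k.factorial * (M1 k : ℝ)‖ ≤ _ * M1 K at h1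
    change ‖E2 - ∑ k ∈ Finset.range K, (I * ξ) ^ k / k.factorial * (M2 k : ℝ)‖ ≤ _ * M2 K at h2
    have h4 : ‖(∑ k ∈ Finset.range K, (I * ξ) ^ k / k.factorial * (M1 k : ℝ)) -
        ∑ k ∈ Finset.range K, (I * ξ) ^ k / k.factorial * (M2 k : ℝ)‖ ≤
        ∑ k ∈ Finset.range K, |ξ| ^ k / k.factorial * D k X := by
      rw [← Finset.sum_sub_distrib]
      refine norm_sum_le_of_le _ fun k _ => ?_
      rw [← mul_sub, norm_mul, ← ofReal_sub, Complex.norm_real, Real.norm_eq_abs, norm_div,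
        norm_pow, norm_mul, norm_I, one_mul, Complex.norm_real, Real.norm_eq_abs,
        Complex.norm_natCast, hDk]
    have h5 : |ξ| ^ K / K.factorial * M2 K ≤ (1 / 2) ^ K * (2 * Real.exp (l ^ 2 * 2)) := by
      have hxl : |ξ| / l ≤ 1 / 2 := by
        rw [div_le_iff₀ hl0, hl]; linarith
      calc |ξ| ^ K / K.factorial * M2 K ≤ |ξ| ^ K / K.factorial * (K.factorial / l ^ K *
            (2 * Real.exp (l ^ 2 * ∑ i ∈ S X, a X i ^ 2 / 2))) := by gcongr
        _ = (|ξ| / l) ^ K * (2 * Real.exp (l ^ 2 * ∑ i ∈ S X, a X i ^ 2 / 2)) := by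
          have : (K.factorial : ℝ) ≠ 0 := by positivity
          rw [div_pow]; field_simp
        _ ≤ _ := by gcongr
    have h6 : M1 K ≤ D K X + M2 K := by
      rw [hDk]; linarith [le_abs_self (M1 K - M2 K)]
    have h7 : |ξ| ^ K / K.factorial * M1 K ≤
        |ξ| ^ K / K.factorial * D K X + |ξ| ^ K / K.factorial * M2 K := by
      rw [← mul_add]; gcongr
    rw [Finset.sum_range_succ]
    have h8 : ‖E1 - E2‖ ≤ ‖E1 - ∑ k ∈ Finset.range K, (I * ξ) ^ k / k.factorial * (M1 k : ℝ)‖ +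
        ‖(∑ k ∈ Finset.range K, (I * ξ) ^ k / k.factorial * (M1 k : ℝ)) -
        ∑ k ∈ Finset.range K, (I * ξ) ^ k / k.factorial * (M2 k : ℝ)‖ +
        ‖E2 - ∑ k ∈ Finset.range K, (I * ξ) ^ k / k.factorial * (M2 k : ℝ)‖ := by
      refine (norm_sub_le_norm_sub_add_norm_sub _ (∑ k ∈ Finset.range K,
        (I * ξ) ^ k / k.factorial * (M2 k : ℝ)) _).trans ?_
      rw [norm_sub_rev _ E2]
      gcongr
      exact norm_sub_le_norm_sub_add_norm_sub _ _ _
    linarith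
  rw [Metric.tendsto_nhds]
  intro ε hε
  have hgeo : Tendsto (fun K : ℕ => (1 / 2 : ℝ) ^ K * (4 * Real.exp (l ^ 2 * 2))) atTop (𝓝 0) := by
    have := (tendsto_pow_atTop_nhds_zero_of_lt_one (r := (1 / 2 : ℝ)) (by norm_num)
      (by norm_num)).mul_const (4 * Real.exp (l ^ 2 * 2))
    rwa [zero_mul] at this
  obtain ⟨K, hK, hKe⟩ := ((hgeo.eventually_lt_const (half_pos hε)).and_frequently
    (Nat.frequently_even)).exists
  have hsum : Tendsto (fun X => ∑ k ∈ Finset.range (K + 1), |ξ| ^ k / k.factorial * D k X)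
      atTop (𝓝 0) := by
    have := tendsto_finsetSum (Finset.range (K + 1)) fun k _ =>
      (hDt k).const_mul (|ξ| ^ k / (k.factorial : ℝ))
    simpa using this
  filter_upwards [hmain K hKe, hsum.eventually_lt_const (half_pos hε)] with X h1 h2
  rw [dist_zero_right, norm_norm]
  linarith

open Complex in
/-- Central limit theorem for trigonometric sums with frequencies `m √q`, in terms of
characteristic functions. -/
theorem tendsto_dyadicMean_cexp_phaseSum
    (hq : ∀ᶠ X in atTop, ∀ i ∈ S X, Squarefree (q i))
    (hm : ∀ᶠ X in atTop, ∀ i ∈ S X, m i ≠ 0)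
    (hinj : ∀ i j, q i = q j → m i = m j → i = j)
    (hY1 : ∀ᶠ X in atTop, 1 ≤ Y X) (hY : ∀ᶠ X in atTop, ∀ i ∈ S X, m i * √(q i) ≤ Y X)
    (hA : ∀ᶠ X in atTop, ∑ i ∈ S X, |a X i| ≤ Y X)
    (hYX : ∀ k : ℕ, Tendsto (fun X => Y X ^ k / X) atTop (𝓝 0))
    (hv : Tendsto (fun X => ∑ i ∈ S X, a X i ^ 2 / 2) atTop (𝓝 1))
    (hb : ∀ᶠ X in atTop, ∀ r, ∑ i ∈ S X with q i = r, |a X i| ≤ b X)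
    (hb0 : Tendsto b atTop (𝓝 0)) (ξ : ℝ) :
    Tendsto (fun X => dyadicMean X (fun x => cexp (I * (ξ * phaseSum (S X) q m (a X) (φ X)
        (fun r => √r * x) : ℝ)))) atTop (𝓝 (Real.exp (-(ξ ^ 2 / 2)) : ℂ)) := by
  have h1 := tendsto_dyadicMean_cexp_phaseSum_sub (φ := φ) hq hm hinj hY1 hY hA hYX hv hb hb0 ξ
  have h2 : Tendsto (fun X => (∫ y, cexp (I * (ξ * phaseSum (S X) q m (a X) (φ X) y : ℝ))
      ∂phaseMeasure) - (Real.exp (-(ξ ^ 2 * (∑ i ∈ S X, a X i ^ 2 / 2) / 2)) : ℂ))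
      atTop (𝓝 0) := by
    have hz : Tendsto (fun X => |ξ| ^ 3 * b X * ∑ i ∈ S X, a X i ^ 2 / 2) atTop (𝓝 0) := by
      have := (hb0.const_mul (|ξ| ^ 3)).mul hv
      rwa [mul_zero, zero_mul] at this
    refine squeeze_zero_norm' ?_ hz
    have hbl : ∀ᶠ X in atTop, |ξ| * b X ≤ 1 := by
      have := hb0.const_mul |ξ|
      rw [mul_zero] at this
      exact this.eventually_le_const one_pos
    filter_upwards [hm, hb, hbl] with X hm hb hbl
    exact norm_integral_cexp_phaseSum_sub_le (a X) (φ X) hm (fun i _ j _ => hinj i j) hb hbl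
  have h3 : Tendsto (fun X => (Real.exp (-(ξ ^ 2 * (∑ i ∈ S X, a X i ^ 2 / 2) / 2)) : ℂ))
      atTop (𝓝 (Real.exp (-(ξ ^ 2 / 2)) : ℂ)) := by
    refine (continuous_ofReal.tendsto _).comp ((Real.continuous_exp.tendsto _).comp ?_)
    have := ((hv.const_mul (ξ ^ 2)).div_const 2).neg
    rwa [mul_one] at this
  have h4 := ((tendsto_zero_iff_norm_tendsto_zero.2 h1).add h2).add h3
  rw [zero_add, zero_add] at h4
  exact h4.congr fun X => by ring

end CLT

theorem sum_one_div_dist_le {M n : ℕ} (hn : n ∈ Finset.Ioc 0 M) :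
    ∑ k ∈ (Finset.Ioc 0 M).erase n, 1 / |(n : ℝ) - k| ≤ 2 * (1 + log M) := by
  have hmaps : ∀ k ∈ (Finset.Ioc 0 M).erase n, Nat.dist n k ∈ Finset.Icc 1 M := fun k hk => by
    simp only [Finset.mem_erase, Finset.mem_Ioc, Finset.mem_Icc, Nat.dist] at *
    omega
  rw [← Finset.sum_fiberwise_of_maps_to hmaps]
  calc _ ≤ ∑ d ∈ Finset.Icc 1 M, 2 * (d : ℝ)⁻¹ := by
        refine Finset.sum_le_sum fun d _ => ?_
        have hd : ∀ k ∈ ((Finset.Ioc 0 M).erase n).filter (fun k => Nat.dist n k = d),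
            1 / |(n : ℝ) - k| = (d : ℝ)⁻¹ := fun k hk => by
          obtain ⟨_, rfl⟩ := Finset.mem_filter.1 hk
          rw [one_div, Nat.dist]
          rcases le_total n k with h | h
          · rw [abs_sub_comm, abs_of_nonneg (by simpa using h), Nat.sub_eq_zero_of_le h,
              zero_add, Nat.cast_sub h]
          · rw [abs_of_nonneg (by simpa using h), Nat.sub_eq_zero_of_le h, add_zero,
              Nat.cast_sub h]
        rw [Finset.sum_congr rfl hd, Finset.sum_const, nsmul_eq_mul]
        have hc : (((Finset.Ioc 0 M).erase n).filter fun k => Nat.dist n k = d).card ≤ 2 := by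
          refine (Finset.card_le_card (t := {n - d, n + d}) fun k hk => ?_).trans
            Finset.card_le_two
          have h2 := (Finset.mem_filter.1 hk).2
          simp only [Nat.dist, Finset.mem_insert, Finset.mem_singleton] at h2 ⊢
          omega
        gcongr
        exact_mod_cast hc
    _ = 2 * (harmonic M : ℝ) := by
        rw [harmonic_eq_sum_Icc, ← Finset.mul_sum]
        push_cast
        rfl
    _ ≤ _ := by gcongr; exact harmonic_le_one_add_log M

theorem abs_dyadicMean_cos_le_one {X : ℝ} (hX : 0 < X) (f : ℝ → ℝ) :
    |dyadicMean X fun x => cos (f x)| ≤ 1 := by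
  have h := intervalIntegral.norm_integral_le_of_norm_le_const (a := X) (b := 2 * X) (C := 1)
    (f := fun x => cos (f x)) fun x _ => abs_cos_le_one _
  rw [dyadicMean, smul_eq_mul, abs_mul, abs_of_pos (inv_pos.2 hX), inv_mul_le_iff₀ hX]
  refine h.trans_eq ?_
  rw [show 2 * X - X = X by ring, abs_of_pos hX]
  ring

theorem abs_dyadicMean_cos_le {X Λ : ℝ} (hX : 0 < X) (hΛ : Λ ≠ 0) (φ : ℝ) :
    |dyadicMean X fun x => cos (2 * π * (Λ * x) + φ)| ≤ 1 / (π * X * |Λ|) := by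
  have hc : 2 * π * Λ ≠ 0 := by simp [hΛ, pi_ne_zero]
  have hp := pi_pos
  have hL : 0 < |Λ| := abs_pos.2 hΛ
  simp only [← mul_assoc]
  rw [dyadicMean, intervalIntegral.integral_comp_mul_add _ hc, integral_cos, smul_eq_mul,
    smul_eq_mul, abs_mul, abs_mul, abs_inv, abs_inv, abs_of_pos hX, abs_mul,
    abs_of_pos two_pi_pos]
  have h := abs_sub (sin (2 * π * Λ * (2 * X) + φ)) (sin (2 * π * Λ * X + φ))
  have h1 := abs_sin_le_one (2 * π * Λ * (2 * X) + φ)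
  have h2 := abs_sin_le_one (2 * π * Λ * X + φ)
  calc _ ≤ X⁻¹ * ((2 * π * |Λ|)⁻¹ * 2) := by gcongr; linarith
    _ = _ := by field_simp

theorem dyadicMean_sq_le {X : ℝ} (hX : 0 < X) (M : ℕ) (a φ : ℕ → ℝ) {l : ℝ} (hl : 0 < l) :
    dyadicMean X (fun x => (∑ n ∈ Finset.Ioc 0 M, a n * cos (2 * π * (√n * x) + φ n)) ^ 2) ≤
      ∑ n ∈ Finset.Ioc 0 M, a n ^ 2 +
        2 * (1 + log M) / (π * X) * ∑ n ∈ Finset.Ioc 0 M, a n ^ 2 * (l * n + 1 / l) := by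
  have hp := pi_pos
  set s := Finset.Ioc 0 M
  have hexp : ∀ x, (∑ n ∈ s, a n * cos (2 * π * (√n * x) + φ n)) ^ 2 =
      ∑ i ∈ s, ∑ j ∈ s, a i * a j / 2 *
        (cos (2 * π * ((√i - √j) * x) + (φ i - φ j)) +
          cos (2 * π * ((√i + √j) * x) + (φ i + φ j))) := fun x => by
    rw [sq, Finset.sum_mul_sum]
    refine Finset.sum_congr rfl fun i _ => Finset.sum_congr rfl fun j _ => ?_
    rw [show 2 * π * ((√i - √j) * x) + (φ i - φ j) =
      (2 * π * (√i * x) + φ i) - (2 * π * (√j * x) + φ j) by ring,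
      show 2 * π * ((√i + √j) * x) + (φ i + φ j) =
      (2 * π * (√i * x) + φ i) + (2 * π * (√j * x) + φ j) by ring,
      cos_sub (_ + φ i), cos_add (_ + φ i)]
    ring
  set E : ℕ → ℕ → ℝ := fun i j =>
    dyadicMean X (fun x => cos (2 * π * ((√i - √j) * x) + (φ i - φ j))) +
      dyadicMean X (fun x => cos (2 * π * ((√i + √j) * x) + (φ i + φ j))) with hE
  have hmean : dyadicMean X (fun x => (∑ n ∈ s, a n * cos (2 * π * (√n * x) + φ n)) ^ 2) =
      ∑ i ∈ s, ∑ j ∈ s, a i * a j / 2 * E i j := by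
    simp only [hexp, dyadicMean, hE]
    rw [intervalIntegral.integral_finsetSum fun i _ =>
      Continuous.intervalIntegrable (by fun_prop) _ _, Finset.smul_sum]
    refine Finset.sum_congr rfl fun i _ => ?_
    rw [intervalIntegral.integral_finsetSum fun i _ =>
      Continuous.intervalIntegrable (by fun_prop) _ _, Finset.smul_sum]
    refine Finset.sum_congr rfl fun j _ => ?_
    rw [intervalIntegral.integral_const_mul, intervalIntegral.integral_add
      (Continuous.intervalIntegrable (by fun_prop) _ _)
      (Continuous.intervalIntegrable (by fun_prop) _ _)]
    simp only [smul_eq_mul]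
    ring
  have hdiag : ∀ i ∈ s, a i * a i / 2 * E i i ≤ a i ^ 2 := fun i _ => by
    have h1 := (abs_le.1 (abs_dyadicMean_cos_le_one hX
      fun x => 2 * π * ((√i - √i) * x) + (φ i - φ i))).2
    have h2 := (abs_le.1 (abs_dyadicMean_cos_le_one hX
      fun x => 2 * π * ((√i + √i) * x) + (φ i + φ i))).2
    have h3 : E i i ≤ 2 := by rw [hE]; dsimp only; linarith
    nlinarith [mul_self_nonneg (a i)]
  have hoff : ∀ i ∈ s, ∀ j ∈ s.erase i, a i * a j / 2 * E i j ≤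
      1 / (π * X) * ((l * i * a i ^ 2 + a j ^ 2 / l) / 2 * (1 / |(i : ℝ) - j|) +
        (l * j * a j ^ 2 + a i ^ 2 / l) / 2 * (1 / |(i : ℝ) - j|)) := by
    intro i hi j hj
    obtain ⟨hji, hj⟩ := Finset.mem_erase.1 hj
    have hi0 : 0 < √(i : ℝ) := sqrt_pos.2 (by exact_mod_cast (Finset.mem_Ioc.1 hi).1)
    have hj0 : 0 < √(j : ℝ) := sqrt_pos.2 (by exact_mod_cast (Finset.mem_Ioc.1 hj).1)
    have hi2 := sq_sqrt (Nat.cast_nonneg (α := ℝ) i)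
    have hj2 := sq_sqrt (Nat.cast_nonneg (α := ℝ) j)
    have hne : √(i : ℝ) - √j ≠ 0 := fun h => hji <| by
      have h2 : √(i : ℝ) = √j := sub_eq_zero.1 h
      rw [h2, hj2] at hi2
      exact_mod_cast hi2
    have hd : |√(i : ℝ) - √j| * (√i + √j) = |(i : ℝ) - j| := by
      rw [show (i : ℝ) - j = (√i - √j) * (√i + √j) by linear_combination hj2 - hi2, abs_mul,
        abs_of_pos (add_pos hi0 hj0)]
    have hD : 0 < |√(i : ℝ) - √j| := abs_pos.2 hne
    have hD' : |√(i : ℝ) - √j| ≤ √i + √j := abs_le.2 ⟨by linarith, by linarith⟩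
    have h1 := abs_dyadicMean_cos_le hX hne (φ i - φ j)
    have h2 := abs_dyadicMean_cos_le hX (add_pos hi0 hj0).ne' (φ i + φ j)
    rw [abs_of_pos (add_pos hi0 hj0)] at h2
    have h3 : |E i j| ≤ 2 * (1 / (π * X * |√(i : ℝ) - √j|)) := by
      have h4 : 1 / (π * X * (√(i : ℝ) + √j)) ≤ 1 / (π * X * |√(i : ℝ) - √j|) := by gcongr
      exact (abs_add_le _ _).trans (by linarith)
    have h5 : |a i * a j| * (√i + √j) ≤ (l * i * a i ^ 2 + a j ^ 2 / l) / 2 +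
        (l * j * a j ^ 2 + a i ^ 2 / l) / 2 := by
      have key : ∀ u v w : ℝ, 0 ≤ u → 0 ≤ v → u * v * w ≤ (l * w ^ 2 * u ^ 2 + v ^ 2 / l) / 2 :=
        fun u v w _ _ => by
          have hsl := sq_sqrt hl.le
          have h := sq_nonneg (√l * w * u - v / √l)
          have hne := (sqrt_pos.2 hl).ne'
          have e : (√l * w * u - v / √l) ^ 2 = l * w ^ 2 * u ^ 2 + v ^ 2 / l - 2 * (u * v * w) := by
            rw [sub_sq, div_pow, mul_pow, mul_pow, hsl]
            field_simp
            ring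
          linarith
      have k1 := key |a i| |a j| √i (abs_nonneg _) (abs_nonneg _)
      have k2 := key |a j| |a i| √j (abs_nonneg _) (abs_nonneg _)
      rw [sq_abs, sq_abs, hi2] at k1
      rw [sq_abs, sq_abs, hj2] at k2
      rw [abs_mul]
      linarith
    calc a i * a j / 2 * E i j ≤ |a i * a j| / 2 * |E i j| := by
          refine (le_abs_self _).trans_eq ?_
          rw [abs_mul, abs_div, abs_two]
      _ ≤ |a i * a j| / 2 * (2 * (1 / (π * X * |√(i : ℝ) - √j|))) := by gcongr
      _ = 1 / (π * X) * (|a i * a j| * (√i + √j) * (1 / |(i : ℝ) - j|)) := by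
          rw [← hd]
          have := (add_pos hi0 hj0).ne'
          field_simp
      _ ≤ _ := by rw [← add_mul]; gcongr
  rw [hmean]
  have hswap : ∑ i ∈ s, ∑ j ∈ s.erase i, (l * j * a j ^ 2 + a i ^ 2 / l) / 2 *
      (1 / |(i : ℝ) - j|) = ∑ i ∈ s, ∑ j ∈ s.erase i, (l * i * a i ^ 2 + a j ^ 2 / l) / 2 *
      (1 / |(i : ℝ) - j|) := by
    rw [Finset.sum_comm' (t' := s) (s' := fun j => s.erase j) (by
      intro x y; simp only [Finset.mem_erase]; tauto)]
    refine Finset.sum_congr rfl fun i _ => Finset.sum_congr rfl fun j _ => ?_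
    rw [abs_sub_comm]
  have hsum2 : ∑ i ∈ s, ∑ j ∈ s.erase i, (l * i * a i ^ 2 + a j ^ 2 / l) *
      (1 / |(i : ℝ) - j|) = ∑ i ∈ s, a i ^ 2 * (l * i + 1 / l) *
        ∑ j ∈ s.erase i, 1 / |(i : ℝ) - j| := by
    have hsw : ∑ i ∈ s, ∑ j ∈ s.erase i, a j ^ 2 / l * (1 / |(i : ℝ) - j|) =
        ∑ i ∈ s, ∑ j ∈ s.erase i, a i ^ 2 / l * (1 / |(i : ℝ) - j|) := by
      rw [Finset.sum_comm' (t' := s) (s' := fun j => s.erase j) (by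
        intro x y; simp only [Finset.mem_erase]; tauto)]
      refine Finset.sum_congr rfl fun i _ => Finset.sum_congr rfl fun j _ => ?_
      rw [abs_sub_comm]
    simp only [add_mul, Finset.sum_add_distrib]
    rw [hsw, ← Finset.sum_add_distrib]
    refine Finset.sum_congr rfl fun i _ => ?_
    rw [← Finset.sum_add_distrib, Finset.mul_sum]
    refine Finset.sum_congr rfl fun j _ => ?_
    ring
  calc ∑ i ∈ s, ∑ j ∈ s, a i * a j / 2 * E i j
      = ∑ i ∈ s, (a i * a i / 2 * E i i + ∑ j ∈ s.erase i, a i * a j / 2 * E i j) :=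
        Finset.sum_congr rfl fun i hi => (Finset.add_sum_erase s _ hi).symm
    _ ≤ ∑ i ∈ s, (a i ^ 2 + ∑ j ∈ s.erase i,
        1 / (π * X) * ((l * i * a i ^ 2 + a j ^ 2 / l) / 2 * (1 / |(i : ℝ) - j|) +
        (l * j * a j ^ 2 + a i ^ 2 / l) / 2 * (1 / |(i : ℝ) - j|))) :=
        Finset.sum_le_sum fun i hi => add_le_add (hdiag i hi) (Finset.sum_le_sum (hoff i hi))
    _ = ∑ i ∈ s, a i ^ 2 + 1 / (π * X) * ∑ i ∈ s, a i ^ 2 * (l * i + 1 / l) *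
        ∑ j ∈ s.erase i, 1 / |(i : ℝ) - j| := by
        simp only [Finset.sum_add_distrib, ← Finset.mul_sum]
        rw [hswap, ← two_mul, ← hsum2, Finset.mul_sum]
        congr 2
        refine Finset.sum_congr rfl fun i _ => ?_
        rw [Finset.mul_sum]
        refine Finset.sum_congr rfl fun j _ => ?_
        ring
    _ ≤ ∑ i ∈ s, a i ^ 2 + 1 / (π * X) * ∑ i ∈ s, a i ^ 2 * (l * i + 1 / l) *
        (2 * (1 + log M)) := by
        gcongr with i hi
        exact sum_one_div_dist_le hi
    _ = _ := by rw [← Finset.sum_mul]; ring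

/-- Mean square bound for trigonometric sums with frequencies `√n`, `n ≤ X ^ 3`. -/
theorem exists_dyadicMean_sq_le : ∃ C, 0 ≤ C ∧ ∀ X : ℝ, 1 ≤ X → ∀ M : ℕ, (M : ℝ) ≤ X ^ 3 →
    ∀ a φ : ℕ → ℝ,
    dyadicMean X (fun x => (∑ n ∈ Finset.Ioc 0 M, a n * cos (2 * π * (√n * x) + φ n)) ^ 2) ≤
      C * ∑ n ∈ Finset.Ioc 0 M, a n ^ 2 * (1 + n * X ^ (-(13 / 8) : ℝ)) := by
  refine ⟨1 + 50 / π, by positivity, fun X hX M hM a φ => ?_⟩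
  have hp := pi_pos
  have hX0 : 0 < X := by linarith
  have hlog : log M ≤ 24 * X ^ (1 / 8 : ℝ) := by
    have h1 : log X ≤ 8 * X ^ (1 / 8 : ℝ) := by
      have := log_le_rpow_div hX0.le (ε := 1 / 8) (by norm_num)
      linarith
    rcases Nat.eq_zero_or_pos M with rfl | hM0
    · simp only [Nat.cast_zero, log_zero]; positivity
    · have := log_le_log (by exact_mod_cast hM0) hM
      rw [log_pow] at this
      push_cast at this
      linarith
  have h1 : 1 ≤ X ^ (1 / 8 : ℝ) := one_le_rpow hX (by norm_num)
  have hlog0 : 0 ≤ log (M : ℝ) := log_natCast_nonneg M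
  refine (dyadicMean_sq_le hX0 M a φ (l := X ^ (-(3 / 4) : ℝ)) (by positivity)).trans ?_
  rw [add_mul, Finset.mul_sum, Finset.mul_sum, Finset.mul_sum]
  refine add_le_add (Finset.sum_le_sum fun n _ => ?_) (Finset.sum_le_sum fun n _ => ?_)
  · rw [one_mul]
    exact le_mul_of_one_le_right (sq_nonneg _) (le_add_of_nonneg_right (by positivity))
  · have e1 : X ^ (1 / 8 : ℝ) / X * X ^ (-(3 / 4) : ℝ) = X ^ (-(13 / 8) : ℝ) := by
      rw [← rpow_sub_one hX0.ne', ← rpow_add hX0]; norm_num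
    have e2 : X ^ (1 / 8 : ℝ) / X * (1 / X ^ (-(3 / 4) : ℝ)) ≤ 1 := by
      rw [← rpow_sub_one hX0.ne', one_div (X ^ _), ← rpow_neg hX0.le, ← rpow_add hX0]
      exact rpow_le_one_of_one_le_of_nonpos hX (by norm_num)
    calc 2 * (1 + log M) / (π * X) * (a n ^ 2 * (X ^ (-(3 / 4) : ℝ) * n + 1 / X ^ (-(3 / 4) : ℝ)))
        ≤ 2 * (X ^ (1 / 8 : ℝ) + 24 * X ^ (1 / 8 : ℝ)) / (π * X) *
          (a n ^ 2 * (X ^ (-(3 / 4) : ℝ) * n + 1 / X ^ (-(3 / 4) : ℝ))) := by gcongr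
      _ = 50 / π * (a n ^ 2 * (n * (X ^ (1 / 8 : ℝ) / X * X ^ (-(3 / 4) : ℝ)) +
          X ^ (1 / 8 : ℝ) / X * (1 / X ^ (-(3 / 4) : ℝ)))) := by field_simp; ring
      _ ≤ 50 / π * (a n ^ 2 * (1 + n * X ^ (-(13 / 8) : ℝ))) := by
          rw [e1, add_comm (1 : ℝ)]; gcongr

set_option maxHeartbeats 1000000 in
theorem exists_abs_rieszMean_diff_quotient_sub_le : ∃ C : ℝ, 0 ≤ C ∧ ∀ x h : ℝ, 1 ≤ x → 0 < h →
    h ≤ 1 → |(rieszMean (x + h) - rieszMean x) / ((x + h) ^ 2 - x ^ 2) - π * x ^ 2 +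
      √x * ((rieszOsc (x + h) - rieszOsc x) / (2 * π ^ 2 * h))| ≤
      C * √x * (√x * h + 1 / (x * h)) := by
  obtain ⟨C, hC0, hC⟩ := exists_abs_rieszMean_sub_le
  obtain ⟨B, hB0, hB⟩ := exists_abs_rieszOsc_le
  refine ⟨5 + 2 * C + 3 * B, by positivity, fun x h hx hh hh1 => ?_⟩
  have key : ∀ y : ℝ, 1 ≤ y → ∃ e : ℝ, |e| ≤ C * √y ∧
      rieszMean y = π * √y ^ 8 / 2 - 1 / π ^ 2 * √y ^ 3 * rieszOsc y + e := fun y hy => by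
    have h1 := hC y hy
    have h2 : y ^ (3 / 2 : ℝ) = √y ^ 3 := by
      rw [sqrt_eq_rpow, ← rpow_natCast, ← rpow_mul (by linarith)]; norm_num
    have h3 : √y ^ 8 = y ^ 4 := by
      rw [show √y ^ 8 = (√y ^ 2) ^ 4 by ring, sq_sqrt (by linarith)]
    rw [h2] at h1
    exact ⟨_, h1, by rw [h3]; ring⟩
  obtain ⟨e0, he0, hR0⟩ := key x hx
  obtain ⟨e1, he1, hR1⟩ := key (x + h) (by linarith)
  rw [hR0, hR1]
  have hO0 := hB x
  have hO1 := hB (x + h)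
  set O0 := rieszOsc x
  set O1 := rieszOsc (x + h)
  obtain ⟨s, hs⟩ : ∃ s, s = √x := ⟨_, rfl⟩
  obtain ⟨t, ht⟩ : ∃ t, t = √(x + h) := ⟨_, rfl⟩
  have hs1 : 1 ≤ s := by rw [hs]; exact one_le_sqrt.2 hx
  have hs2 : x = s ^ 2 := by rw [hs, sq_sqrt (by linarith)]
  have ht2 : x + h = t ^ 2 := by rw [ht, sq_sqrt (by linarith)]
  rw [← hs] at he0 ⊢
  rw [← ht] at he1 ⊢
  have hst : s ≤ t := by rw [hs, ht]; exact sqrt_le_sqrt (by linarith)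
  have hs0 : 0 < s := by linarith
  have ht0 : 0 < t := by linarith
  have hth : h = t ^ 2 - s ^ 2 := by linarith
  have hts : t ≤ 2 * s := by nlinarith
  rw [ht2, hs2]
  have hw : 0 < (t ^ 2) ^ 2 - (s ^ 2) ^ 2 := by
    have : (t ^ 2) ^ 2 - (s ^ 2) ^ 2 = h * (t ^ 2 + s ^ 2) := by rw [hth]; ring
    rw [this]; positivity
  have hw' : (t ^ 2) ^ 2 - (s ^ 2) ^ 2 = h * (t ^ 2 + s ^ 2) := by rw [hth]; ring
  have hp := pi_pos
  have hsplit : (π * t ^ 8 / 2 - 1 / π ^ 2 * t ^ 3 * O1 + e1 -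
      (π * s ^ 8 / 2 - 1 / π ^ 2 * s ^ 3 * O0 + e0)) / ((t ^ 2) ^ 2 - (s ^ 2) ^ 2) -
      π * (s ^ 2) ^ 2 + s * ((O1 - O0) / (2 * π ^ 2 * h)) =
      π / 2 * (h * (t ^ 2 + s ^ 2)) + (e1 - e0) / (h * (t ^ 2 + s ^ 2)) +
      1 / π ^ 2 * (s / (2 * (t ^ 2 + s ^ 2)) * (O1 - O0) -
        (t ^ 2 + t * s + s ^ 2) / ((t + s) * (t ^ 2 + s ^ 2)) * O1) := by
    rw [hw']
    have h1 : t ^ 2 = s ^ 2 + h := by linarith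
    have h3 : h = (t - s) * (t + s) := by rw [hth]; ring
    have h4 : t - s ≠ 0 := fun h0 => hh.ne' (by rw [h3, h0, zero_mul])
    rw [h3]
    field_simp
    ring
  rw [hsplit]
  have b1 : |π / 2 * (h * (t ^ 2 + s ^ 2))| ≤ 5 * (h * s ^ 2) := by
    rw [abs_of_pos (by positivity)]
    have : t ^ 2 + s ^ 2 ≤ 3 * s ^ 2 := by nlinarith
    calc π / 2 * (h * (t ^ 2 + s ^ 2)) ≤ 3.15 / 2 * (h * (3 * s ^ 2)) := by
          gcongr; exact pi_lt_d2.le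
      _ ≤ 5 * (h * s ^ 2) := by nlinarith [mul_pos hh (pow_pos hs0 2)]
  have b2 : |(e1 - e0) / (h * (t ^ 2 + s ^ 2))| ≤ 2 * C * (1 / (s * h)) := by
    rw [abs_div, abs_of_pos (a := h * (t ^ 2 + s ^ 2)) (by positivity), div_le_iff₀ (by positivity)]
    calc |e1 - e0| ≤ C * (2 * s) + C * s :=
          (abs_sub _ _).trans (by gcongr; exact he1.trans (by gcongr))
      _ ≤ 2 * C * ((s ^ 2 + s ^ 2) / s) := by
        rw [show (s ^ 2 + s ^ 2) / s = 2 * s by field_simp; ring]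
        nlinarith [mul_nonneg hC0 hs0.le]
      _ ≤ 2 * C * ((t ^ 2 + s ^ 2) / s) := by gcongr
      _ = 2 * C * (1 / (s * h)) * (h * (t ^ 2 + s ^ 2)) := by field_simp
  have hsh : 1 / s ≤ 1 / (s * h) := by
    gcongr
    exact mul_le_of_le_one_right hs0.le hh1
  have b3 : |1 / π ^ 2 * (s / (2 * (t ^ 2 + s ^ 2)) * (O1 - O0) -
        (t ^ 2 + t * s + s ^ 2) / ((t + s) * (t ^ 2 + s ^ 2)) * O1)| ≤ 3 * B * (1 / (s * h)) := by
    have c1 : s / (2 * (t ^ 2 + s ^ 2)) ≤ 1 / s := by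
      rw [div_le_div_iff₀ (by positivity) hs0]
      linarith [sq_nonneg t, sq_nonneg s]
    have c2 : (t ^ 2 + t * s + s ^ 2) / ((t + s) * (t ^ 2 + s ^ 2)) ≤ 1 / s := by
      rw [div_le_div_iff₀ (by positivity) hs0]
      linarith [pow_pos ht0 3]
    have c3 : 1 / π ^ 2 ≤ 1 := by
      rw [div_le_one (by positivity)]
      nlinarith [pi_gt_three]
    rw [abs_mul, abs_of_pos (a := 1 / π ^ 2) (by positivity)]
    calc _ ≤ 1 * (1 / s * (B + B) + 1 / s * B) := by
          gcongr
          refine (abs_sub _ _).trans ?_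
          rw [abs_mul, abs_mul, abs_of_nonneg (a := s / (2 * (t ^ 2 + s ^ 2))) (by positivity),
            abs_of_nonneg (a := (t ^ 2 + t * s + s ^ 2) / ((t + s) * (t ^ 2 + s ^ 2)))
              (by positivity)]
          gcongr
          exact (abs_sub _ _).trans (by gcongr)
      _ = 3 * B * (1 / s) := by ring
      _ ≤ _ := by gcongr
  refine (abs_add_three _ _ _).trans ((add_le_add (add_le_add b1 b2) b3).trans ?_)
  have e : (5 + 2 * C + 3 * B) * s * (s * h + 1 / (s ^ 2 * h)) =
      5 * (h * s ^ 2) + 2 * C * (1 / (s * h)) + 3 * B * (1 / (s * h)) +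
      (5 * (1 / (s * h)) + (2 * C + 3 * B) * (h * s ^ 2)) := by field_simp; ring
  rw [e]
  have : 0 ≤ 5 * (1 / (s * h)) + (2 * C + 3 * B) * (h * s ^ 2) := by positivity
  linarith

/-- The normalised error term in the circle problem is controlled from both sides by difference
quotients of `rieszOsc`. -/
theorem exists_latticeCount_sub_le_and_le : ∃ C : ℝ, 0 ≤ C ∧ ∀ x h : ℝ, 1 ≤ x → 0 < h → h ≤ 1 →
    (latticeCount x - π * x ^ 2) / √x ≤
      -((rieszOsc (x + h) - rieszOsc x) / (2 * π ^ 2 * h)) + C * (√x * h + 1 / (x * h)) ∧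
    -((rieszOsc (x + h) - rieszOsc x) / (2 * π ^ 2 * h)) - C * (√x * h + 1 / (x * h)) ≤
      (latticeCount (x + h) - π * (x + h) ^ 2) / √(x + h) := by
  obtain ⟨C, hC0, hC⟩ := exists_abs_rieszMean_diff_quotient_sub_le
  obtain ⟨B, hB0, hB⟩ := exists_abs_rieszOsc_le
  refine ⟨C + 10 + B, by positivity, fun x h hx hh hh1 => ?_⟩
  have hp := pi_pos
  have hw : 0 < (x + h) ^ 2 - x ^ 2 := by nlinarith
  have h1 := latticeCount_mul_le (x := x) (y := x + h) (by linarith) (by linarith)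
  have h2 := le_latticeCount_mul (x := x) (y := x + h) (by linarith) (by linarith)
  rw [← le_div_iff₀ hw] at h1
  rw [← div_le_iff₀ hw] at h2
  have h3 := abs_le.1 (hC x h hx hh hh1)
  set A := (rieszMean (x + h) - rieszMean x) / ((x + h) ^ 2 - x ^ 2)
  set Δ := (rieszOsc (x + h) - rieszOsc x) / (2 * π ^ 2 * h) with hΔ
  set E := √x * h + 1 / (x * h) with hE
  have hx0 : 0 < x := by linarith
  have hE0 : 0 < E := by positivity
  have hs0 : 0 < √x := sqrt_pos.2 hx0
  have ht0 : 0 < √(x + h) := sqrt_pos.2 (by linarith)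
  constructor
  · rw [div_le_iff₀ hs0]
    have : 0 ≤ (10 + B) * E * √x := by positivity
    nlinarith [h3.2]
  · rw [le_div_iff₀ ht0]
    have hst : √x ≤ √(x + h) := sqrt_le_sqrt (by linarith)
    have hs2 := sq_sqrt hx0.le
    have ht2 := sq_sqrt (show 0 ≤ x + h by linarith)
    have hd : (√(x + h) - √x) * (√(x + h) + √x) = h := by linear_combination ht2 - hs2
    have hΔ' : |Δ * (√(x + h) - √x)| ≤ B * E * √(x + h) := by
      have e1 : |Δ| ≤ B / h := by
        rw [hΔ, abs_div, abs_of_pos (a := 2 * π ^ 2 * h) (by positivity),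
          div_le_div_iff₀ (by positivity) hh]
        have := (abs_sub (rieszOsc (x + h)) (rieszOsc x)).trans (add_le_add (hB _) (hB _))
        have hp2 : 1 ≤ π ^ 2 := by nlinarith [pi_gt_three]
        calc |rieszOsc (x + h) - rieszOsc x| * h ≤ (B + B) * h := by gcongr
          _ ≤ B * (2 * π ^ 2 * h) := by nlinarith [mul_nonneg hB0 hh.le]
      have e2 : √(x + h) - √x ≤ h / √(x + h) := by
        rw [le_div_iff₀ ht0]; nlinarith
      have e3 : 1 / √(x + h) ≤ E * √(x + h) := by
        rw [div_le_iff₀ ht0, mul_assoc, ← sq, ht2]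
        have : 1 / (x * h) ≤ E := by rw [hE]; linarith [mul_pos hs0 hh]
        have h5 : 1 / (x * h) * (x * h) = 1 := by field_simp
        have h6 : x * h ≤ x + h := by nlinarith
        calc (1:ℝ) = 1 / (x * h) * (x * h) := h5.symm
          _ ≤ E * (x + h) := by gcongr
      rw [abs_mul, abs_of_nonneg (sub_nonneg.2 hst)]
      calc |Δ| * (√(x + h) - √x) ≤ B / h * (h / √(x + h)) := by
            gcongr
        _ = B * (1 / √(x + h)) := by field_simp
        _ ≤ B * (E * √(x + h)) := by gcongr
        _ = _ := by ring
    have hpw : π * (x + h) ^ 2 - π * x ^ 2 ≤ 10 * E * √(x + h) := by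
      have h5 : √x * h ≤ E := by rw [hE]; linarith [(by positivity : 0 < 1 / (x * h))]
      calc π * (x + h) ^ 2 - π * x ^ 2 = π * h * (2 * x + h) := by ring
        _ ≤ 3.15 * h * (3 * x) := by gcongr; exact pi_lt_d2.le; linarith
        _ ≤ 10 * (√x * h * √x) := by nlinarith [mul_pos hh hx0]
        _ ≤ 10 * (E * √(x + h)) := by gcongr
        _ = _ := by ring
    have h4 := (abs_le.1 hΔ').1
    have h5 : C * √x * E ≤ C * √(x + h) * E := by gcongr
    nlinarith [h3.1]

/-- The truncation of `rieszOsc` to `n ≤ X ^ 3`. -/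
noncomputable def truncOsc (X x : ℝ) : ℝ :=
  ∑ n ∈ Finset.Ioc 0 ⌊X ^ 3⌋₊,
    (repCount n : ℝ) * ((n : ℝ) ^ (-(5 / 4) : ℝ) * cos (2 * π * (√n * x) - π / 4))

theorem exists_abs_rieszOsc_sub_truncOsc_le : ∃ C : ℝ, 0 ≤ C ∧ ∀ X x : ℝ, 1 ≤ X →
    |rieszOsc x - truncOsc X x| ≤ C * X ^ (-(11 / 16) : ℝ) := by
  have hS := summable_repCount_rpow (s := 49 / 48) (by norm_num)
  refine ⟨∑' n, (repCount n : ℝ) * (n : ℝ) ^ (-(49 / 48) : ℝ), tsum_nonneg fun n => by positivity,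
    fun X x hX => ?_⟩
  have hX0 : 0 < X := by linarith
  set f : ℕ → ℝ := fun n =>
    (repCount n : ℝ) * ((n : ℝ) ^ (-(5 / 4) : ℝ) * cos (2 * π * (√n * x) - π / 4)) with hf
  have hfs : Summable f := (hasSum_repCount_rpow_mul (by norm_num) fun n =>
      abs_cos_le_one _).summable
  have h1 : HasSum (fun n => f n - if n ∈ Finset.Ioc 0 ⌊X ^ 3⌋₊ then f n else 0)
      (rieszOsc x - truncOsc X x) := by
    refine hfs.hasSum.sub ?_
    have : HasSum (fun n => if n ∈ Finset.Ioc 0 ⌊X ^ 3⌋₊ then f n else 0)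
        (∑ n ∈ Finset.Ioc 0 ⌊X ^ 3⌋₊, if n ∈ Finset.Ioc 0 ⌊X ^ 3⌋₊ then f n else 0) :=
      hasSum_sum_of_ne_finset_zero fun n hn => if_neg hn
    rwa [Finset.sum_congr rfl fun n hn => if_pos hn] at this
  rw [← h1.tsum_eq, ← Real.norm_eq_abs]
  refine tsum_of_norm_bounded (hS.hasSum.mul_right _) fun n => ?_
  split_ifs with hn
  · rw [sub_self, norm_zero]; positivity
  · rw [sub_zero, hf]
    rcases Nat.eq_zero_or_pos n with rfl | hn0
    · simp
    · have hn1 : X ^ 3 < n := by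
        rw [Finset.mem_Ioc] at hn
        exact Nat.lt_of_floor_lt (by omega)
      have hn0' : (0 : ℝ) < n := by exact_mod_cast hn0
      rw [norm_mul, norm_mul, Real.norm_of_nonneg (by positivity),
        Real.norm_of_nonneg (by positivity), mul_assoc (repCount n : ℝ)]
      refine mul_le_mul_of_nonneg_left ?_ (Nat.cast_nonneg _)
      refine (mul_le_of_le_one_right (by positivity) (abs_cos_le_one _)).trans ?_
      rw [show (-(5 / 4) : ℝ) = -(49 / 48) + -(11 / 48) by norm_num, rpow_add hn0']
      gcongr
      calc (n : ℝ) ^ (-(11 / 48) : ℝ) ≤ (X ^ 3) ^ (-(11 / 48) : ℝ) :=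
            rpow_le_rpow_of_nonpos (by positivity) hn1.le (by norm_num)
        _ = X ^ (-(11 / 16) : ℝ) := by
            rw [← rpow_natCast, ← rpow_mul hX0.le]; norm_num

/-- A smoothed, truncated approximation to the normalised error term in the circle problem. -/
noncomputable def smoothSum (X x : ℝ) : ℝ :=
  -((truncOsc X (x + X ^ (-(5 / 8) : ℝ)) - truncOsc X x) / (2 * π ^ 2 * X ^ (-(5 / 8) : ℝ)))

theorem smoothSum_add_sub (X x u : ℝ) : smoothSum X (x + u) - smoothSum X x =
    ∑ n ∈ Finset.Ioc 0 ⌊X ^ 3⌋₊, 2 / (π ^ 2 * X ^ (-(5 / 8) : ℝ)) *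
      ((repCount n : ℝ) * ((n : ℝ) ^ (-(5 / 4) : ℝ) * (sin (π * X ^ (-(5 / 8) : ℝ) * √n) *
        sin (π * u * √n)))) *
      cos (2 * π * (√n * x) + (π * (X ^ (-(5 / 8) : ℝ) + u) * √n - π / 4)) := by
  set h := X ^ (-(5 / 8) : ℝ) with hh
  have key : ∀ D B C : ℝ, -(cos (D + B + C) - cos (D - B + C)) +
      (cos (D + B - C) - cos (D - B - C)) = 4 * (sin B * sin C) * cos D := fun D B C => by
    simp only [cos_add, cos_sub, sin_add, sin_sub]
    ring
  have hh0 : X ^ (-(5 / 8) : ℝ) = h := rfl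
  simp only [smoothSum, truncOsc, hh0]
  rw [← neg_sub_neg, neg_neg, neg_neg, ← sub_div, ← Finset.sum_sub_distrib,
    ← Finset.sum_sub_distrib, ← Finset.sum_sub_distrib, Finset.sum_div]
  refine Finset.sum_congr rfl fun n _ => ?_
  have k := key (2 * π * (√n * x) + (π * (h + u) * √n - π / 4)) (π * h * √n) (π * u * √n)
  rw [show 2 * π * (√n * (x + h)) - π / 4 = 2 * π * (√n * x) + (π * (h + u) * √n - π / 4) +
      π * h * √n - π * u * √n by ring,
    show 2 * π * (√n * (x + u)) - π / 4 = 2 * π * (√n * x) + (π * (h + u) * √n - π / 4) -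
      π * h * √n + π * u * √n by ring,
    show 2 * π * (√n * (x + u + h)) - π / 4 = 2 * π * (√n * x) + (π * (h + u) * √n - π / 4) +
      π * h * √n + π * u * √n by ring,
    show 2 * π * (√n * x) - π / 4 = 2 * π * (√n * x) + (π * (h + u) * √n - π / 4) -
      π * h * √n - π * u * √n by ring]
  rw [show 2 / (π ^ 2 * h) = 4 * (2 * π ^ 2 * h)⁻¹ by
    simp only [mul_inv, div_eq_mul_inv]; ring, div_eq_mul_inv]
  linear_combination ((repCount n : ℝ) * (n : ℝ) ^ (-(5 / 4) : ℝ) * (2 * π ^ 2 * h)⁻¹) * k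

theorem exists_latticeCount_sub_le_smoothSum : ∃ C : ℝ, 0 ≤ C ∧ ∀ X x : ℝ, 2 ≤ X → X ≤ x →
    x ≤ 3 * X →
    (latticeCount x - π * x ^ 2) / √x ≤ smoothSum X x + C * X ^ (-(1 / 16) : ℝ) ∧
    smoothSum X (x - X ^ (-(5 / 8) : ℝ)) - C * X ^ (-(1 / 16) : ℝ) ≤
      (latticeCount x - π * x ^ 2) / √x := by
  obtain ⟨C₁, hC₁, h₁⟩ := exists_abs_rieszOsc_sub_truncOsc_le
  obtain ⟨C₂, hC₂, h₂⟩ := exists_latticeCount_sub_le_and_le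
  have herr : ∀ X x : ℝ, 2 ≤ X → X / 2 ≤ x → x ≤ 3 * X →
      √x * X ^ (-(5 / 8) : ℝ) + 1 / (x * X ^ (-(5 / 8) : ℝ)) ≤ 4 * X ^ (-(1 / 16) : ℝ) := by
    intro X x hX hx1 hx2
    have hX0 : 0 < X := by linarith
    have hX1 : 1 ≤ X := by linarith
    have e1 : √x ≤ 2 * X ^ (1 / 2 : ℝ) := by
      rw [← sqrt_eq_rpow, show (2 : ℝ) = √4 by
        rw [show (4 : ℝ) = 2 ^ 2 by norm_num, sqrt_sq (by norm_num)], ← sqrt_mul (by norm_num)]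
      exact sqrt_le_sqrt (by linarith)
    have e2 : 1 / (x * X ^ (-(5 / 8) : ℝ)) ≤ 2 * X ^ (-(3 / 8) : ℝ) := by
      rw [div_le_iff₀ (mul_pos (by linarith) (rpow_pos_of_pos hX0 _))]
      calc (1 : ℝ) = X ^ (-(3 / 8) : ℝ) * X ^ (-(5 / 8) : ℝ) * X := by
            rw [← rpow_add hX0, ← rpow_add_one hX0.ne']; norm_num
        _ ≤ X ^ (-(3 / 8) : ℝ) * X ^ (-(5 / 8) : ℝ) * (2 * x) := by gcongr; linarith
        _ = _ := by ring
    have e3 : X ^ (1 / 2 : ℝ) * X ^ (-(5 / 8) : ℝ) ≤ X ^ (-(1 / 16) : ℝ) := by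
      rw [← rpow_add hX0]; exact rpow_le_rpow_of_exponent_le hX1 (by norm_num)
    have e4 : X ^ (-(3 / 8) : ℝ) ≤ X ^ (-(1 / 16) : ℝ) :=
      rpow_le_rpow_of_exponent_le hX1 (by norm_num)
    have e5 : √x * X ^ (-(5 / 8) : ℝ) ≤ 2 * X ^ (1 / 2 : ℝ) * X ^ (-(5 / 8) : ℝ) := by gcongr
    linarith
  have hosc : ∀ X x : ℝ, 2 ≤ X →
      |-((rieszOsc (x + X ^ (-(5 / 8) : ℝ)) - rieszOsc x) / (2 * π ^ 2 * X ^ (-(5 / 8) : ℝ))) -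
        smoothSum X x| ≤ C₁ * X ^ (-(1 / 16) : ℝ) := by
    intro X x hX
    have hX0 : 0 < X := by linarith
    have hh : 0 < X ^ (-(5 / 8) : ℝ) := rpow_pos_of_pos hX0 _
    have hp2 : 1 ≤ π ^ 2 := by nlinarith [pi_gt_three]
    have a1 := h₁ X (x + X ^ (-(5 / 8) : ℝ)) (by linarith)
    have a2 := h₁ X x (by linarith)
    have e : X ^ (-(11 / 16) : ℝ) = X ^ (-(1 / 16) : ℝ) * X ^ (-(5 / 8) : ℝ) := by
      rw [← rpow_add hX0]; norm_num
    rw [smoothSum, ← neg_sub', abs_neg, ← sub_div, abs_div, abs_of_pos (by positivity :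
      0 < 2 * π ^ 2 * X ^ (-(5 / 8) : ℝ)), div_le_iff₀ (by positivity)]
    calc _ = |(rieszOsc (x + X ^ (-(5 / 8) : ℝ)) - truncOsc X (x + X ^ (-(5 / 8) : ℝ))) -
          (rieszOsc x - truncOsc X x)| := by congr 1; ring
      _ ≤ _ := abs_sub _ _
      _ ≤ C₁ * X ^ (-(11 / 16) : ℝ) + C₁ * X ^ (-(11 / 16) : ℝ) := add_le_add a1 a2
      _ = C₁ * X ^ (-(1 / 16) : ℝ) * (2 * 1 * X ^ (-(5 / 8) : ℝ)) := by rw [e]; ring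
      _ ≤ _ := by gcongr
  refine ⟨C₁ + 4 * C₂, by positivity, fun X x hX hx1 hx2 => ?_⟩
  have hX0 : 0 < X := by linarith
  have hh : 0 < X ^ (-(5 / 8) : ℝ) := rpow_pos_of_pos hX0 _
  have hh1 : X ^ (-(5 / 8) : ℝ) ≤ 1 := rpow_le_one_of_one_le_of_nonpos (by linarith) (by norm_num)
  constructor
  · have b1 := (h₂ x _ (by linarith) hh hh1).1
    have b2 := (abs_le.1 (hosc X x hX)).2
    have b3 := mul_le_mul_of_nonneg_left (herr X x hX (by linarith) hx2) hC₂
    linarith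
  · have b1 := (h₂ (x - X ^ (-(5 / 8) : ℝ)) _ (by linarith) hh hh1).2
    have b2 := (abs_le.1 (hosc X (x - X ^ (-(5 / 8) : ℝ)) hX)).1
    have b3 := mul_le_mul_of_nonneg_left
      (herr X (x - X ^ (-(5 / 8) : ℝ)) hX (by linarith) (by linarith)) hC₂
    rw [sub_add_cancel] at b1 b2
    linarith

/-- The difference of two adjacent smoothings. -/
noncomputable def smoothGap (X x : ℝ) : ℝ :=
  smoothSum X x - smoothSum X (x - X ^ (-(5 / 8) : ℝ))

/-- The normalised deviation of the lattice point count in the annulus `(x, x + δ]`. -/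
noncomputable def annulusDev (δ x : ℝ) : ℝ :=
  ((latticeCount (x + δ) : ℝ) - latticeCount x - π * ((x + δ) ^ 2 - x ^ 2)) / √x

theorem exists_abs_annulusDev_sub_le : ∃ C : ℝ, 0 ≤ C ∧ ∀ X δ x : ℝ, 2 ≤ X → 0 ≤ δ → δ ≤ 1 →
    X ≤ x → x ≤ 2 * X →
    |annulusDev δ x - (smoothSum X (x + δ) - smoothSum X x)| ≤
      |smoothGap X x| + |smoothGap X (x + δ)| + C * X ^ (-(1 / 16) : ℝ) := by
  obtain ⟨C₁, hC₁, h₁⟩ := exists_latticeCount_sub_le_smoothSum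
  obtain ⟨C₂, hC₂, h₂⟩ := exists_abs_latticeCount_sub_le
  refine ⟨2 * C₁ + 2 * C₂, by positivity, fun X δ x hX hδ hδ1 hx1 hx2 => ?_⟩
  have hX0 : 0 < X := by linarith
  have hx0 : 0 < x := by linarith
  have hs : 0 < √x := sqrt_pos.2 hx0
  have ht : 0 < √(x + δ) := sqrt_pos.2 (by linarith)
  have hss : √x * √x = x := mul_self_sqrt hx0.le
  have htt : √(x + δ) * √(x + δ) = x + δ := mul_self_sqrt (by linarith)
  have hst : √x ≤ √(x + δ) := sqrt_le_sqrt (by linarith)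
  obtain ⟨a1, a2⟩ := h₁ X x hX hx1 (by linarith)
  obtain ⟨b1, b2⟩ := h₁ X (x + δ) hX (by linarith) (by linarith)
  have c := h₂ (x + δ) (by linarith)
  set E := (latticeCount (x + δ) : ℝ) - π * (x + δ) ^ 2 with hE
  have e1 : annulusDev δ x = E / √(x + δ) - (latticeCount x - π * x ^ 2) / √x +
      (E / √x - E / √(x + δ)) := by
    rw [annulusDev, hE]; ring
  have e2 : |E / √x - E / √(x + δ)| ≤ 2 * C₂ * X ^ (-(1 / 16) : ℝ) := by
    have hX12 : X ^ (-(1 / 2) : ℝ) ≤ X ^ (-(1 / 16) : ℝ) :=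
      rpow_le_rpow_of_exponent_le (by linarith) (by norm_num)
    have hd : √(x + δ) - √x ≤ 1 / √(x + δ) := by
      rw [le_div_iff₀ ht]; nlinarith
    have hx12 : 1 / √x ≤ X ^ (-(1 / 2) : ℝ) := by
      rw [rpow_neg hX0.le, ← sqrt_eq_rpow, ← one_div]
      exact one_div_le_one_div_of_le (sqrt_pos.2 hX0) (sqrt_le_sqrt hx1)
    rw [div_sub_div _ _ hs.ne' ht.ne', mul_comm (√x) E, ← mul_sub, abs_div, abs_mul,
      abs_of_nonneg (sub_nonneg.2 hst), abs_of_pos (mul_pos hs ht)]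
    calc |E| * (√(x + δ) - √x) / (√x * √(x + δ))
        ≤ C₂ * (x + δ) * (1 / √(x + δ)) / (√x * √(x + δ)) := by gcongr
      _ = C₂ * (√(x + δ) * √(x + δ)) * (1 / √(x + δ)) / (√x * √(x + δ)) := by rw [htt]
      _ = C₂ * (1 / √x) := by field_simp
      _ ≤ C₂ * X ^ (-(1 / 16) : ℝ) := by gcongr; exact hx12.trans hX12
      _ ≤ _ := by
          have : 0 ≤ C₂ * X ^ (-(1 / 16) : ℝ) := by positivity
          linarith
  rw [smoothGap, smoothGap]
  rw [e1]
  obtain ⟨e2, e3⟩ := abs_le.1 e2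
  have g1 := neg_abs_le (smoothSum X x - smoothSum X (x - X ^ (-(5 / 8) : ℝ)))
  have g2 := le_abs_self (smoothSum X x - smoothSum X (x - X ^ (-(5 / 8) : ℝ)))
  have g3 := abs_nonneg (smoothSum X x - smoothSum X (x - X ^ (-(5 / 8) : ℝ)))
  have g4 := le_abs_self (smoothSum X (x + δ) - smoothSum X (x + δ - X ^ (-(5 / 8) : ℝ)))
  have g5 := abs_nonneg (smoothSum X (x + δ) - smoothSum X (x + δ - X ^ (-(5 / 8) : ℝ)))
  rw [abs_le]
  constructor <;> linarith

/-- The squarefree part of `n`. -/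
noncomputable def sqfreePart (n : ℕ) : ℕ := (Nat.sq_mul_squarefree n).choose

/-- The square root of the quotient of `n` by its squarefree part. -/
noncomputable def sqrtPart (n : ℕ) : ℕ := (Nat.sq_mul_squarefree n).choose_spec.choose

theorem sqrtPart_sq_mul_sqfreePart (n : ℕ) : sqrtPart n ^ 2 * sqfreePart n = n :=
  (Nat.sq_mul_squarefree n).choose_spec.choose_spec.1

theorem squarefree_sqfreePart (n : ℕ) : Squarefree (sqfreePart n) :=
  (Nat.sq_mul_squarefree n).choose_spec.choose_spec.2

theorem sqfreePart_pos (n : ℕ) : 0 < sqfreePart n :=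
  Nat.pos_of_ne_zero (squarefree_sqfreePart n).ne_zero

theorem eq_of_sqfreePart_eq_of_sqrtPart_eq {i j : ℕ} (hq : sqfreePart i = sqfreePart j)
    (hm : sqrtPart i = sqrtPart j) : i = j := by
  rw [← sqrtPart_sq_mul_sqfreePart i, hq, hm, sqrtPart_sq_mul_sqfreePart]

theorem sqrtPart_pos {n : ℕ} (hn : 0 < n) : 0 < sqrtPart n := by
  refine Nat.pos_of_ne_zero fun h => hn.ne ?_
  rw [← sqrtPart_sq_mul_sqfreePart n, h]; simp

theorem sqrt_natCast_eq (n : ℕ) : √(n : ℝ) = sqrtPart n * √(sqfreePart n : ℝ) := by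
  conv_lhs => rw [← sqrtPart_sq_mul_sqfreePart n]
  push_cast
  rw [sqrt_mul (by positivity), sqrt_sq (by positivity)]

theorem summable_sqfreePart_rpow_mul {s t : ℝ} (hs : 1 < s) (ht : 1 < t) :
    Summable fun n : ℕ => (sqfreePart n : ℝ) ^ (-s) * (sqrtPart n : ℝ) ^ (-t) := by
  have h := (Real.summable_nat_rpow.2 (neg_lt_neg hs)).mul_of_nonneg
    (Real.summable_nat_rpow.2 (neg_lt_neg ht)) (fun _ => by positivity) (fun _ => by positivity)
  exact h.comp_injective (i := fun n => (sqfreePart n, sqrtPart n)) fun i j hij =>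
    eq_of_sqfreePart_eq_of_sqrtPart_eq (Prod.ext_iff.1 hij).1 (Prod.ext_iff.1 hij).2

theorem abs_sin_le_self {y : ℝ} (hy : 0 ≤ y) : |sin y| ≤ y :=
  abs_sin_le_abs.trans_eq (abs_of_nonneg hy)

theorem abs_sin_pow_le_rpow {y s : ℝ} {k : ℕ} (hy : 0 ≤ y) (hs : 0 ≤ s) (hsk : s ≤ k) :
    |sin y| ^ k ≤ y ^ s := by
  rw [← rpow_natCast]
  exact (rpow_le_rpow_of_exponent_ge' (abs_nonneg _) (abs_sin_le_one y) hs hsk).trans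
    (rpow_le_rpow (abs_nonneg _) (abs_sin_le_self hy) hs)

/-- The Fourier coefficients of `smoothSum X (x + u) - smoothSum X x`. -/
noncomputable def smoothCoeff (X u : ℝ) (n : ℕ) : ℝ :=
  2 / (π ^ 2 * X ^ (-(5 / 8) : ℝ)) *
    ((repCount n : ℝ) * ((n : ℝ) ^ (-(5 / 4) : ℝ) * (sin (π * X ^ (-(5 / 8) : ℝ) * √n) *
      sin (π * u * √n))))

/-- The limit of `smoothCoeff X δ` as the smoothing length tends to zero. -/
noncomputable def annulusCoeff (δ : ℝ) (n : ℕ) : ℝ :=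
  2 / π * ((repCount n : ℝ) * ((n : ℝ) ^ (-(3 / 4) : ℝ) * sin (π * δ * √n)))

theorem annulusCoeff_sq (δ : ℝ) (n : ℕ) : annulusCoeff δ n ^ 2 =
    4 / π ^ 2 * ((repCount n : ℝ) ^ 2 * ((n : ℝ) ^ (-(3 / 2) : ℝ) * sin (π * δ * √n) ^ 2)) := by
  have : ((n : ℝ) ^ (-(3 / 4) : ℝ)) ^ 2 = (n : ℝ) ^ (-(3 / 2) : ℝ) := by
    rw [← rpow_natCast, ← rpow_mul (Nat.cast_nonneg _)]; norm_num
  rw [annulusCoeff, ← this]; ring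

theorem abs_smoothCoeff_le {X u : ℝ} (hX : 0 < X) (n : ℕ) :
    |smoothCoeff X u n| ≤ |annulusCoeff u n| := by
  rcases Nat.eq_zero_or_pos n with rfl | hn
  · simp [smoothCoeff, annulusCoeff]
  have hn' : (0 : ℝ) < n := by exact_mod_cast hn
  have hh : 0 < X ^ (-(5 / 8) : ℝ) := rpow_pos_of_pos hX _
  have e : (n : ℝ) ^ (-(3 / 4) : ℝ) = (n : ℝ) ^ (-(5 / 4) : ℝ) * √n := by
    rw [sqrt_eq_rpow, ← rpow_add hn']; norm_num
  rw [smoothCoeff, annulusCoeff, e]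
  simp only [abs_mul, abs_div]
  set h := X ^ (-(5 / 8) : ℝ)
  have : |sin (π * h * √n)| ≤ π * h * √n := abs_sin_le_self (by positivity)
  rw [abs_of_pos hh, abs_of_pos pi_pos, abs_of_pos (sqrt_pos.2 hn'),
      abs_of_pos (by positivity : 0 < π ^ 2), abs_two]
  calc 2 / (π ^ 2 * h) * (|(repCount n : ℝ)| * (|(n : ℝ) ^ (-(5 / 4) : ℝ)| *
        (|sin (π * h * √n)| * |sin (π * u * √n)|)))
      ≤ 2 / (π ^ 2 * h) * (|(repCount n : ℝ)| * (|(n : ℝ) ^ (-(5 / 4) : ℝ)| *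
        (π * h * √n * |sin (π * u * √n)|))) := by gcongr
    _ = _ := by field_simp

/-- The size of `smoothCoeff` when both sines are of order one. -/
theorem smoothCoeff_sq_le {X u : ℝ} (hX : 0 < X) {n : ℕ} {B : ℝ}
    (hB : (sin (π * X ^ (-(5 / 8) : ℝ) * √n) * sin (π * u * √n)) ^ 2 ≤ B) :
    smoothCoeff X u n ^ 2 ≤
      X ^ (5 / 4 : ℝ) * ((repCount n : ℝ) ^ 2 * (n : ℝ) ^ (-(5 / 2) : ℝ)) * B := by
  have e1 : ((n : ℝ) ^ (-(5 / 4) : ℝ)) ^ 2 = (n : ℝ) ^ (-(5 / 2) : ℝ) := by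
    rw [← rpow_natCast, ← rpow_mul (Nat.cast_nonneg _)]; norm_num
  have e2 : (2 / (π ^ 2 * X ^ (-(5 / 8) : ℝ))) ^ 2 = 4 / π ^ 4 * X ^ (5 / 4 : ℝ) := by
    have : (X ^ (-(5 / 8) : ℝ)) ^ 2 * X ^ (5 / 4 : ℝ) = 1 := by
      rw [← rpow_natCast, ← rpow_mul hX.le, ← rpow_add hX]; norm_num
    have hh : 0 < X ^ (-(5 / 8) : ℝ) := rpow_pos_of_pos hX _
    field_simp
    linear_combination -4 * this
  have e3 : 4 / π ^ 4 ≤ 1 := by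
    rw [div_le_one (by positivity)]
    calc (4 : ℝ) ≤ 3 ^ 4 := by norm_num
      _ ≤ π ^ 4 := by gcongr; exact pi_gt_three.le
  rw [smoothCoeff, mul_pow, mul_pow, mul_pow, e1, e2]
  calc 4 / π ^ 4 * X ^ (5 / 4 : ℝ) * ((repCount n : ℝ) ^ 2 * ((n : ℝ) ^ (-(5 / 2) : ℝ) *
        (sin (π * X ^ (-(5 / 8) : ℝ) * √n) * sin (π * u * √n)) ^ 2))
      ≤ 1 * X ^ (5 / 4 : ℝ) * ((repCount n : ℝ) ^ 2 * ((n : ℝ) ^ (-(5 / 2) : ℝ) * B)) := by gcongr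
    _ = _ := by ring

theorem natCast_mul_smoothCoeff_sq_le {X u : ℝ} (hX : 0 < X) {n : ℕ} (hn : 0 < n) :
    n * X ^ (-(13 / 8) : ℝ) * smoothCoeff X u n ^ 2 ≤
      X ^ (-(3 / 8) : ℝ) * ((repCount n : ℝ) ^ 2 * (n : ℝ) ^ (-(3 / 2) : ℝ)) := by
  have hn' : (0 : ℝ) < n := by exact_mod_cast hn
  have h := smoothCoeff_sq_le hX (n := n) (u := u) (B := 1) (by
    rw [sq_le_one_iff_abs_le_one, abs_mul]
    exact mul_le_one₀ (abs_sin_le_one _) (abs_nonneg _) (abs_sin_le_one _))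
  have e1 : X ^ (-(3 / 8) : ℝ) = X ^ (-(13 / 8) : ℝ) * X ^ (5 / 4 : ℝ) := by
    rw [← rpow_add hX]; norm_num
  have e2 : (n : ℝ) ^ (-(3 / 2) : ℝ) = n * (n : ℝ) ^ (-(5 / 2) : ℝ) := by
    rw [← rpow_one_add' hn'.le (by norm_num)]; norm_num
  refine (mul_le_mul_of_nonneg_left h (by positivity)).trans (le_of_eq ?_)
  rw [e1, e2]; ring

theorem sq_smoothCoeff_self_le {X : ℝ} (hX : 0 < X) {n : ℕ} (hn : 0 < n) :
    smoothCoeff X (X ^ (-(5 / 8) : ℝ)) n ^ 2 ≤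
      π ^ (5 / 2 : ℝ) * X ^ (-(5 / 16) : ℝ) *
        ((repCount n : ℝ) ^ 2 * (n : ℝ) ^ (-(5 / 4) : ℝ)) := by
  have hn' : (0 : ℝ) < n := by exact_mod_cast hn
  have hh : 0 < X ^ (-(5 / 8) : ℝ) := rpow_pos_of_pos hX _
  have h := smoothCoeff_sq_le hX (n := n) (u := X ^ (-(5 / 8) : ℝ))
    (B := (π * X ^ (-(5 / 8) : ℝ) * √n) ^ (5 / 2 : ℝ)) (by
      refine le_trans (le_of_eq ?_) (abs_sin_pow_le_rpow (k := 4) (by positivity) (by norm_num)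
        (by norm_num))
      rw [← sq, ← pow_mul, ← abs_pow, abs_of_nonneg (by positivity)])
  refine h.trans (le_of_eq ?_)
  rw [mul_rpow (by positivity) (by positivity), mul_rpow (by positivity) (by positivity),
    ← rpow_mul hX.le, sqrt_eq_rpow, ← rpow_mul hn'.le,
    show (-(5 / 16) : ℝ) = 5 / 4 + -(5 / 8) * (5 / 2) by norm_num, rpow_add hX,
    show (n : ℝ) ^ (-(5 / 4) : ℝ) = (n : ℝ) ^ (-(5 / 2) : ℝ) * (n : ℝ) ^ (1 / 2 * (5 / 2) : ℝ) by
      rw [← rpow_add hn']; norm_num]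
  ring

/-- The mean square of `smoothGap` and of its translates is small. -/
theorem exists_sum_smoothCoeff_self_le : ∃ C : ℝ, 0 ≤ C ∧ ∀ X : ℝ, 1 ≤ X → ∀ M : ℕ,
    ∑ n ∈ Finset.Ioc 0 M, smoothCoeff X (X ^ (-(5 / 8) : ℝ)) n ^ 2 *
      (1 + n * X ^ (-(13 / 8) : ℝ)) ≤ C * X ^ (-(5 / 16) : ℝ) := by
  have hS := summable_repCount_sq_rpow (s := 5 / 4) (by norm_num)
  have hT := summable_repCount_sq_rpow (s := 3 / 2) (by norm_num)
  refine ⟨π ^ (5 / 2 : ℝ) * ∑' n, (repCount n : ℝ) ^ 2 * (n : ℝ) ^ (-(5 / 4) : ℝ) +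
    ∑' n, (repCount n : ℝ) ^ 2 * (n : ℝ) ^ (-(3 / 2) : ℝ), ?_, fun X hX M => ?_⟩
  · have hpos : ∀ s : ℝ, 0 ≤ ∑' n, (repCount n : ℝ) ^ 2 * (n : ℝ) ^ (-s) :=
      fun s => tsum_nonneg fun n => by positivity
    have h1 := hpos (5 / 4)
    have h2 := hpos (3 / 2)
    positivity
  have hX0 : 0 < X := by linarith
  have hXX : X ^ (-(3 / 8) : ℝ) ≤ X ^ (-(5 / 16) : ℝ) :=
    rpow_le_rpow_of_exponent_le hX (by norm_num)
  calc _ ≤ ∑ n ∈ Finset.Ioc 0 M, X ^ (-(5 / 16) : ℝ) * (π ^ (5 / 2 : ℝ) *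
        ((repCount n : ℝ) ^ 2 * (n : ℝ) ^ (-(5 / 4) : ℝ)) +
        (repCount n : ℝ) ^ 2 * (n : ℝ) ^ (-(3 / 2) : ℝ)) := by
        refine Finset.sum_le_sum fun n hn => ?_
        have hn := (Finset.mem_Ioc.1 hn).1
        have h1 := sq_smoothCoeff_self_le hX0 hn
        have h2 := natCast_mul_smoothCoeff_sq_le hX0 (u := X ^ (-(5 / 8) : ℝ)) hn
        have h3 := mul_le_mul_of_nonneg_right hXX (by positivity :
          0 ≤ (repCount n : ℝ) ^ 2 * (n : ℝ) ^ (-(3 / 2) : ℝ))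
        linarith
    _ ≤ _ := by
        rw [← Finset.mul_sum, Finset.sum_add_distrib, ← Finset.mul_sum, mul_comm]
        gcongr
        · exact hS.sum_le_tsum _ fun n _ => by positivity
        · exact hT.sum_le_tsum _ fun n _ => by positivity

/-- The frequencies carrying the main term: those `n ≤ δ⁻⁴` with a large squarefree part. -/
noncomputable def mainIndex (δ : ℝ) : Finset ℕ :=
  (Finset.Ioc 0 ⌊δ⁻¹ ^ 4⌋₊).filter fun n => δ⁻¹ < sqfreePart n

theorem annulusCoeff_sq_le (δ : ℝ) (n : ℕ) :
    annulusCoeff δ n ^ 2 ≤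
      (repCount n : ℝ) ^ 2 * ((n : ℝ) ^ (-(3 / 2) : ℝ) * sin (π * δ * √n) ^ 2) := by
  rw [annulusCoeff_sq]
  refine mul_le_of_le_one_left (by positivity) ?_
  rw [div_le_one (by positivity)]
  nlinarith [pi_gt_three]

theorem annulusCoeff_sq_le' (δ : ℝ) (n : ℕ) :
    annulusCoeff δ n ^ 2 ≤ (repCount n : ℝ) ^ 2 * (n : ℝ) ^ (-(3 / 2) : ℝ) :=
  (annulusCoeff_sq_le δ n).trans <| mul_le_mul_of_nonneg_left
    (mul_le_of_le_one_right (by positivity) (sin_sq_le_one _)) (by positivity)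

theorem annulusCoeff_sq_le_of_lt {δ : ℝ} (hδ : 0 < δ) {n : ℕ} (hn : δ⁻¹ ^ 4 < n) :
    annulusCoeff δ n ^ 2 ≤ δ * ((repCount n : ℝ) ^ 2 * (n : ℝ) ^ (-(5 / 4) : ℝ)) := by
  have hn0 : (0 : ℝ) < n := lt_trans (by positivity) hn
  refine (annulusCoeff_sq_le' δ n).trans ?_
  have h : (n : ℝ) ^ (-(1 / 4) : ℝ) ≤ δ := by
    refine (rpow_le_rpow_of_nonpos (by positivity) hn.le (by norm_num)).trans_eq ?_
    rw [← rpow_natCast, ← rpow_mul (by positivity), inv_rpow hδ.le]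
    norm_num [rpow_neg_one]
  rw [show (-(3 / 2) : ℝ) = -(1 / 4) + -(5 / 4) by norm_num, rpow_add hn0, mul_left_comm]
  gcongr

theorem exists_annulusCoeff_sq_le_of_sqfreePart_le : ∃ C : ℝ, 0 ≤ C ∧ ∀ δ : ℝ, 0 < δ → δ ≤ 1 →
    ∀ n : ℕ, 0 < n → (sqfreePart n : ℝ) ≤ δ⁻¹ → annulusCoeff δ n ^ 2 ≤
      C * δ * ((sqfreePart n : ℝ) ^ (-(17 / 16) : ℝ) * (sqrtPart n : ℝ) ^ (-(9 / 8) : ℝ)) := by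
  obtain ⟨C, hC0, hC⟩ := exists_repCount_le (ε := 1 / 32) (by norm_num)
  refine ⟨C ^ 2 * π ^ (7 / 4 : ℝ), by positivity, fun δ hδ hδ1 n hn hq => ?_⟩
  have hn0 : (0 : ℝ) < n := by exact_mod_cast hn
  have hq0 : (0 : ℝ) < sqfreePart n := by exact_mod_cast sqfreePart_pos n
  have hm0 : (0 : ℝ) < sqrtPart n := by exact_mod_cast sqrtPart_pos hn
  have h1 : (repCount n : ℝ) ^ 2 ≤ C ^ 2 * (n : ℝ) ^ (1 / 16 : ℝ) := by
    calc _ ≤ (C * (n : ℝ) ^ (1 / 32 : ℝ)) ^ 2 := by gcongr; exact hC n hn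
      _ = _ := by rw [mul_pow, ← rpow_natCast (_ ^ _) 2, ← rpow_mul hn0.le]; norm_num
  have h2 : sin (π * δ * √n) ^ 2 ≤ π ^ (7 / 4 : ℝ) * δ ^ (7 / 4 : ℝ) * (n : ℝ) ^ (7 / 8 : ℝ) := by
    rw [← sq_abs]
    refine (abs_sin_pow_le_rpow (s := 7 / 4) (by positivity) (by norm_num)
      (by norm_num)).trans_eq ?_
    rw [mul_rpow (by positivity) (by positivity), mul_rpow (by positivity) (by positivity),
      sqrt_eq_rpow, ← rpow_mul hn0.le]
    norm_num
  have h3 : (n : ℝ) ^ (-(9 / 16) : ℝ) =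
      (sqfreePart n : ℝ) ^ (-(9 / 16) : ℝ) * (sqrtPart n : ℝ) ^ (-(9 / 8) : ℝ) := by
    conv_lhs => rw [← sqrtPart_sq_mul_sqfreePart n]
    push_cast
    rw [mul_rpow (by positivity) (by positivity), ← rpow_natCast, ← rpow_mul hm0.le, mul_comm]
    norm_num
  have h4 : δ ^ (7 / 4 : ℝ) * (sqfreePart n : ℝ) ^ (-(9 / 16) : ℝ) ≤
      δ * (sqfreePart n : ℝ) ^ (-(17 / 16) : ℝ) := by
    have h5 : (sqfreePart n : ℝ) ^ (1 / 2 : ℝ) ≤ δ ^ (-(1 / 2) : ℝ) := by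
      rw [rpow_neg hδ.le, ← inv_rpow hδ.le]
      exact rpow_le_rpow hq0.le hq (by norm_num)
    have h6 : δ ^ (7 / 4 : ℝ) * δ ^ (-(1 / 2) : ℝ) ≤ δ := by
      rw [← rpow_add hδ]
      exact (rpow_le_rpow_of_exponent_ge hδ hδ1 (by norm_num)).trans_eq (rpow_one δ)
    calc _ = δ ^ (7 / 4 : ℝ) * (sqfreePart n : ℝ) ^ (1 / 2 : ℝ) *
          (sqfreePart n : ℝ) ^ (-(17 / 16) : ℝ) := by
          rw [mul_assoc, ← rpow_add hq0]; norm_num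
      _ ≤ δ ^ (7 / 4 : ℝ) * δ ^ (-(1 / 2) : ℝ) * (sqfreePart n : ℝ) ^ (-(17 / 16) : ℝ) := by gcongr
      _ ≤ _ := by gcongr
  calc _ ≤ _ := annulusCoeff_sq_le δ n
    _ ≤ C ^ 2 * (n : ℝ) ^ (1 / 16 : ℝ) * ((n : ℝ) ^ (-(3 / 2) : ℝ) *
        (π ^ (7 / 4 : ℝ) * δ ^ (7 / 4 : ℝ) * (n : ℝ) ^ (7 / 8 : ℝ))) := by gcongr
    _ = C ^ 2 * π ^ (7 / 4 : ℝ) * δ ^ (7 / 4 : ℝ) *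
        ((n : ℝ) ^ (1 / 16 : ℝ) * (n : ℝ) ^ (-(3 / 2) : ℝ) * (n : ℝ) ^ (7 / 8 : ℝ)) := by ring
    _ = C ^ 2 * π ^ (7 / 4 : ℝ) * δ ^ (7 / 4 : ℝ) * (n : ℝ) ^ (-(9 / 16) : ℝ) := by
        rw [← rpow_add hn0, ← rpow_add hn0]; norm_num
    _ = C ^ 2 * π ^ (7 / 4 : ℝ) * (δ ^ (7 / 4 : ℝ) * (sqfreePart n : ℝ) ^ (-(9 / 16) : ℝ)) *
        (sqrtPart n : ℝ) ^ (-(9 / 8) : ℝ) := by rw [h3]; ring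
    _ ≤ C ^ 2 * π ^ (7 / 4 : ℝ) * (δ * (sqfreePart n : ℝ) ^ (-(17 / 16) : ℝ)) *
        (sqrtPart n : ℝ) ^ (-(9 / 8) : ℝ) := by gcongr
    _ = _ := by ring

theorem exists_sum_annulusCoeff_sq_le : ∃ C : ℝ, 0 ≤ C ∧ ∀ δ : ℝ, 0 < δ → δ ≤ 1 →
    ∀ T : Finset ℕ, (∀ n ∈ T, 0 < n ∧ n ∉ mainIndex δ) →
      ∑ n ∈ T, annulusCoeff δ n ^ 2 ≤ C * δ := by
  obtain ⟨C, hC0, hC⟩ := exists_annulusCoeff_sq_le_of_sqfreePart_le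
  have hS := (summable_repCount_sq_rpow (s := 5 / 4) (by norm_num)).add
    ((summable_sqfreePart_rpow_mul (s := 17 / 16) (t := 9 / 8) (by norm_num)
      (by norm_num)).mul_left C)
  refine ⟨∑' n : ℕ, ((repCount n : ℝ) ^ 2 * (n : ℝ) ^ (-(5 / 4) : ℝ) +
    C * ((sqfreePart n : ℝ) ^ (-(17 / 16) : ℝ) * (sqrtPart n : ℝ) ^ (-(9 / 8) : ℝ))),
    tsum_nonneg fun n => by positivity, fun δ hδ hδ1 T hT => ?_⟩
  calc _ ≤ ∑ n ∈ T, δ * ((repCount n : ℝ) ^ 2 * (n : ℝ) ^ (-(5 / 4) : ℝ) +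
          C * ((sqfreePart n : ℝ) ^ (-(17 / 16) : ℝ) * (sqrtPart n : ℝ) ^ (-(9 / 8) : ℝ))) := by
          refine Finset.sum_le_sum fun n hn => ?_
          obtain ⟨hn0, hn1⟩ := hT n hn
          have p1 : 0 ≤ δ * ((repCount n : ℝ) ^ 2 * (n : ℝ) ^ (-(5 / 4) : ℝ)) := by positivity
          have p2 : 0 ≤ C * δ * ((sqfreePart n : ℝ) ^ (-(17 / 16) : ℝ) *
            (sqrtPart n : ℝ) ^ (-(9 / 8) : ℝ)) := by positivity
          by_cases hq : (sqfreePart n : ℝ) ≤ δ⁻¹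
          · linarith [hC δ hδ hδ1 n hn0 hq]
          · have : δ⁻¹ ^ 4 < n := by
              refine Nat.lt_of_floor_lt (not_le.1 fun h => hn1 ?_)
              rw [mainIndex, Finset.mem_filter, Finset.mem_Ioc]
              exact ⟨⟨hn0, h⟩, not_le.1 hq⟩
            linarith [annulusCoeff_sq_le_of_lt hδ this]
      _ ≤ _ := by
          rw [← Finset.mul_sum, mul_comm]
          exact mul_le_mul_of_nonneg_right (hS.sum_le_tsum T fun n _ => by positivity) hδ.le

theorem sq_smoothCoeff_sub_annulusCoeff_le {X : ℝ} (hX : 0 < X) (u : ℝ) (n : ℕ) :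
    (smoothCoeff X u n - annulusCoeff u n) ^ 2 ≤
      π ^ 4 * X ^ (-(5 / 2) : ℝ) * n ^ 2 * annulusCoeff u n ^ 2 := by
  rcases Nat.eq_zero_or_pos n with rfl | hn
  · simp [smoothCoeff, annulusCoeff]
  have hn' : (0 : ℝ) < n := by exact_mod_cast hn
  have hh : 0 < X ^ (-(5 / 8) : ℝ) := rpow_pos_of_pos hX _
  have e : (n : ℝ) ^ (-(3 / 4) : ℝ) = (n : ℝ) ^ (-(5 / 4) : ℝ) * √n := by
    rw [sqrt_eq_rpow, ← rpow_add hn']; norm_num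
  have e4 : X ^ (-(5 / 2) : ℝ) = (X ^ (-(5 / 8) : ℝ)) ^ 4 := by
    rw [← rpow_natCast, ← rpow_mul hX.le]; norm_num
  rw [smoothCoeff, annulusCoeff, e, e4]
  set h := X ^ (-(5 / 8) : ℝ)
  have hy : 0 < π * h * √n := by positivity
  have hs : |sin (π * h * √n) - π * h * √n| ≤ (π * h * √n) ^ 3 := by
    have h1 := sin_gt_sub_cube hy
    have h2 := sin_lt hy
    have h3 : 0 < (π * h * √n) ^ 3 := by positivity
    rw [abs_le]; constructor <;> linarith
  have hs2 := sq_le_sq' (neg_le_of_abs_le hs) (le_of_abs_le hs)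
  have hnn : √n ^ 4 = (n : ℝ) ^ 2 := by
    rw [show √(n : ℝ) ^ 4 = (√n ^ 2) ^ 2 by ring, sq_sqrt hn'.le]
  set R := (repCount n : ℝ) * ((n : ℝ) ^ (-(5 / 4) : ℝ) * sin (π * u * √n)) with hR
  calc _ = (2 / (π ^ 2 * h) * R) ^ 2 * (sin (π * h * √n) - π * h * √n) ^ 2 := by
        rw [hR, ← mul_pow]; field_simp
    _ ≤ (2 / (π ^ 2 * h) * R) ^ 2 * ((π * h * √n) ^ 3) ^ 2 := by gcongr
    _ = _ := by rw [← hnn, hR]; field_simp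

theorem exists_sum_sq_smoothCoeff_sub_le : ∃ C : ℝ, 0 ≤ C ∧ ∀ X δ : ℝ, 1 ≤ X →
    X ^ (-(1 / 16) : ℝ) ≤ δ → δ ≤ 1 → ∀ M : ℕ,
    ∑ n ∈ Finset.Ioc 0 M,
        (smoothCoeff X δ n - if n ∈ mainIndex δ then annulusCoeff δ n else 0) ^ 2 *
      (1 + n * X ^ (-(13 / 8) : ℝ)) ≤ C * δ := by
  obtain ⟨C, hC0, hC⟩ := exists_sum_annulusCoeff_sq_le
  have hT := summable_repCount_sq_rpow (s := 3 / 2) (by norm_num)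
  have hT0 : 0 ≤ ∑' n, (repCount n : ℝ) ^ 2 * (n : ℝ) ^ (-(3 / 2) : ℝ) :=
    tsum_nonneg fun n => by positivity
  refine ⟨C + (1 + 2 * π ^ 4) * ∑' n, (repCount n : ℝ) ^ 2 * (n : ℝ) ^ (-(3 / 2) : ℝ),
    by positivity, fun X δ hX hXδ hδ1 M => ?_⟩
  have hX0 : 0 < X := by linarith
  have hδ : 0 < δ := (rpow_pos_of_pos hX0 _).trans_le hXδ
  have hexp : ∀ s : ℝ, s ≤ -(1 / 16) → X ^ s ≤ δ := fun s hs =>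
    (rpow_le_rpow_of_exponent_le hX hs).trans hXδ
  have hpt : ∀ n ∈ Finset.Ioc 0 M,
      (smoothCoeff X δ n - if n ∈ mainIndex δ then annulusCoeff δ n else 0) ^ 2 *
        (1 + n * X ^ (-(13 / 8) : ℝ)) ≤ (if n ∈ mainIndex δ then 0 else annulusCoeff δ n ^ 2) +
        (1 + 2 * π ^ 4) * δ * ((repCount n : ℝ) ^ 2 * (n : ℝ) ^ (-(3 / 2) : ℝ)) := by
    intro n hn
    have hn0 := (Finset.mem_Ioc.1 hn).1
    have hR : 0 ≤ (repCount n : ℝ) ^ 2 * (n : ℝ) ^ (-(3 / 2) : ℝ) := by positivity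
    have hp4 : 0 ≤ 2 * π ^ 4 * δ * ((repCount n : ℝ) ^ 2 * (n : ℝ) ^ (-(3 / 2) : ℝ)) :=
        by positivity
    split_ifs with hS
    · have hnX : (n : ℝ) ≤ X ^ (1 / 4 : ℝ) := by
        have h1 : (n : ℝ) ≤ δ⁻¹ ^ 4 := (Nat.le_floor_iff (by positivity)).1
          (Finset.mem_Ioc.1 (Finset.mem_filter.1 hS).1).2
        refine h1.trans ?_
        calc δ⁻¹ ^ 4 ≤ (X ^ (-(1 / 16) : ℝ))⁻¹ ^ 4 := by gcongr
          _ = _ := by rw [← rpow_neg hX0.le, ← rpow_natCast, ← rpow_mul hX0.le]; norm_num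
      have hw : 1 + n * X ^ (-(13 / 8) : ℝ) ≤ 2 := by
        have : n * X ^ (-(13 / 8) : ℝ) ≤ X ^ (1 / 4 : ℝ) * X ^ (-(13 / 8) : ℝ) := by gcongr
        rw [← rpow_add hX0] at this
        linarith [hexp (1 / 4 + -(13 / 8)) (by norm_num)]
      have hn2 : X ^ (-(5 / 2) : ℝ) * n ^ 2 ≤ δ := by
        calc X ^ (-(5 / 2) : ℝ) * n ^ 2 ≤ X ^ (-(5 / 2) : ℝ) * (X ^ (1 / 4 : ℝ)) ^ 2 := by gcongr
          _ = X ^ (-2 : ℝ) := by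
              rw [← rpow_natCast, ← rpow_mul hX0.le, ← rpow_add hX0]; norm_num
          _ ≤ δ := hexp _ (by norm_num)
      calc _ ≤ π ^ 4 * X ^ (-(5 / 2) : ℝ) * n ^ 2 * annulusCoeff δ n ^ 2 * 2 := by
            gcongr; exact sq_smoothCoeff_sub_annulusCoeff_le hX0 δ n
        _ = π ^ 4 * (X ^ (-(5 / 2) : ℝ) * n ^ 2) * annulusCoeff δ n ^ 2 * 2 := by ring
        _ ≤ π ^ 4 * δ * ((repCount n : ℝ) ^ 2 * (n : ℝ) ^ (-(3 / 2) : ℝ)) * 2 := by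
            gcongr; exact annulusCoeff_sq_le' δ n
        _ ≤ _ := by linarith [mul_nonneg hδ.le hR]
    · have h1 := natCast_mul_smoothCoeff_sq_le hX0 (u := δ) hn0
      have h2 := sq_le_sq.2 (abs_smoothCoeff_le hX0 n (u := δ))
      have h3 := mul_le_mul_of_nonneg_right (hexp (-(3 / 8)) (by norm_num)) hR
      rw [sub_zero]
      linarith
  refine (Finset.sum_le_sum hpt).trans ?_
  rw [Finset.sum_add_distrib, ← Finset.mul_sum, Finset.sum_ite, Finset.sum_const_zero, zero_add,
    add_mul C]
  refine add_le_add (hC δ hδ hδ1 _ fun n hn => ?_) ?_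
  · rw [Finset.mem_filter, Finset.mem_Ioc] at hn
    exact ⟨hn.1.1, hn.2⟩
  · rw [mul_right_comm]
    gcongr
    exact hT.sum_le_tsum _ fun n _ => by positivity

/-- The trigonometric sum that models `annulusDev δ x` for `x` between `X` and `2 * X`. -/
noncomputable def mainSum (X δ x : ℝ) : ℝ :=
  phaseSum (mainIndex δ) sqfreePart sqrtPart (annulusCoeff δ)
    (fun n => π * (X ^ (-(5 / 8) : ℝ) + δ) * √n - π / 4) (fun r => √r * x)

theorem mainSum_eq_sum (X δ x : ℝ) : mainSum X δ x = ∑ n ∈ mainIndex δ, annulusCoeff δ n *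
    cos (2 * π * (√n * x) + (π * (X ^ (-(5 / 8) : ℝ) + δ) * √n - π / 4)) := by
  rw [mainSum, phaseSum]
  refine Finset.sum_congr rfl fun n _ => ?_
  rw [← mul_assoc (sqrtPart n : ℝ), ← sqrt_natCast_eq]

theorem smoothGap_add_eq_sum (X u x : ℝ) : smoothGap X (x + u) = ∑ n ∈ Finset.Ioc 0 ⌊X ^ 3⌋₊,
    smoothCoeff X (X ^ (-(5 / 8) : ℝ)) n * cos (2 * π * (√n * x) + (2 * π * u * √n - π / 4)) := by
  have h := smoothSum_add_sub X (x + u - X ^ (-(5 / 8) : ℝ)) (X ^ (-(5 / 8) : ℝ))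
  rw [sub_add_cancel] at h
  rw [smoothGap, h]
  refine Finset.sum_congr rfl fun n _ => ?_
  rw [smoothCoeff]
  congr 2
  ring

theorem mainIndex_subset {δ Y : ℝ} (hδ : δ⁻¹ ^ 4 ≤ Y) :
    mainIndex δ ⊆ Finset.Ioc 0 ⌊Y⌋₊ :=
  (Finset.filter_subset _ _).trans (Finset.Ioc_subset_Ioc_right (Nat.floor_mono hδ))

theorem smoothSum_add_sub_sub_mainSum {X δ : ℝ} (hδ : δ⁻¹ ^ 4 ≤ X ^ 3) (x : ℝ) :
    smoothSum X (x + δ) - smoothSum X x - mainSum X δ x = ∑ n ∈ Finset.Ioc 0 ⌊X ^ 3⌋₊,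
      (smoothCoeff X δ n - if n ∈ mainIndex δ then annulusCoeff δ n else 0) *
        cos (2 * π * (√n * x) + (π * (X ^ (-(5 / 8) : ℝ) + δ) * √n - π / 4)) := by
  simp only [sub_mul (smoothCoeff _ _ _), Finset.sum_sub_distrib, ite_mul, zero_mul]
  rw [smoothSum_add_sub, mainSum_eq_sum, Finset.sum_ite_mem,
    Finset.inter_eq_right.2 (mainIndex_subset hδ)]
  rfl

theorem dyadicMean_const_add_mul {X : ℝ} (hX : 0 < X) (c k : ℝ) {f : ℝ → ℝ} (hf : Continuous f) :
    dyadicMean X (fun x => c + k * f x) = c + k * dyadicMean X f := by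
  have hkf : Continuous fun x => k * f x := continuous_const.mul hf
  simp only [dyadicMean, smul_eq_mul]
  rw [intervalIntegral.integral_add (by simp) (hkf.intervalIntegrable _ _),
      intervalIntegral.integral_const_mul,
    intervalIntegral.integral_const, smul_eq_mul]
  field_simp
  ring

theorem dyadicMean_add (X : ℝ) {f g : ℝ → ℝ} (hf : Continuous f) (hg : Continuous g) :
    dyadicMean X (fun x => f x + g x) = dyadicMean X f + dyadicMean X g := by
  simp only [dyadicMean, smul_eq_mul]
  rw [intervalIntegral.integral_add (hf.intervalIntegrable _ _) (hg.intervalIntegrable _ _),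
      mul_add]

theorem exists_abs_annulusDev_sub_mainSum_le : ∃ C : ℝ, 0 ≤ C ∧ ∀ X δ : ℝ, 2 ≤ X →
    X ^ (-(1 / 16) : ℝ) ≤ δ → δ ≤ 1 → ∃ g : ℝ → ℝ, Continuous g ∧
      (∀ x, X ≤ x → x ≤ 2 * X → |annulusDev δ x - mainSum X δ x| ≤ g x) ∧
      dyadicMean X g ≤ C * √δ := by
  obtain ⟨C₁, hC₁, h₁⟩ := exists_abs_annulusDev_sub_le
  obtain ⟨C₂, hC₂, h₂⟩ := exists_dyadicMean_sq_le
  obtain ⟨C₃, hC₃, h₃⟩ := exists_sum_sq_smoothCoeff_sub_le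
  obtain ⟨C₄, hC₄, h₄⟩ := exists_sum_smoothCoeff_self_le
  refine ⟨3 / 2 + C₁ + (C₂ * C₃ + 2 * (C₂ * C₄)) / 2, by positivity, fun X δ hX hXδ hδ1 => ?_⟩
  have hX0 : 0 < X := by linarith
  have hX1 : 1 ≤ X := by linarith
  have hδ : 0 < δ := (rpow_pos_of_pos hX0 _).trans_le hXδ
  have hδX : δ⁻¹ ^ 4 ≤ X ^ 3 := by
    calc δ⁻¹ ^ 4 ≤ (X ^ (-(1 / 16) : ℝ))⁻¹ ^ 4 := by gcongr
      _ = X ^ (1 / 4 : ℝ) := by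
          rw [← rpow_neg hX0.le, ← rpow_natCast, ← rpow_mul hX0.le]; norm_num
      _ ≤ X ^ (3 : ℝ) := rpow_le_rpow_of_exponent_le hX1 (by norm_num)
      _ = X ^ 3 := by norm_cast
  have hM : ((⌊X ^ 3⌋₊ : ℕ) : ℝ) ≤ X ^ 3 := Nat.floor_le (by positivity)
  have hs : 0 < √δ := sqrt_pos.2 hδ
  have hss : √δ * √δ = δ := mul_self_sqrt hδ.le
  have hs1 : √δ ≤ 1 := sqrt_le_one.2 hδ1
  have hδs : δ ≤ √δ := by nlinarith
  have hcont : ∀ a φ : ℕ → ℝ, Continuous fun x => (∑ n ∈ Finset.Ioc 0 ⌊X ^ 3⌋₊,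
      a n * cos (2 * π * (√n * x) + φ n)) ^ 2 := fun a φ => by fun_prop
  set z := smoothCoeff X (X ^ (-(5 / 8) : ℝ))
  set V : ℝ → ℝ := fun x => (∑ n ∈ Finset.Ioc 0 ⌊X ^ 3⌋₊,
    (smoothCoeff X δ n - if n ∈ mainIndex δ then annulusCoeff δ n else 0) *
      cos (2 * π * (√n * x) + (π * (X ^ (-(5 / 8) : ℝ) + δ) * √n - π / 4))) ^ 2
  set Z : ℝ → ℝ → ℝ := fun u x => (∑ n ∈ Finset.Ioc 0 ⌊X ^ 3⌋₊,
    z n * cos (2 * π * (√n * x) + (2 * π * u * √n - π / 4))) ^ 2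
  have hVc : Continuous V := hcont _ _
  have hZc : ∀ u, Continuous (Z u) := fun u => hcont _ _
  have hV : dyadicMean X V ≤ C₂ * C₃ * δ := by
    refine (h₂ X hX1 _ hM _ _).trans ?_
    rw [mul_assoc]
    exact mul_le_mul_of_nonneg_left (h₃ X δ hX1 hXδ hδ1 _) hC₂
  have hZ : ∀ u, dyadicMean X (Z u) ≤ C₂ * C₄ * δ := fun u => by
    refine (h₂ X hX1 _ hM _ _).trans ?_
    rw [mul_assoc]
    refine mul_le_mul_of_nonneg_left ((h₄ X hX1 _).trans ?_) hC₂
    exact mul_le_mul_of_nonneg_left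
      ((rpow_le_rpow_of_exponent_le hX1 (by norm_num)).trans hXδ) hC₄
  have hamgm : ∀ v : ℝ, |v| ≤ √δ / 2 + 1 / (2 * √δ) * v ^ 2 := fun v => by
    have h : 0 ≤ 1 / (2 * √δ) * (|v| - √δ) ^ 2 := by positivity
    have e : 1 / (2 * √δ) * (|v| - √δ) ^ 2 = √δ / 2 + 1 / (2 * √δ) * v ^ 2 - |v| := by
      rw [← sq_abs v]; field_simp; ring
    linarith
  refine ⟨fun x => (3 / 2 * √δ + C₁ * X ^ (-(1 / 16) : ℝ)) + 1 / (2 * √δ) * (V x + (Z 0 x + Z δ x)),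
    by fun_prop, fun x hx1 hx2 => ?_, ?_⟩
  · have k := h₁ X δ x hX hδ.le hδ1 hx1 hx2
    have k1 := hamgm (smoothSum X (x + δ) - smoothSum X x - mainSum X δ x)
    have k2 := hamgm (smoothGap X (x + 0))
    have k3 := hamgm (smoothGap X (x + δ))
    rw [smoothGap_add_eq_sum] at k2 k3
    rw [smoothSum_add_sub_sub_mainSum hδX] at k1
    rw [← add_zero x, add_assoc, zero_add, smoothGap_add_eq_sum, smoothGap_add_eq_sum,
        add_zero] at k
    have k4 := abs_sub_le (annulusDev δ x) (smoothSum X (x + δ) - smoothSum X x) (mainSum X δ x)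
    rw [smoothSum_add_sub_sub_mainSum hδX] at k4
    simp only [V, Z]
    linarith
  · have hZZ : Continuous fun x => Z 0 x + Z δ x := (hZc 0).add (hZc δ)
    have hVZ : Continuous fun x => V x + (Z 0 x + Z δ x) := hVc.add hZZ
    rw [dyadicMean_const_add_mul hX0 _ _ hVZ, dyadicMean_add X hVc hZZ,
        dyadicMean_add X (hZc 0) (hZc δ)]
    have e1 : 1 / (2 * √δ) * (dyadicMean X V + (dyadicMean X (Z 0) + dyadicMean X (Z δ))) ≤
        1 / (2 * √δ) * ((C₂ * C₃ + 2 * (C₂ * C₄)) * (√δ * √δ)) := by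
      rw [hss]
      gcongr
      linarith [hV, hZ 0, hZ δ]
    have e2 : 1 / (2 * √δ) * ((C₂ * C₃ + 2 * (C₂ * C₄)) * (√δ * √δ)) =
        (C₂ * C₃ + 2 * (C₂ * C₄)) / 2 * √δ := by field_simp
    have e3 : C₁ * X ^ (-(1 / 16) : ℝ) ≤ C₁ * √δ :=
      mul_le_mul_of_nonneg_left (hXδ.trans hδs) hC₁
    linarith

theorem exists_abs_annulusCoeff_le : ∃ C : ℝ, 0 ≤ C ∧ ∀ δ : ℝ, ∀ n : ℕ, 0 < n →
    |annulusCoeff δ n| ≤ C * (n : ℝ) ^ (-(5 / 8) : ℝ) := by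
  obtain ⟨C, hC0, hC⟩ := exists_repCount_le (ε := 1 / 8) (by norm_num)
  refine ⟨C, hC0.le, fun δ n hn => ?_⟩
  have hn0 : (0 : ℝ) < n := by exact_mod_cast hn
  refine abs_le_of_sq_le_sq ?_ (by positivity)
  calc annulusCoeff δ n ^ 2 ≤ _ := annulusCoeff_sq_le' δ n
    _ ≤ (C * (n : ℝ) ^ (1 / 8 : ℝ)) ^ 2 * (n : ℝ) ^ (-(3 / 2) : ℝ) := by gcongr; exact hC n hn
    _ = C ^ 2 * ((n : ℝ) ^ (1 / 4 : ℝ) * (n : ℝ) ^ (-(3 / 2) : ℝ)) := by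
        rw [mul_pow, ← rpow_natCast (_ ^ _) 2, ← rpow_mul hn0.le]; norm_num; ring
    _ = _ := by
        rw [mul_pow, ← rpow_natCast (_ ^ _) 2, ← rpow_mul hn0.le, ← rpow_add hn0]; norm_num

theorem exists_sum_abs_annulusCoeff_le : ∃ C : ℝ, 0 ≤ C ∧ ∀ δ : ℝ, 0 < δ →
    ∑ n ∈ mainIndex δ, |annulusCoeff δ n| ≤ C * δ⁻¹ ^ 4 := by
  obtain ⟨C, hC0, hC⟩ := exists_abs_annulusCoeff_le
  refine ⟨C, hC0, fun δ hδ => ?_⟩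
  calc _ ≤ ∑ n ∈ Finset.Ioc 0 ⌊δ⁻¹ ^ 4⌋₊, |annulusCoeff δ n| :=
        Finset.sum_le_sum_of_subset_of_nonneg (Finset.filter_subset _ _) fun n _ _ => abs_nonneg _
    _ ≤ ∑ n ∈ Finset.Ioc 0 ⌊δ⁻¹ ^ 4⌋₊, C := by
        refine Finset.sum_le_sum fun n hn => ?_
        have hn := (Finset.mem_Ioc.1 hn).1
        refine (hC δ n hn).trans (mul_le_of_le_one_right hC0 ?_)
        exact rpow_le_one_of_one_le_of_nonpos (by exact_mod_cast hn) (by norm_num)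
    _ = C * ⌊δ⁻¹ ^ 4⌋₊ := by simp [mul_comm]
    _ ≤ _ := by gcongr; exact Nat.floor_le (by positivity)

/-- Each block of commensurable frequencies is small. -/
theorem exists_sum_abs_annulusCoeff_block_le : ∃ C : ℝ, 0 ≤ C ∧ ∀ δ : ℝ, 0 < δ → ∀ r : ℕ,
    ∑ n ∈ mainIndex δ with sqfreePart n = r, |annulusCoeff δ n| ≤ C * δ ^ (5 / 8 : ℝ) := by
  obtain ⟨C, hC0, hC⟩ := exists_abs_annulusCoeff_le
  have hS := Real.summable_nat_rpow.2 (by norm_num : (-(5 / 4) : ℝ) < -1)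
  have hS0 : 0 ≤ ∑' n : ℕ, (n : ℝ) ^ (-(5 / 4) : ℝ) := tsum_nonneg fun n => by positivity
  refine ⟨C * ∑' n : ℕ, (n : ℝ) ^ (-(5 / 4) : ℝ), by positivity, fun δ hδ r => ?_⟩
  calc _ ≤ ∑ n ∈ mainIndex δ with sqfreePart n = r,
        C * δ ^ (5 / 8 : ℝ) * (sqrtPart n : ℝ) ^ (-(5 / 4) : ℝ) := by
        refine Finset.sum_le_sum fun n hn => ?_
        rw [Finset.mem_filter, mainIndex, Finset.mem_filter, Finset.mem_Ioc] at hn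
        have hm0 : (0 : ℝ) < sqrtPart n := by exact_mod_cast sqrtPart_pos hn.1.1.1
        have e : (n : ℝ) ^ (-(5 / 8) : ℝ) =
            (sqfreePart n : ℝ) ^ (-(5 / 8) : ℝ) * (sqrtPart n : ℝ) ^ (-(5 / 4) : ℝ) := by
          conv_lhs => rw [← sqrtPart_sq_mul_sqfreePart n]
          push_cast
          rw [mul_rpow (by positivity) (by positivity), ← rpow_natCast, ← rpow_mul hm0.le, mul_comm]
          norm_num
        have hq : (sqfreePart n : ℝ) ^ (-(5 / 8) : ℝ) ≤ δ ^ (5 / 8 : ℝ) := by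
          refine (rpow_le_rpow_of_nonpos (by positivity) hn.1.2.le (by norm_num)).trans_eq ?_
          rw [inv_rpow hδ.le, ← rpow_neg hδ.le, neg_neg]
        refine (hC δ n hn.1.1.1).trans ?_
        rw [e, mul_assoc]
        gcongr
    _ = C * δ ^ (5 / 8 : ℝ) * ∑ k ∈ ((mainIndex δ).filter fun n => sqfreePart n = r).image sqrtPart,
        (k : ℝ) ^ (-(5 / 4) : ℝ) := by
        rw [← Finset.mul_sum, Finset.sum_image]
        intro i hi j hj hij
        rw [Finset.mem_coe, Finset.mem_filter] at hi hj
        exact eq_of_sqfreePart_eq_of_sqrtPart_eq (hi.2.trans hj.2.symm) hij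
    _ ≤ C * δ ^ (5 / 8 : ℝ) * ∑' n : ℕ, (n : ℝ) ^ (-(5 / 4) : ℝ) := by
        gcongr
        exact hS.sum_le_tsum _ fun n _ => by positivity
    _ = _ := by ring

theorem exists_abs_sum_annulusCoeff_sq_sub_le : ∃ C : ℝ, 0 ≤ C ∧ ∀ δ : ℝ, 0 < δ → δ ≤ 1 →
    |4 / π ^ 2 * annulusSq δ - ∑ n ∈ mainIndex δ, annulusCoeff δ n ^ 2| ≤ C * δ := by
  obtain ⟨C, hC0, hC⟩ := exists_sum_annulusCoeff_sq_le
  refine ⟨C, hC0, fun δ hδ hδ1 => ?_⟩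
  have hs : HasSum (fun n => annulusCoeff δ n ^ 2) (4 / π ^ 2 * annulusSq δ) := by
    simp only [annulusCoeff_sq]
    exact (summable_annulusSq δ).hasSum.mul_left _
  have h0 : annulusCoeff δ 0 ^ 2 = 0 := by simp [annulusCoeff]
  have hbound : ∀ T : Finset ℕ, ∑ n ∈ T, annulusCoeff δ n ^ 2 ≤
      ∑ n ∈ mainIndex δ, annulusCoeff δ n ^ 2 + C * δ := fun T => by
    have hU := hC δ hδ hδ1 ((T \ mainIndex δ).erase 0) fun n hn => by
      rw [Finset.mem_erase, Finset.mem_sdiff] at hn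
      exact ⟨Nat.pos_of_ne_zero hn.1, hn.2.2⟩
    rw [Finset.sum_erase (f := fun n => annulusCoeff δ n ^ 2) _ h0] at hU
    calc _ ≤ ∑ n ∈ mainIndex δ ∪ (T \ mainIndex δ), annulusCoeff δ n ^ 2 :=
          Finset.sum_le_sum_of_subset_of_nonneg
            (by rw [Finset.union_sdiff_self_eq_union]; exact Finset.subset_union_right)
            fun n _ _ => sq_nonneg _
      _ = _ := Finset.sum_union Finset.disjoint_sdiff
      _ ≤ _ := by gcongr
  have h1 : ∑ n ∈ mainIndex δ, annulusCoeff δ n ^ 2 ≤ 4 / π ^ 2 * annulusSq δ :=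
    sum_le_hasSum _ (fun n _ => sq_nonneg _) hs
  have h2 : 4 / π ^ 2 * annulusSq δ ≤ ∑ n ∈ mainIndex δ, annulusCoeff δ n ^ 2 + C * δ :=
    hasSum_le_of_sum_le hs hbound
  rw [abs_of_nonneg (by linarith)]
  linarith

/-- The normalising factor of the central limit theorem. -/
noncomputable def annulusScale (δ : ℝ) : ℝ := 4 * √(δ * log (1 / δ))

theorem one_le_log_one_div {δ : ℝ} (hδ : 0 < δ) (h : δ ≤ exp (-1)) : 1 ≤ log (1 / δ) := by
  rw [one_div, log_inv]
  have := log_le_log hδ h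
  rw [log_exp] at this
  linarith

theorem sqrt_le_annulusScale {δ : ℝ} (hδ : 0 < δ) (h : δ ≤ exp (-1)) : √δ ≤ annulusScale δ := by
  rw [annulusScale]
  have := sqrt_le_sqrt (le_mul_of_one_le_right hδ.le (one_le_log_one_div hδ h))
  have := sqrt_nonneg (δ * log (1 / δ))
  linarith

theorem tendsto_log_one_div : Tendsto (fun δ : ℝ => log (1 / δ)) (𝓝[>] 0) atTop := by
  simp only [one_div]
  exact tendsto_log_atTop.comp tendsto_inv_nhdsGT_zero

theorem tendsto_sum_annulusCoeff_sq : Tendsto (fun δ : ℝ => ∑ n ∈ mainIndex δ,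
    (annulusCoeff δ n / annulusScale δ) ^ 2 / 2) (𝓝[>] 0) (𝓝 1) := by
  obtain ⟨C, hC0, hC⟩ := exists_abs_sum_annulusCoeff_sq_sub_le
  have h1 : Tendsto (fun δ => 1 / (8 * π ^ 2) * (annulusSq δ / (δ * log (1 / δ))))
      (𝓝[>] 0) (𝓝 1) := by
    convert! tendsto_annulusSq_div.const_mul (1 / (8 * π ^ 2)) using 2
    field_simp
  have hsmall : ∀ᶠ δ : ℝ in 𝓝[>] 0, δ ≤ exp (-1) :=
    nhdsWithin_le_nhds (Iic_mem_nhds (exp_pos _))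
  have h2 : Tendsto (fun δ : ℝ => C / 32 * (log (1 / δ))⁻¹) (𝓝[>] 0) (𝓝 0) := by
    simpa using tendsto_log_one_div.inv_tendsto_atTop.const_mul (C / 32)
  have h3 : Tendsto (fun δ : ℝ => 1 / (8 * π ^ 2) * (annulusSq δ / (δ * log (1 / δ))) -
      ∑ n ∈ mainIndex δ, (annulusCoeff δ n / annulusScale δ) ^ 2 / 2) (𝓝[>] 0) (𝓝 0) := by
    refine squeeze_zero_norm' ?_ h2
    filter_upwards [hsmall, self_mem_nhdsWithin] with δ hδ1 hδ
    have hδ : 0 < δ := hδ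
    have hL := one_le_log_one_div hδ hδ1
    have hc := hC δ hδ (hδ1.trans (exp_le_one_iff.2 (by norm_num)))
    set L := log (1 / δ)
    have hL0 : 0 < L := by linarith
    have e : 1 / (8 * π ^ 2) * (annulusSq δ / (δ * L)) -
        ∑ n ∈ mainIndex δ, (annulusCoeff δ n / annulusScale δ) ^ 2 / 2 =
        (4 / π ^ 2 * annulusSq δ - ∑ n ∈ mainIndex δ, annulusCoeff δ n ^ 2) / (32 * (δ * L)) := by
      have : annulusScale δ ^ 2 = 16 * (δ * L) := by
        rw [annulusScale, mul_pow, sq_sqrt (by positivity), show (4 : ℝ) ^ 2 = 16 by norm_num]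
      simp only [div_pow, this]
      rw [← Finset.sum_div, ← Finset.sum_div]
      field_simp
      ring
    rw [e, Real.norm_eq_abs, abs_div, abs_of_pos (by positivity : 0 < 32 * (δ * L)),
      div_le_iff₀ (by positivity)]
    refine hc.trans_eq ?_
    field_simp
  simpa using h1.sub h3

theorem eventually_rpow_le_of_tendsto {δ : ℝ → ℝ} (hδpos : ∀ X, 0 < δ X)
    (hδX : Tendsto (fun X : ℝ => log (1 / δ X) / log X) atTop (𝓝 0)) {ε : ℝ} (hε : 0 < ε) :
    ∀ᶠ X in atTop, X ^ (-ε) ≤ δ X := by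
  filter_upwards [hδX.eventually (gt_mem_nhds hε), eventually_gt_atTop 1] with X h hX
  have hX0 : 0 < X := by linarith
  rw [div_lt_iff₀ (log_pos hX), one_div, log_inv] at h
  rw [← log_le_log_iff (rpow_pos_of_pos hX0 _) (hδpos X), log_rpow hX0]
  linarith

open Complex in
theorem tendsto_dyadicMean_cexp_mainSum {δ : ℝ → ℝ} (hδpos : ∀ X, 0 < δ X)
    (hδ : Tendsto δ atTop (𝓝 0))
    (hδX : Tendsto (fun X : ℝ => Real.log (1 / δ X) / Real.log X) atTop (𝓝 0)) (ξ : ℝ) :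
    Tendsto (fun X => dyadicMean X fun x =>
      cexp (I * (ξ * (mainSum X (δ X) x / annulusScale (δ X)) : ℝ))) atTop
      (𝓝 (Real.exp (-(ξ ^ 2 / 2)) : ℂ)) := by
  obtain ⟨C₁, hC₁, h₁⟩ := exists_sum_abs_annulusCoeff_le
  obtain ⟨C₂, hC₂, h₂⟩ := exists_sum_abs_annulusCoeff_block_le
  have hδ' : Tendsto δ atTop (𝓝[>] 0) :=
    tendsto_nhdsWithin_iff.2 ⟨hδ, Eventually.of_forall hδpos⟩
  have hsmall : ∀ᶠ X in atTop, δ X ≤ Real.exp (-1) :=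
    hδ.eventually (Iic_mem_nhds (Real.exp_pos _))
  have hone : ∀ᶠ X in atTop, 1 ≤ (δ X)⁻¹ := by
    filter_upwards [hsmall] with X hX
    exact (one_le_inv₀ (hδpos X)).2 (hX.trans (Real.exp_le_one_iff.2 (by norm_num)))
  have hscale : ∀ᶠ X in atTop, √(δ X) ≤ annulusScale (δ X) := by
    filter_upwards [hsmall] with X hX using sqrt_le_annulusScale (hδpos X) hX
  have habs : ∀ X, √(δ X) ≤ annulusScale (δ X) → ∀ T : Finset ℕ,
      ∑ n ∈ T, |annulusCoeff (δ X) n / annulusScale (δ X)| ≤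
        (∑ n ∈ T, |annulusCoeff (δ X) n|) / √(δ X) := fun X hX T => by
    have hs := Real.sqrt_pos.2 (hδpos X)
    simp only [abs_div, abs_of_pos (hs.trans_le hX)]
    rw [← Finset.sum_div]
    gcongr
  have key := tendsto_dyadicMean_cexp_phaseSum (ι := ℕ) (S := fun X => mainIndex (δ X))
    (q := sqfreePart) (m := sqrtPart)
    (a := fun X n => annulusCoeff (δ X) n / annulusScale (δ X))
    (φ := fun X n => π * (X ^ (-(5 / 8) : ℝ) + δ X) * √n - π / 4)
    (Y := fun X => (C₁ + 1) * (δ X)⁻¹ ^ 5) (b := fun X => C₂ * δ X ^ (1 / 8 : ℝ))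
    (Eventually.of_forall fun X i _ => squarefree_sqfreePart i) ?_
    (fun i j => eq_of_sqfreePart_eq_of_sqrtPart_eq) ?_ ?_ ?_ ?_
    (tendsto_sum_annulusCoeff_sq.comp hδ') ?_ ?_ ξ
  · refine key.congr fun X => ?_
    congr 1
    ext x
    rw [mainSum, phaseSum, phaseSum, Finset.sum_div]
    simp only [mul_div_right_comm]
  · refine Eventually.of_forall fun X i hi => (sqrtPart_pos ?_).ne'
    exact (Finset.mem_Ioc.1 (Finset.mem_filter.1 hi).1).1
  · filter_upwards [hone] with X hX
    have := one_le_pow₀ hX (n := 5)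
    nlinarith
  · filter_upwards [hone] with X hX i hi
    rw [← sqrt_natCast_eq]
    have hi := (Nat.le_floor_iff (by positivity)).1 (Finset.mem_Ioc.1 (Finset.mem_filter.1 hi).1).2
    calc √(i : ℝ) ≤ √((δ X)⁻¹ ^ 4) := Real.sqrt_le_sqrt hi
      _ = (δ X)⁻¹ ^ 2 := by
          rw [show (δ X)⁻¹ ^ 4 = ((δ X)⁻¹ ^ 2) ^ 2 by ring, Real.sqrt_sq (by positivity)]
      _ ≤ 1 * (δ X)⁻¹ ^ 5 := by rw [one_mul]; exact pow_le_pow_right₀ hX (by norm_num)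
      _ ≤ _ := by gcongr; linarith
  · filter_upwards [hone, hscale] with X hX hs
    have hd := hδpos X
    refine (habs X hs _).trans ?_
    rw [div_le_iff₀ (Real.sqrt_pos.2 hd)]
    refine (h₁ _ hd).trans ?_
    have e : 1 ≤ (δ X)⁻¹ * √(δ X) := by
      rw [inv_mul_eq_div, one_le_div hd]
      exact Real.le_sqrt_of_sq_le (by nlinarith [(one_le_inv₀ hd).1 hX])
    calc _ = C₁ * (δ X)⁻¹ ^ 4 * 1 := (mul_one _).symm
      _ ≤ (C₁ + 1) * (δ X)⁻¹ ^ 4 * ((δ X)⁻¹ * √(δ X)) := by gcongr; linarith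
      _ = _ := by ring
  · intro k
    have hε : (0 : ℝ) < 1 / (10 * (k + 1)) := by positivity
    have hlim : Tendsto (fun X : ℝ => (C₁ + 1) ^ k * X ^ (-(1 / 2) : ℝ)) atTop (𝓝 0) := by
      simpa using (tendsto_rpow_neg_atTop (by norm_num : (0 : ℝ) < 1 / 2)).const_mul ((C₁ + 1) ^ k)
    refine squeeze_zero' ?_ ?_ hlim
    · filter_upwards [eventually_gt_atTop 0] with X hX
      have := hδpos X
      positivity
    · filter_upwards [eventually_rpow_le_of_tendsto hδpos hδX hε, eventually_ge_atTop 1] with X h hX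
      have hX0 : 0 < X := by linarith
      have e : ((δ X)⁻¹ ^ 5) ^ k ≤ X ^ (1 / 2 : ℝ) := by
        rw [← pow_mul]
        calc (δ X)⁻¹ ^ (5 * k) ≤ (X ^ (-(1 / (10 * (k + 1))) : ℝ))⁻¹ ^ (5 * k) := by
              have := hδpos X
              gcongr
          _ = X ^ (1 / (10 * (k + 1)) * (5 * k : ℕ) : ℝ) := by
              rw [← rpow_neg hX0.le, ← rpow_natCast, ← rpow_mul hX0.le, neg_neg]
          _ ≤ _ := by
              refine rpow_le_rpow_of_exponent_le hX ?_
              rw [div_mul_eq_mul_div, div_le_div_iff₀ (by positivity) (by norm_num)]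
              push_cast
              linarith
      rw [mul_pow, div_le_iff₀ hX0, mul_assoc]
      gcongr
      refine e.trans_eq ?_
      rw [← rpow_add_one hX0.ne']
      norm_num
  · filter_upwards [hscale] with X hs r
    have hd := hδpos X
    refine (habs X hs _).trans ?_
    rw [div_le_iff₀ (Real.sqrt_pos.2 hd)]
    refine (h₂ _ hd r).trans_eq ?_
    rw [Real.sqrt_eq_rpow, mul_assoc, ← rpow_add hd]
    norm_num
  · have := (hδ.rpow_const (p := 1 / 8) (Or.inr (by norm_num))).const_mul C₂
    simpa using this

theorem measurable_latticeCount : Measurable latticeCount := by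
  have hmono : Monotone fun t : ℝ => latticeCount (max t 0) := fun s t hst =>
    latticeCount_mono (le_max_right _ _) (max_le_max_right 0 hst)
  have habs : latticeCount = fun t => latticeCount (max |t| 0) := by
    ext t
    rw [max_eq_left (abs_nonneg t), latticeCount, latticeCount, sq_abs]
  rw [habs]
  exact hmono.measurable.comp measurable_id.abs

theorem measurable_annulusDev (δ : ℝ) : Measurable (annulusDev δ) := by
  have h := measurable_latticeCount
  have h1 : Measurable fun x : ℝ => (latticeCount (x + δ) : ℝ) :=
    measurable_from_top.comp (h.comp (measurable_id.add_const δ))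
  have h2 : Measurable fun x : ℝ => (latticeCount x : ℝ) := measurable_from_top.comp h
  unfold annulusDev
  fun_prop

theorem continuous_mainSum (X δ : ℝ) : Continuous (mainSum X δ) := by
  rw [show mainSum X δ = _ from funext (mainSum_eq_sum X δ)]
  fun_prop

open Complex in
theorem norm_cexp_I_mul_sub_cexp_I_mul_le (a b : ℝ) :
    ‖cexp (I * (a : ℝ)) - cexp (I * (b : ℝ))‖ ≤ |a - b| := by
  have h : cexp (I * (a : ℝ)) - cexp (I * (b : ℝ)) =
      cexp (I * (b : ℝ)) * (cexp (I * (a - b : ℝ)) - 1) := by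
    rw [mul_sub, ← Complex.exp_add, mul_one]
    congr 2
    push_cast
    ring
  rw [h, norm_mul, Complex.norm_exp_I_mul_ofReal, one_mul]
  exact Real.norm_exp_I_mul_ofReal_sub_one_le

open Complex in
theorem norm_dyadicMean_cexp_sub_le {X : ℝ} (hX : 0 < X) {u v g : ℝ → ℝ} (hu : Measurable u)
    (hv : Measurable v) (hg : Continuous g)
    (h : ∀ x, X ≤ x → x ≤ 2 * X → |u x - v x| ≤ g x) :
    ‖(dyadicMean X fun x => cexp (I * (u x : ℝ))) - dyadicMean X fun x => cexp (I * (v x : ℝ))‖ ≤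
      dyadicMean X g := by
  have hintg : ∀ w : ℝ → ℝ, Measurable w →
      IntervalIntegrable (fun x => cexp (I * (w x : ℝ))) volume X (2 * X) := fun w hw => by
    refine (intervalIntegrable_const (c := (1 : ℝ))).mono_fun (by fun_prop)
      (Eventually.of_forall fun x => ?_)
    simp [Complex.norm_exp_I_mul_ofReal]
  rw [dyadicMean, dyadicMean, dyadicMean, ← smul_sub,
    ← intervalIntegral.integral_sub (hintg u hu) (hintg v hv), norm_smul,
    Real.norm_of_nonneg (by positivity), smul_eq_mul]
  gcongr
  refine intervalIntegral.norm_integral_le_of_norm_le (by linarith)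
    (Eventually.of_forall fun x hx => ?_) (hg.intervalIntegrable _ _)
  exact (norm_cexp_I_mul_sub_cexp_I_mul_le _ _).trans (h x hx.1.le hx.2)

open Complex in
theorem tendsto_dyadicMean_cexp_annulusDev {δ : ℝ → ℝ} (hδpos : ∀ X, 0 < δ X)
    (hδ : Tendsto δ atTop (𝓝 0))
    (hδX : Tendsto (fun X : ℝ => Real.log (1 / δ X) / Real.log X) atTop (𝓝 0)) (ξ : ℝ) :
    Tendsto (fun X => dyadicMean X fun x =>
      cexp (I * (ξ * (annulusDev (δ X) x / annulusScale (δ X)) : ℝ))) atTop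
      (𝓝 (Real.exp (-(ξ ^ 2 / 2)) : ℂ)) := by
  obtain ⟨C, hC, hdev⟩ := exists_abs_annulusDev_sub_mainSum_le
  have hδ' : Tendsto δ atTop (𝓝[>] 0) :=
    tendsto_nhdsWithin_iff.2 ⟨hδ, Eventually.of_forall hδpos⟩
  have hlim : Tendsto (fun X => |ξ| * C / 4 / √(Real.log (1 / δ X))) atTop (𝓝 0) :=
    tendsto_const_nhds.div_atTop
      (tendsto_sqrt_atTop.comp (tendsto_log_one_div.comp hδ'))
  have hsub : Tendsto (fun X => (dyadicMean X fun x =>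
      cexp (I * (ξ * (annulusDev (δ X) x / annulusScale (δ X)) : ℝ))) - dyadicMean X fun x =>
      cexp (I * (ξ * (mainSum X (δ X) x / annulusScale (δ X)) : ℝ))) atTop (𝓝 0) := by
    refine squeeze_zero_norm' ?_ hlim
    filter_upwards [eventually_ge_atTop 2, hδ.eventually (Iic_mem_nhds (Real.exp_pos (-1))),
      eventually_rpow_le_of_tendsto hδpos hδX (ε := 1 / 16) (by norm_num)] with X hX hs hr
    have hX0 : 0 < X := by linarith
    have hd := hδpos X
    obtain ⟨g, hgc, hgle, hgm⟩ := hdev X (δ X) hX hr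
      (hs.trans (Real.exp_le_one_iff.2 (by norm_num)))
    have hL := one_le_log_one_div hd hs
    have hA : 0 < annulusScale (δ X) :=
      (Real.sqrt_pos.2 hd).trans_le (sqrt_le_annulusScale hd hs)
    refine (norm_dyadicMean_cexp_sub_le hX0 (g := fun x => |ξ| / annulusScale (δ X) * g x)
      (((measurable_annulusDev _).div_const _).const_mul _)
      (((continuous_mainSum _ _).measurable.div_const _).const_mul _) (hgc.const_mul _)
      fun x hx hx' => ?_).trans ?_
    · rw [← mul_sub, ← sub_div, abs_mul, abs_div, abs_of_pos hA, div_mul_eq_mul_div, mul_div_assoc]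
      gcongr
      exact hgle x hx hx'
    · have hm : (dyadicMean X fun x => |ξ| / annulusScale (δ X) * g x) =
          |ξ| / annulusScale (δ X) * dyadicMean X g := by
        rw [dyadicMean, dyadicMean, intervalIntegral.integral_const_mul, mul_smul_comm]
      rw [hm]
      calc _ ≤ |ξ| / annulusScale (δ X) * (C * √(δ X)) := by gcongr
        _ = _ := by
          rw [annulusScale, Real.sqrt_mul hd.le]
          have := Real.sqrt_pos.2 hd
          have := Real.sqrt_pos.2 (zero_lt_one.trans_le hL)
          field_simp
  simpa using hsub.add (tendsto_dyadicMean_cexp_mainSum hδpos hδ hδX ξ)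

theorem tendsto_map_dyadicMeasure_Ioc {T : ℝ → ℝ → ℝ} (hT : ∀ X, Measurable (T X))
    (h : ∀ ξ : ℝ, Tendsto (fun X => dyadicMean X fun x =>
      Complex.exp (Complex.I * (ξ * T X x : ℝ))) atTop (𝓝 (exp (-(ξ ^ 2 / 2)) : ℂ)))
    {α β : ℝ} (hαβ : α < β) :
    Tendsto (fun X => dyadicMeasure X (T X ⁻¹' Set.Ioc α β)) atTop
      (𝓝 (ProbabilityTheory.gaussianReal 0 1 (Set.Ioc α β))) := by
  refine tendsto_of_seq_tendsto fun u hu => ?_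
  have hpos : ∀ n, 0 < max (u n) 1 := fun n => zero_lt_one.trans_le (le_max_right _ _)
  have hu' : ∀ᶠ n in atTop, max (u n) 1 = u n := by
    filter_upwards [hu.eventually_ge_atTop 1] with n hn using max_eq_left hn
  have hprob : ∀ n, IsProbabilityMeasure ((dyadicMeasure (max (u n) 1)).map (T (max (u n) 1))) :=
    fun n => by
      have := isProbabilityMeasure_dyadicMeasure (hpos n)
      exact Measure.isProbabilityMeasure_map (hT _).aemeasurable
  have hconv : Tendsto (β := ProbabilityMeasure ℝ) (fun n => ⟨_, hprob n⟩) atTop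
      (𝓝 ⟨ProbabilityTheory.gaussianReal 0 1, inferInstance⟩) := by
    refine ProbabilityMeasure.tendsto_iff_tendsto_charFun.2 fun ξ => ?_
    have hgauss : charFun (ProbabilityTheory.gaussianReal 0 1) ξ = (exp (-(ξ ^ 2 / 2)) : ℂ) := by
      rw [ProbabilityTheory.charFun_gaussianReal]
      simp
    simp only [ProbabilityMeasure.coe_mk, hgauss]
    refine ((h ξ).comp hu).congr' ?_
    filter_upwards [hu'] with n hn
    rw [charFun_apply_real, integral_map (hT _).aemeasurable (by fun_prop), Function.comp_apply,
      dyadicMean_eq_integral (hn ▸ hpos n), hn]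
    congr 1
    ext x
    push_cast
    ring_nf
  have hnull : ProbabilityTheory.gaussianReal 0 1 (frontier (Set.Ioc α β)) = 0 := by
    have := ProbabilityTheory.nullSingletonClass_gaussianReal (μ := 0) (v := 1) one_ne_zero
    rw [frontier_Ioc hαβ]
    exact (Set.toFinite _).measure_zero _
  refine (ProbabilityMeasure.tendsto_measure_of_null_frontier_of_tendsto' hconv hnull).congr' ?_
  filter_upwards [hu'] with n hn
  rw [ProbabilityMeasure.coe_mk, Measure.map_apply (hT _) measurableSet_Ioc, Function.comp_apply,
    hn]

theorem toReal_gaussianReal_Ioc {α β : ℝ} (hαβ : α ≤ β) :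
    (ProbabilityTheory.gaussianReal 0 1 (Set.Ioc α β)).toReal =
      1 / √(2 * π) * ∫ t in α..β, exp (-t ^ 2 / 2) := by
  rw [ProbabilityTheory.gaussianReal_apply_eq_integral _ one_ne_zero, ENNReal.toReal_ofReal
    (integral_nonneg fun x => ProbabilityTheory.gaussianPDFReal_nonneg _ _ _),
    ← intervalIntegral.integral_of_le hαβ, ← intervalIntegral.integral_const_mul]
  simp [ProbabilityTheory.gaussianPDFReal_def]

theorem toReal_dyadicMeasure {X : ℝ} (hX : 0 < X) {s : Set ℝ} (hs : MeasurableSet s) :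
    (dyadicMeasure X s).toReal = (volume {x | x ∈ Set.Icc X (2 * X) ∧ x ∈ s}).toReal / X := by
  rw [dyadicMeasure, restrict_Ioc_eq_restrict_Icc, Measure.smul_apply, Measure.restrict_apply hs,
    smul_eq_mul, ENNReal.toReal_mul, ENNReal.toReal_ofReal (by positivity), div_eq_inv_mul,
    Set.inter_comm]
  rfl

/-- Central limit theorem for lattice point counts in thin annuli
(Hughes–Rudnick; the case `K = ℚ(i)` of the main theorem). -/
theorem lattice_points_thin_annuli_clt
    (δ : ℝ → ℝ) (hδpos : ∀ X, 0 < δ X)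
    (hδ : Tendsto δ atTop (𝓝 0))
    (hδX : Tendsto (fun X : ℝ => Real.log (1 / δ X) / Real.log X) atTop (𝓝 0)) :
    ∀ α β : ℝ, α < β →
      Tendsto
        (fun X : ℝ =>
          (volume {x : ℝ | x ∈ Set.Icc X (2 * X) ∧
              ((latticeCount (x + δ X) : ℝ) - (latticeCount x : ℝ) -
                  π * ((x + δ X) ^ 2 - x ^ 2)) /
                (4 * Real.sqrt x * Real.sqrt (δ X * Real.log (1 / δ X)))
                ∈ Set.Ioc α β}).toReal / X)
        atTop
        (𝓝 ((1 / Real.sqrt (2 * π)) * ∫ t in α..β, Real.exp (-t ^ 2 / 2))) := by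
  intro α β hαβ
  have hT : ∀ X, Measurable fun x => annulusDev (δ X) x / annulusScale (δ X) := fun X =>
    (measurable_annulusDev _).div_const _
  have h := (ENNReal.tendsto_toReal (measure_ne_top _ _)).comp (tendsto_map_dyadicMeasure_Ioc hT
    (tendsto_dyadicMean_cexp_annulusDev hδpos hδ hδX) hαβ)
  rw [toReal_gaussianReal_Ioc hαβ.le] at h
  refine h.congr' ?_
  filter_upwards [eventually_gt_atTop 0] with X hX
  rw [Function.comp_apply, toReal_dyadicMeasure hX (hT X measurableSet_Ioc)]
  congr! 5 with x
  rw [Set.mem_preimage, annulusDev, annulusScale, div_div]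
  ring_nf
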